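/- (Main theorem, Tate-module version) Let V1, V2 be finite-dimensional representations over an algebraically closed field F of characteristic 0 of a group Γ, such that the Zariski closure G12 of the image of Γ in GL(V1 ⊕ V2) is reductive with identity component G, and V1, V2 restricted to G are minuscule. If there exists a semisimple element t ∈ G generating a Zariski-dense subgroup of a maximal torus T of G, and an integer m ≥ 1 with Hom(V1, V2)^{t^m} ≠ 0, then Hom_G(V1, V2) ≠ 0. -/

import Mathlib

/-! Concrete model of linear algebraic groups: Zariski-closed subgroups of `GL n F`. -/

variable {F : Type} [Field F]

/-- A subset of `GL n F` is Zariski closed if it is the vanishing locus (inside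
`GL n F`) of a family of polynomials in the matrix entries. -/
def IsZClosed {n : ℕ} (S : Set (GL (Fin n) F)) : Prop :=
  ∃ I : Set (MvPolynomial (Fin n × Fin n) F),
    S = {g | ∀ p ∈ I, MvPolynomial.eval
      (fun q => ((g : GL (Fin n) F) : Matrix (Fin n) (Fin n) F) q.1 q.2) p = 0}

/-- Connectedness of a subset of `GL n F` for the Zariski topology. -/
def IsZConnected {n : ℕ} (S : Set (GL (Fin n) F)) : Prop :=
  ∀ C₁ C₂ : Set (GL (Fin n) F), IsZClosed C₁ → IsZClosed C₂ → S ⊆ C₁ ∪ C₂ →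
    (S ∩ C₁).Nonempty → (S ∩ C₂).Nonempty → (S ∩ (C₁ ∩ C₂)).Nonempty

/-- `C` is the Zariski closure of `S`. -/
def IsZClosure {n : ℕ} (S C : Set (GL (Fin n) F)) : Prop :=
  IsZClosed C ∧ S ⊆ C ∧ ∀ D : Set (GL (Fin n) F), IsZClosed D → S ⊆ D → C ⊆ D

/-- An element of `GL n F` is unipotent. -/
def IsUnipotentElem {n : ℕ} (g : GL (Fin n) F) : Prop :=
  ((g : Matrix (Fin n) (Fin n) F) - 1) ^ n = 0

/-- An element of `GL n F` is semisimple (diagonalizable; over an algebraically closed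
field of characteristic zero this is the usual notion). -/
def IsSemisimpleElem {n : ℕ} (g : GL (Fin n) F) : Prop :=
  ∃ P : GL (Fin n) F,
    Matrix.IsDiag ((P⁻¹ * g * P : GL (Fin n) F) : Matrix (Fin n) (Fin n) F)

/-- A closed subgroup `G` is reductive if its only Zariski-closed connected normal
subgroup consisting of unipotent elements is trivial. -/
def IsReductive {n : ℕ} (G : Subgroup (GL (Fin n) F)) : Prop :=
  ∀ H : Subgroup (GL (Fin n) F), H ≤ G → IsZClosed (H : Set (GL (Fin n) F)) →
    IsZConnected (H : Set (GL (Fin n) F)) → (∀ h ∈ H, IsUnipotentElem h) →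
    (∀ g ∈ G, ∀ h ∈ H, g * h * g⁻¹ ∈ H) → H = ⊥

/-- A torus: a Zariski-closed connected commutative subgroup all of whose elements are
semisimple. -/
def IsTorus {n : ℕ} (T : Subgroup (GL (Fin n) F)) : Prop :=
  IsZClosed (T : Set (GL (Fin n) F)) ∧ IsZConnected (T : Set (GL (Fin n) F)) ∧
    (∀ t ∈ T, IsSemisimpleElem t) ∧ ∀ a ∈ T, ∀ b ∈ T, a * b = b * a

/-- A maximal torus of `G`. -/
def IsMaximalTorus {n : ℕ} (G T : Subgroup (GL (Fin n) F)) : Prop :=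
  T ≤ G ∧ IsTorus T ∧ ∀ T' : Subgroup (GL (Fin n) F), T' ≤ G → IsTorus T' → T ≤ T' → T' = T

/-- `G0` is the identity component of `G`. -/
def IsIdentityComponent {n : ℕ} (G0 G : Subgroup (GL (Fin n) F)) : Prop :=
  G0 ≤ G ∧ IsZClosed (G0 : Set (GL (Fin n) F)) ∧ IsZConnected (G0 : Set (GL (Fin n) F)) ∧
    ∀ H : Subgroup (GL (Fin n) F), H ≤ G → IsZClosed (H : Set (GL (Fin n) F)) →
      IsZConnected (H : Set (GL (Fin n) F)) → H ≤ G0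

/-- A representation `ρ : G → GL m F` is algebraic: its matrix entries are polynomial
functions of the matrix entries of `g` and of `g⁻¹`. -/
def IsAlgebraicRep {n m : ℕ} (G : Subgroup (GL (Fin n) F)) (ρ : G →* GL (Fin m) F) : Prop :=
  ∀ i j : Fin m, ∃ p : MvPolynomial ((Fin n × Fin n) ⊕ (Fin n × Fin n)) F, ∀ g : G,
    ((ρ g : GL (Fin m) F) : Matrix (Fin m) (Fin m) F) i j =
      MvPolynomial.eval (Sum.elim
        (fun q => (((g : GL (Fin n) F)) : Matrix (Fin n) (Fin n) F) q.1 q.2)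
        (fun q => (((g : GL (Fin n) F)⁻¹) : Matrix (Fin n) (Fin n) F) q.1 q.2)) p

/-- A submodule invariant under the representation. -/
def RepInvariant {n m : ℕ} {G : Subgroup (GL (Fin n) F)} (ρ : G →* GL (Fin m) F)
    (U : Submodule F (Fin m → F)) : Prop :=
  ∀ g : G, ∀ v ∈ U, Matrix.mulVec ((ρ g : GL (Fin m) F) : Matrix (Fin m) (Fin m) F) v ∈ U

/-- `U` is a nonzero irreducible subrepresentation. -/
def IsIrreducibleOn {n m : ℕ} {G : Subgroup (GL (Fin n) F)} (ρ : G →* GL (Fin m) F)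
    (U : Submodule F (Fin m → F)) : Prop :=
  U ≠ ⊥ ∧ RepInvariant ρ U ∧
    ∀ U' : Submodule F (Fin m → F), U' ≤ U → RepInvariant ρ U' → U' = ⊥ ∨ U' = U

/-- `v ∈ U` is a weight vector for the torus `T` with weight (character) `c`; the
character is recorded as a function on all of `GL n F`, only its values on `T`
being relevant. -/
def IsWeightVector {n m : ℕ} {G : Subgroup (GL (Fin n) F)} (T : Subgroup (GL (Fin n) F))
    (ρ : G →* GL (Fin m) F) (U : Submodule F (Fin m → F)) (c : GL (Fin n) F → F)
    (v : Fin m → F) : Prop :=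
  v ∈ U ∧ v ≠ 0 ∧ ∀ t : G, (t : GL (Fin n) F) ∈ T →
    Matrix.mulVec ((ρ t : GL (Fin m) F) : Matrix (Fin m) (Fin m) F) v = c t • v

/-- The subrepresentation `U` is minuscule: the Weyl group `N_G(T)/T` acts transitively
on its `T`-weights. -/
def IsMinusculeOn {n m : ℕ} (G : Subgroup (GL (Fin n) F)) (T : Subgroup (GL (Fin n) F))
    (ρ : G →* GL (Fin m) F) (U : Submodule F (Fin m → F)) : Prop :=
  ∀ (c c' : GL (Fin n) F → F) (v v' : Fin m → F),
    IsWeightVector T ρ U c v → IsWeightVector T ρ U c' v' →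
    ∃ w : GL (Fin n) F, w ∈ G ∧ w ∈ Subgroup.normalizer T ∧
      ∀ t ∈ T, c' t = c (w * t * w⁻¹)

/-- A representation is minuscule if all its irreducible factors are. -/
def IsMinuscule {n m : ℕ} (G : Subgroup (GL (Fin n) F)) (T : Subgroup (GL (Fin n) F))
    (ρ : G →* GL (Fin m) F) : Prop :=
  ∀ U : Submodule F (Fin m → F), IsIrreducibleOn ρ U → IsMinusculeOn G T ρ U

theorem lie_top_eq_top (K L : Type) [Field K] [LieRing L] [LieAlgebra K L]
    [FiniteDimensional K L] [LieAlgebra.IsKilling K L] :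
    LieAlgebra.derivedSeries K L 1 = ⊤ := by
  set D := LieAlgebra.derivedSeries K L 1 with hD
  have hc : D.killingCompl = ⊥ := by
    rw [eq_bot_iff]
    intro x hx
    rw [LieIdeal.mem_killingCompl] at hx
    have : ∀ y : L, ⁅x, y⁆ = 0 := by
      intro y
      have h0 : ⁅x, y⁆ ∈ LieIdeal.killingCompl K L ⊤ := by
        rw [LieIdeal.mem_killingCompl]
        intro z _
        rw [LieModule.traceForm_comm, LieModule.traceForm_apply_lie_apply,
          LieModule.traceForm_comm]
        apply hx
        rw [hD]
        exact LieSubmodule.lie_mem_lie (LieSubmodule.mem_top _) (LieSubmodule.mem_top _)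
      rw [LieAlgebra.IsKilling.killingCompl_top_eq_bot] at h0
      simpa using h0
    have hz : x ∈ LieAlgebra.center K L := by
      rw [LieModule.mem_maxTrivSubmodule]
      intro y
      rw [← lie_skew, this, neg_zero]
    rw [LieAlgebra.center_eq_bot] at hz
    exact hz
  have := D.isCompl_killingCompl
  rw [hc] at this
  simpa using this.sup_eq_top

theorem trivial_of_traceForm_zero (K L M : Type) [Field K] [CharZero K] [LieRing L]
    [LieAlgebra K L]
    [FiniteDimensional K L] [LieAlgebra.IsKilling K L] [AddCommGroup M] [Module K M]
    [LieRingModule L M] [LieModule K L M] [FiniteDimensional K M]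
    (h : LieModule.traceForm K L M = 0) : ∀ (x : L) (m : M), ⁅x, m⁆ = 0 := by
  have h1 := LieModule.isNilpotent_derivedSeries_of_traceForm_eq_zero h
  have hnil : LieModule.IsNilpotent L M := by
    rw [LieModule.isNilpotent_iff_forall' (R := K)] at h1 ⊢
    intro x
    have hx : x ∈ LieAlgebra.derivedSeries K L 1 := by
      rw [lie_top_eq_top]; exact LieSubmodule.mem_top _
    exact h1 ⟨x, hx⟩
  have key : ∀ k, LieModule.lowerCentralSeries K L M 1 ≤
      LieModule.lowerCentralSeries K L M (k+1) := by
    intro k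
    induction k with
    | zero => exact le_rfl
    | succ k ih =>
      have h2 : LieModule.lowerCentralSeries K L M 1 ≤ LieModule.lowerCentralSeries K L M 2 := by
        rw [LieModule.lowerCentralSeries_succ, LieSubmodule.lieIdeal_oper_eq_span,
          LieSubmodule.lieSpan_le]
        rintro _ ⟨⟨x, hx⟩, ⟨m, hm⟩, rfl⟩
        have hx : x ∈ LieAlgebra.derivedSeries K L 1 := by
          rw [lie_top_eq_top]; exact LieSubmodule.mem_top _
        change x ∈ ⁅(⊤ : LieIdeal K L), (⊤ : LieIdeal K L)⁆ at hx
        rw [← LieSubmodule.mem_toSubmodule, LieSubmodule.lieIdeal_oper_eq_linear_span'] at hx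
        change ⁅x, m⁆ ∈ LieModule.lowerCentralSeries K L M 2
        clear hm
        rename_i hx0
        clear hx0
        induction hx using Submodule.span_induction with
        | mem x hx =>
          obtain ⟨a, -, b, -, rfl⟩ := hx
          rw [lie_lie]
          have : ∀ a b : L, ⁅a, ⁅b, m⁆⁆ ∈ LieModule.lowerCentralSeries K L M 2 := by
            intro a b
            apply LieSubmodule.lie_mem_lie (LieSubmodule.mem_top _)
            apply LieSubmodule.lie_mem_lie (LieSubmodule.mem_top _) (LieSubmodule.mem_top _)
          exact sub_mem (this _ _) (this _ _)
        | zero => simp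
        | add x y _ _ hx hy => rw [add_lie]; exact add_mem hx hy
        | smul c x _ hx => rw [smul_lie]; exact (LieModule.lowerCentralSeries K L M 2).toSubmodule.smul_mem _ hx
      refine h2.trans ?_
      rw [LieModule.lowerCentralSeries_succ K L M (k+1), LieModule.lowerCentralSeries_succ K L M 1]
      exact LieSubmodule.mono_lie_right _ ih
  obtain ⟨k, hk⟩ := (LieModule.isNilpotent_iff K L M).mp hnil
  intro x m
  have : ⁅x, m⁆ ∈ LieModule.lowerCentralSeries K L M 1 :=
    LieSubmodule.lie_mem_lie (LieSubmodule.mem_top _) (LieSubmodule.mem_top _)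
  have h3 := LieModule.antitone_lowerCentralSeries K L M (Nat.le_succ k) (key k this)
  rw [hk] at h3
  simpa using h3

/-- The Casimir element package. -/
theorem exists_casimir (K L M : Type) [Field K] [CharZero K] [LieRing L]
    [LieAlgebra K L]
    [FiniteDimensional K L] [LieAlgebra.IsKilling K L] [AddCommGroup M] [Module K M]
    [LieRingModule L M] [LieModule K L M] [FiniteDimensional K M]
    (h : LieModule.traceForm K L M ≠ 0) :
    ∃ (ι : Type) (_ : Fintype ι) (x y : ι → L),
      (∀ (z : L) (β : L →ₗ[K] L →ₗ[K] M), ∑ i, β ⁅z, x i⁆ (y i) + ∑ i, β (x i) ⁅z, y i⁆ = 0) ∧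
      (∑ i, LinearMap.trace K M (LieModule.toEnd K L M (x i) * LieModule.toEnd K L M (y i)) ≠ 0)
       := by
  set B := LieModule.traceForm K L M with hB
  -- the kernel ideal
  let I : LieIdeal K L :=
    { LinearMap.ker B with
      lie_mem := by
        intro x m hm
        have hm' : B m = 0 := hm
        change B ⁅x, m⁆ = 0
        ext z
        rw [hB, LieModule.traceForm_comm, ← LieModule.traceForm_apply_lie_apply,
          LieModule.traceForm_comm, ← hB, hm']
        rfl }
  have hI : ∀ x, x ∈ I ↔ B x = 0 := fun x => Iff.rfl
  set J := I.killingCompl with hJ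
  have hIJ := I.isCompl_killingCompl
  have hJne : J ≠ ⊥ := by
    intro h0
    rw [← hJ, h0] at hIJ
    have : I = ⊤ := by simpa using hIJ.sup_eq_top
    apply h
    ext x z
    have : x ∈ I := by rw [this]; exact LieSubmodule.mem_top _
    rw [(hI x).mp this]
    rfl
  let BJ : LinearMap.BilinForm K J := B.restrict J.toSubmodule
  have hBJ : ∀ x y : J, BJ x y = B x y := fun x y => rfl
  have hnd : BJ.Nondegenerate := by
    have hsymm : BJ.IsSymm := ⟨fun x y => by
      simp only [hBJ]; exact LieModule.traceForm_comm K L M _ _⟩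
    refine (hsymm.isRefl.nondegenerate_iff_separatingLeft).mpr ?_
    intro x hx
    have hxI : (x : L) ∈ I := by
      rw [hI]
      ext z
      have hz : z ∈ I ⊔ J := by rw [hIJ.sup_eq_top]; exact LieSubmodule.mem_top _
      obtain ⟨a, ha, b, hb, rfl⟩ := (LieSubmodule.mem_sup _ _ _).mp hz
      have h1 : B x a = 0 := by
        rw [hB, LieModule.traceForm_comm, ← hB, (hI a).mp ha]; rfl
      have h2 : B x b = 0 := hx ⟨b, hb⟩
      simp [h1, h2]
    have : (x : L) ∈ I ⊓ J := ⟨hxI, x.2⟩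
    rw [hIJ.inf_eq_bot] at this
    ext
    simpa using this
  have hfd : FiniteDimensional K J := inferInstanceAs (FiniteDimensional K J.toSubmodule)
  let b : Module.Basis (Fin (Module.finrank K J)) K J := Module.finBasis K J
  let d := BJ.dualBasis hnd b
  refine ⟨Fin (Module.finrank K J), inferInstance, fun i => d i, fun i => b i, ?_, ?_⟩
  · intro z β
    have e1 : ∀ i, ⁅z, (d i : L)⁆ = ∑ j, B ⁅z, (d i : L)⁆ (b j) • (d j : L) := by
      intro i
      have := d.sum_repr ⁅z, d i⁆
      have h2 := congrArg (fun u : J => (u : L)) this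
      simp only [LieSubmodule.coe_bracket] at h2
      refine h2.symm.trans ?_
      simp only [AddSubmonoidClass.coe_finsetSum, LieSubmodule.coe_smul]
      apply Finset.sum_congr rfl
      intro j _
      rw [LinearMap.BilinForm.dualBasis_repr_apply, hBJ]
      rfl
    have e2 : ∀ i, ⁅z, (b i : L)⁆ = ∑ j, B (d j) ⁅z, (b i : L)⁆ • (b j : L) := by
      intro i
      have := b.sum_repr ⁅z, b i⁆
      have h2 := congrArg (fun u : J => (u : L)) this
      simp only [LieSubmodule.coe_bracket] at h2
      refine h2.symm.trans ?_
      simp only [AddSubmonoidClass.coe_finsetSum, LieSubmodule.coe_smul]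
      apply Finset.sum_congr rfl
      intro j _
      congr 1
      have h3 : BJ (d j) (⁅z, b i⁆) = (b.repr ⁅z, b i⁆) j := by
        conv_lhs => rw [← this]
        rw [map_sum]
        simp only [map_smul, d, LinearMap.BilinForm.apply_dualBasis_left]
        simp
      rw [← h3, hBJ]
      rfl
    have e3 : ∑ i, β ⁅z, (d i : L)⁆ (b i) =
        ∑ i, ∑ j, B ⁅z, (d i : L)⁆ (b j) • β (d j) (b i) := by
      apply Finset.sum_congr rfl
      intro i _
      conv_lhs => rw [e1 i]
      simp
    have e4 : ∑ i, β (d i) ⁅z, (b i : L)⁆ =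
        ∑ i, ∑ j, B (d i) ⁅z, (b j : L)⁆ • β (d j) (b i) := by
      rw [Finset.sum_comm]
      apply Finset.sum_congr rfl
      intro i _
      conv_lhs => rw [e2 i]
      simp
    rw [e3, e4, ← Finset.sum_add_distrib]
    apply Finset.sum_eq_zero
    intro i _
    rw [← Finset.sum_add_distrib]
    apply Finset.sum_eq_zero
    intro j _
    rw [← add_smul]
    have : B ⁅z, (d i : L)⁆ (b j) = - B (d i) ⁅z, (b j : L)⁆ := by
      rw [hB, ← lie_skew, map_neg, LinearMap.neg_apply, LieModule.traceForm_apply_lie_apply]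
    rw [this, neg_add_cancel, zero_smul]
  · have h1 : ∀ i, LinearMap.trace K M (LieModule.toEnd K L M (d i : L) * LieModule.toEnd K L M (b i : L)) = 1 := by
      intro i
      have := LinearMap.BilinForm.apply_dualBasis_left hnd b i i
      rw [if_pos rfl, hBJ] at this
      exact this
    simp only [h1]
    simp only [Finset.sum_const, Finset.card_univ, Fintype.card_fin, nsmul_eq_mul, mul_one]
    rw [Nat.cast_ne_zero]
    intro h0
    apply hJne
    rw [Module.finrank_zero_iff] at h0
    rw [eq_bot_iff]
    intro x hx
    have : (⟨x, hx⟩ : J) = 0 := Subsingleton.elim _ _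
    simpa using congrArg Subtype.val this

theorem H1_vanish_aux (K L : Type) [Field K] [CharZero K] [LieRing L]
    [LieAlgebra K L] [FiniteDimensional K L] [LieAlgebra.IsKilling K L] (n : ℕ) :
    ∀ (M : Type) [AddCommGroup M] [Module K M]
    [LieRingModule L M] [LieModule K L M] [FiniteDimensional K M] (_ : Module.finrank K M = n)
    (c : L →ₗ[K] M) (_ : ∀ x y, c ⁅x, y⁆ = ⁅x, c y⁆ - ⁅y, c x⁆), ∃ m, ∀ x, c x = ⁅x, m⁆ := by
  induction n using Nat.strong_induction_on with
  | _ n ih =>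
  intro M _ _ _ _ _ hn c hc
  by_cases h : LieModule.traceForm K L M = 0
  · have ht := trivial_of_traceForm_zero K L M h
    refine ⟨0, fun x => ?_⟩
    rw [lie_zero]
    have hx : x ∈ LieAlgebra.derivedSeries K L 1 := by
      rw [lie_top_eq_top]; exact LieSubmodule.mem_top _
    change x ∈ ⁅(⊤ : LieIdeal K L), (⊤ : LieIdeal K L)⁆ at hx
    rw [← LieSubmodule.mem_toSubmodule, LieSubmodule.lieIdeal_oper_eq_linear_span'] at hx
    induction hx using Submodule.span_induction with
    | mem x hx =>
      obtain ⟨a, -, b, -, rfl⟩ := hx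
      rw [hc, ht, ht, sub_zero]
    | zero => simp
    | add x y _ _ hx hy => rw [map_add, hx, hy, add_zero]
    | smul a x _ hx => rw [map_smul, hx, smul_zero]
  obtain ⟨ι, _, x, y, hinv, htr⟩ := exists_casimir K L M h
  let φ := LieModule.toEnd K L M
  let C : Module.End K M := ∑ i, φ (x i) * φ (y i)
  have hCap : ∀ m, C m = ∑ i, ⁅x i, ⁅y i, m⁆⁆ := by
    intro m; simp [C, φ, LinearMap.sum_apply]
  have hCcomm : ∀ (z : L) (m : M), C ⁅z, m⁆ = ⁅z, C m⁆ := by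
    intro z m
    let β : L →ₗ[K] L →ₗ[K] M := LinearMap.mk₂ K (fun a b => ⁅a, ⁅b, m⁆⁆)
      (by simp) (by simp) (by simp) (by simp)
    have := hinv z β
    simp only [β, LinearMap.mk₂_apply] at this
    rw [hCap, hCap, lie_sum]
    have e : ∀ i, ⁅z, ⁅x i, ⁅y i, m⁆⁆⁆ = ⁅⁅z, x i⁆, ⁅y i, m⁆⁆ + ⁅x i, ⁅⁅z, y i⁆, m⁆⁆
        + ⁅x i, ⁅y i, ⁅z, m⁆⁆⁆ := by
      intro i
      rw [leibniz_lie z (x i), leibniz_lie z (y i) m, lie_add, add_assoc]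
    simp_rw [e]
    rw [Finset.sum_add_distrib, Finset.sum_add_distrib, this, zero_add]
  let m0 : M := ∑ i, ⁅x i, c (y i)⁆
  have hm0 : ∀ z, ⁅z, m0⁆ = C (c z) := by
    intro z
    let β : L →ₗ[K] L →ₗ[K] M := LinearMap.mk₂ K (fun a b => ⁅a, c b⁆)
      (by simp) (by simp) (by simp) (by simp)
    have := hinv z β
    simp only [β, LinearMap.mk₂_apply] at this
    rw [hCap, lie_sum]
    have e : ∀ i, ⁅z, ⁅x i, c (y i)⁆⁆ = ⁅⁅z, x i⁆, c (y i)⁆ + ⁅x i, c ⁅z, y i⁆⁆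
        + ⁅x i, ⁅y i, c z⁆⁆ := by
      intro i
      rw [leibniz_lie z (x i), hc, lie_sub]
      abel
    simp_rw [e]
    rw [Finset.sum_add_distrib, Finset.sum_add_distrib, this, zero_add]
  have hCnn : ¬ IsNilpotent C := by
    intro hnil
    apply htr
    have := LinearMap.isNilpotent_trace_of_isNilpotent hnil
    have h2 := this.eq_zero
    simpa [C, φ, map_sum] using h2
  have hpow : ∀ (k : ℕ) (z : L) (m : M), (C ^ k) ⁅z, m⁆ = ⁅z, (C ^ k) m⁆ := by
    intro k z
    induction k with
    | zero => simp
    | succ k ihk => intro m; rw [pow_succ', Module.End.mul_apply, ihk, hCcomm]; rfl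
  -- Fitting
  obtain ⟨N0, hN0⟩ := Filter.eventually_atTop.mp (LinearMap.eventually_isCompl_ker_pow_range_pow C)
  have hN := hN0 (N0 + 1) (Nat.le_succ _)
  set N := N0 + 1
  have hmem : (C ^ N0) m0 ∈ LinearMap.ker (C ^ N) ⊔ LinearMap.range (C ^ N) := by
    rw [hN.sup_eq_top]; trivial
  obtain ⟨a, ha, b, ⟨m1, rfl⟩, hab⟩ := Submodule.mem_sup.mp hmem
  have hker : ∀ z, (C ^ N) (c z - ⁅z, m1⁆) = 0 := by
    intro z
    have h1 : (C ^ N) (c z) = ⁅z, (C ^ N0) m0⁆ := by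
      rw [← hpow, hm0]; simp [N, pow_succ]
    rw [← hab, lie_add, ← hpow] at h1
    have h2 : ⁅z, a⁆ ∈ LinearMap.ker (C ^ N) ⊓ LinearMap.range (C ^ N) := by
      constructor
      · change (C ^ N) _ = 0
        rw [hpow, LinearMap.mem_ker.mp ha, lie_zero]
      · refine ⟨c z - ⁅z, m1⁆, ?_⟩
        rw [map_sub, h1]; abel
    rw [hN.inf_eq_bot] at h2
    have h3 : ⁅z, a⁆ = 0 := by simpa using h2
    rw [map_sub, h1, h3, zero_add, sub_self]
  let M0 : LieSubmodule K L M :=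
    { LinearMap.ker (C ^ N) with
      lie_mem := by
        intro z m hm
        change (C ^ N) _ = 0
        have hm' : (C ^ N) m = 0 := hm
        rw [hpow, hm', lie_zero] }
  have hM0 : FiniteDimensional K M0 := inferInstanceAs (FiniteDimensional K M0.toSubmodule)
  have hlt : Module.finrank K M0 < n := by
    rw [← hn]
    apply Submodule.finrank_lt (s := M0.toSubmodule)
    intro htop
    apply hCnn
    refine ⟨N, LinearMap.ker_eq_top.mp htop⟩
  let c' : L →ₗ[K] M0 :=
    { toFun := fun z => ⟨c z - ⁅z, m1⁆, hker z⟩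
      map_add' := by intro u v; ext; simp; abel
      map_smul' := by intro u v; ext; simp [smul_sub] }
  obtain ⟨m2, hm2⟩ := ih _ hlt M0 rfl c' (by
    intro u v
    ext
    simp only [c', LinearMap.coe_mk, AddHom.coe_mk, LieSubmodule.coe_sub, LieSubmodule.coe_bracket,
      hc, lie_sub]
    rw [leibniz_lie u v, ]
    abel)
  refine ⟨m1 + m2, fun z => ?_⟩
  have := congrArg Subtype.val (hm2 z)
  simp only [c', LinearMap.coe_mk, AddHom.coe_mk, LieSubmodule.coe_bracket] at this
  rw [lie_add, ← this]; abel

/-- Whitehead's first lemma. -/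
theorem H1_vanish (K L M : Type) [Field K] [CharZero K] [LieRing L]
    [LieAlgebra K L] [FiniteDimensional K L] [LieAlgebra.IsKilling K L] 
    [AddCommGroup M] [Module K M]
    [LieRingModule L M] [LieModule K L M] [FiniteDimensional K M] 
    (c : L →ₗ[K] M) (hc : ∀ x y, c ⁅x, y⁆ = ⁅x, c y⁆ - ⁅y, c x⁆) : ∃ m, ∀ x, c x = ⁅x, m⁆ :=
  H1_vanish_aux K L _ M rfl c hc

section LiePart
attribute [local instance] LieRing.ofAssociativeRing

theorem trivialRadical_quotient (K L : Type) [Field K] [LieRing L] [LieAlgebra K L]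
    [FiniteDimensional K L] (h : LieAlgebra.radical K L = LieAlgebra.center K L) :
    LieAlgebra.HasTrivialRadical K (L ⧸ LieAlgebra.center K L) := by
  rw [LieAlgebra.hasTrivialRadical_iff_no_abelian_ideals]
  intro I hI
  let I' : LieIdeal K L :=
    { carrier := {x | (LieSubmodule.Quotient.mk x : L ⧸ LieAlgebra.center K L) ∈ I}
      add_mem' := by
        intro a b ha hb
        exact I.add_mem ha hb
      zero_mem' := I.zero_mem
      smul_mem' := by
        intro c x hx
        exact I.toSubmodule.smul_mem c hx
      lie_mem := by
        intro x m hm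
        have h5 := I.lie_mem (x := (LieSubmodule.Quotient.mk x : L ⧸ LieAlgebra.center K L)) hm
        rw [← LieSubmodule.Quotient.mk_bracket] at h5
        exact h5 }
  have hI' : ∀ x, x ∈ I' ↔ (LieSubmodule.Quotient.mk x : L ⧸ LieAlgebra.center K L) ∈ I :=
    fun x => Iff.rfl
  have hbr : ∀ a b : I', ⁅(a : L), (b : L)⁆ ∈ LieAlgebra.center K L := by
    intro a b
    rw [← LieSubmodule.Quotient.mk_eq_zero', LieSubmodule.Quotient.mk_bracket]
    have := hI.trivial ⟨_, a.2⟩ ⟨_, b.2⟩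
    exact congrArg Subtype.val this
  have hsolv : LieAlgebra.IsSolvable I' := by
    refine LieAlgebra.IsSolvable.mk (R := K) (k := 2) ?_
    have h1 : ∀ x ∈ LieAlgebra.derivedSeries K I' 1, (x : L) ∈ LieAlgebra.center K L := by
      intro x hx
      change x ∈ ⁅(⊤ : LieIdeal K I'), (⊤ : LieIdeal K I')⁆ at hx
      rw [← LieSubmodule.mem_toSubmodule, LieSubmodule.lieIdeal_oper_eq_linear_span'] at hx
      induction hx using Submodule.span_induction with
      | mem x hx =>
        obtain ⟨a, -, b, -, rfl⟩ := hx
        exact hbr a b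
      | zero => simp
      | add x y _ _ hx hy => exact add_mem hx hy
      | smul c x _ hx => exact (LieAlgebra.center K L).toSubmodule.smul_mem c hx
    change ⁅LieAlgebra.derivedSeries K I' 1, LieAlgebra.derivedSeries K I' 1⁆ = ⊥
    rw [eq_bot_iff, LieSubmodule.lie_le_iff]
    intro x hx y hy
    have h2 := h1 y hy
    rw [LieModule.mem_maxTrivSubmodule] at h2
    have h3 := h2 x
    rw [LieSubmodule.mem_bot]
    ext
    exact h3
  have hle : I' ≤ LieAlgebra.radical K L :=
    (LieAlgebra.LieIdeal.solvable_iff_le_radical K L I').mp hsolv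
  rw [h] at hle
  rw [eq_bot_iff]
  intro y hy
  obtain ⟨x, rfl⟩ := LieSubmodule.Quotient.surjective_mk' _ y
  have : x ∈ I' := hy
  rw [LieSubmodule.mem_bot, LieSubmodule.Quotient.mk_eq_zero]
  exact hle this

/-- `[L, rad L]` acts nilpotently on every finite dimensional module. -/
theorem nilpotent_of_mem_lie_radical (K L : Type) [Field K] [IsAlgClosed K] [CharZero K]
    [LieRing L] [LieAlgebra K L] [FiniteDimensional K L] (n : ℕ) :
    ∀ (M : Type) [AddCommGroup M] [Module K M] [LieRingModule L M] [LieModule K L M]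
      [FiniteDimensional K M] (_ : Module.finrank K M = n),
      ∀ y ∈ ⁅(⊤ : LieIdeal K L), LieAlgebra.radical K L⁆, ∃ k : ℕ, (LieModule.toEnd K L M y) ^ k = 0 := by
  induction n using Nat.strong_induction_on with
  | _ n ih =>
  intro M _ _ _ _ _ hn y hy
  by_cases hM : Nontrivial M
  swap
  · refine ⟨0, ?_⟩
    rw [not_nontrivial_iff_subsingleton] at hM
    ext m
    exact Subsingleton.elim _ _
  obtain ⟨χ, hχ⟩ : ∃ χ : Module.Dual K (LieAlgebra.radical K L),
      Nontrivial (LieModule.weightSpace M χ) :=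
    LieModule.exists_nontrivial_weightSpace_of_isSolvable K (LieAlgebra.radical K L) M
  let N : LieSubmodule K L M := LieModule.weightSpaceOfIsLieTower K M χ
  have hN : ∀ m ∈ N, ∀ (y : L) (hy : y ∈ LieAlgebra.radical K L), ⁅y, m⁆ = χ ⟨y, hy⟩ • m := by
    intro m hm
    simpa [N, LieModule.weightSpaceOfIsLieTower, LieModule.mem_weightSpace] using hm
  have hkill : ∀ m ∈ N, ⁅y, m⁆ = 0 := by
    intro m hm
    rw [← LieSubmodule.mem_toSubmodule, LieSubmodule.lieIdeal_oper_eq_linear_span'] at hy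
    induction hy using Submodule.span_induction with
    | mem x hx =>
      obtain ⟨a, -, b, hb, rfl⟩ := hx
      rw [lie_lie, hN m hm b hb, hN _ (N.lie_mem hm) b hb, lie_smul, sub_self]
    | zero => simp
    | add x y _ _ hx hy => rw [add_lie, hx, hy, add_zero]
    | smul c x _ hx => rw [smul_lie, hx, smul_zero]
  have hNfd : FiniteDimensional K (M ⧸ N) :=
    inferInstanceAs (FiniteDimensional K (M ⧸ N.toSubmodule))
  have hNpos : 0 < Module.finrank K N.toSubmodule := by
    have : Nontrivial N.toSubmodule := hχ
    exact Module.finrank_pos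
  have hlt : Module.finrank K (M ⧸ N) < n := by
    have := Submodule.finrank_quotient_add_finrank N.toSubmodule
    change Module.finrank K (M ⧸ N.toSubmodule) < n
    omega
  obtain ⟨k, hk⟩ := ih _ hlt (M ⧸ N) rfl y hy
  refine ⟨k + 1, ?_⟩
  have hq : ∀ (j : ℕ) (m : M), LieSubmodule.Quotient.mk' N (((LieModule.toEnd K L M y) ^ j) m)
      = ((LieModule.toEnd K L (M ⧸ N) y) ^ j) (LieSubmodule.Quotient.mk' N m) := by
    intro j
    induction j with
    | zero => simp
    | succ j ihj =>
      intro m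
      rw [pow_succ, pow_succ, Module.End.mul_apply, Module.End.mul_apply, ihj]
      simp
  ext m
  rw [pow_succ', Module.End.mul_apply, LieModule.toEnd_apply_apply]
  apply hkill
  rw [← LieSubmodule.Quotient.mk_eq_zero, hq, hk]
  rfl

variable {K V : Type} [Field K] [IsAlgClosed K] [CharZero K] [AddCommGroup V] [Module K V]
  [FiniteDimensional K V]

/-- common semisimple commuting family: stable complement -/
theorem exists_stable_compl (z : Set (Module.End K V)) (hcomm : ∀ a ∈ z, ∀ b ∈ z, a * b = b * a)
    (hss : ∀ a ∈ z, a.IsSemisimple) (W : Submodule K V) (hW : ∀ a ∈ z, ∀ w ∈ W, a w ∈ W) :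
    ∃ U : Submodule K V, (∀ a ∈ z, ∀ u ∈ U, a u ∈ U) ∧ IsCompl W U := by
  let B := Algebra.adjoin K z
  let _ : CommRing B :=
    { (inferInstance : Ring B) with
      mul_comm := (Algebra.isMulCommutative_adjoin K hcomm).is_comm.comm }
  have hBss : ∀ b ∈ B, b.IsSemisimple := by
    intro b hb
    have hcm : ∀ x ∈ B, ∀ y ∈ B, Commute x y := by
      intro x hx y hy
      have := mul_comm (⟨x, hx⟩ : B) ⟨y, hy⟩
      exact congrArg Subtype.val this
    refine Algebra.adjoin_induction (p := fun x _ => Module.End.IsSemisimple x)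
      (fun x hx => hss x hx) (fun r => ?_) (fun x y hx hy h1 h2 => ?_)
      (fun x y hx hy h1 h2 => ?_) hb
    · exact Module.End.isSemisimple_id.aeval (Polynomial.C r) |> fun h => by simpa using h
    · exact Module.End.IsSemisimple.add_of_commute (hcm x hx y hy) h1 h2
    · exact Module.End.IsSemisimple.mul_of_commute (hcm x hx y hy) h1 h2
  have hred : IsReduced B := by
    constructor
    rintro ⟨x, hx⟩ ⟨k, hk⟩
    have h1 : IsNilpotent x := ⟨k, by simpa using congrArg Subtype.val hk⟩
    ext1
    exact Module.End.eq_zero_of_isNilpotent_isSemisimple h1 (hBss x hx)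
  have hfin : Module.Finite K B := inferInstanceAs (FiniteDimensional K (Subalgebra.toSubmodule B))
  have hart : IsArtinianRing B := IsArtinianRing.of_finite K B
  have hsr : IsSemisimpleRing B := IsArtinianRing.isSemisimpleRing_of_isReduced B
  let _ : Module B V := Module.compHom V (B.val : B →+* Module.End K V)
  have hsmul : ∀ (b : B) (v : V), b • v = (b : Module.End K V) v := fun b v => rfl
  have hst : ∀ b ∈ B, ∀ w ∈ W, b w ∈ W := by
    intro b hb
    refine Algebra.adjoin_induction (p := fun x _ => ∀ w ∈ W, x w ∈ W)
      (fun x hx => hW x hx) (fun r => ?_) (fun x y hx hy h1 h2 => ?_)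
      (fun x y hx hy h1 h2 => ?_) hb
    · intro w hw
      simpa using W.smul_mem r hw
    · intro w hw; exact W.add_mem (h1 w hw) (h2 w hw)
    · intro w hw; exact h1 _ (h2 w hw)
  let W' : Submodule B V :=
    { W.toAddSubmonoid with smul_mem' := fun b w hw => hst b b.2 w hw }
  obtain ⟨U', hU'⟩ := exists_isCompl W'
  let U : Submodule K V :=
    { U'.toAddSubmonoid with
      smul_mem' := fun c u hu => by
        have h5 : ((algebraMap K B c : B) : Module.End K V) u ∈ U' :=
          U'.smul_mem (algebraMap K B c) hu
        simpa using h5 }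
  refine ⟨U, fun a ha u hu => ?_, ?_⟩
  · exact U'.smul_mem ⟨a, Algebra.subset_adjoin ha⟩ hu
  · rw [isCompl_iff, disjoint_iff, codisjoint_iff]
    constructor
    · rw [eq_bot_iff]
      intro x hx
      have : x ∈ W' ⊓ U' := hx
      rw [hU'.inf_eq_bot] at this
      simpa using this
    · rw [eq_top_iff]
      intro x _
      have : x ∈ W' ⊔ U' := by rw [hU'.sup_eq_top]; trivial
      obtain ⟨a, ha, b, hb, rfl⟩ := Submodule.mem_sup.mp this
      exact Submodule.mem_sup.mpr ⟨a, ha, b, hb, rfl⟩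


theorem isNilpotent_of_chain (f : Module.End K V) (F : ℕ → Submodule K V) (h0 : F 0 = ⊤)
    (hF : ∀ i, ∀ v ∈ F i, f v ∈ F (i + 1)) (k : ℕ) (hk : F k = ⊥) : IsNilpotent f := by
  refine ⟨k, ?_⟩
  have : ∀ j v, (f ^ j) v ∈ F j := by
    intro j v
    induction j with
    | zero => rw [h0]; trivial
    | succ j ih => rw [pow_succ', Module.End.mul_apply]; exact hF _ _ ih
  ext v
  have := this k v
  rw [hk] at this
  simpa using this

theorem reductive_structure (g : LieSubalgebra K (Module.End K V)) (A : Subalgebra K (Module.End K V))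
    (hstab : ∀ W : Submodule K V, (∀ X ∈ g, ∀ w ∈ W, X w ∈ W) → ∀ b ∈ A, ∀ w ∈ W, b w ∈ W)
    (hnd : ∀ X ∈ g, (∀ b ∈ A, LinearMap.trace K V (X * b) = 0) → X = 0)
    (hJ : ∀ X ∈ g, ∀ N S : Module.End K V, Commute N S → IsNilpotent N → S.IsSemisimple → X = N + S → N ∈ g) :
    LieAlgebra.radical K g = LieAlgebra.center K g ∧
    (∀ x : g, x ∈ LieAlgebra.center K g ↔ ∀ y : g, (y : Module.End K V) * x = x * y) ∧
    ∀ x ∈ LieAlgebra.center K g, (x : Module.End K V).IsSemisimple := by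
  have hnd' : ∀ X ∈ g, (∀ b ∈ A, IsNilpotent (X * b)) → X = 0 := by
    intro X hX h
    refine hnd X hX (fun b hb => ?_)
    exact (LinearMap.isNilpotent_trace_of_isNilpotent (h b hb)).eq_zero
  have hgfd : FiniteDimensional K g := inferInstanceAs (FiniteDimensional K g.toSubmodule)
  -- step a
  let D : LieIdeal K g := ⁅(⊤ : LieIdeal K g), LieAlgebra.radical K g⁆
  have hD : ∀ y ∈ D, y = 0 := by
    have hnil : LieModule.IsNilpotent D V := by
      rw [LieModule.isNilpotent_iff_forall' (R := K)]
      intro y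
      exact nilpotent_of_mem_lie_radical K g _ V rfl y y.2
    obtain ⟨k, hk⟩ := (LieModule.isNilpotent_iff K D V).mp hnil
    intro y hy
    ext1
    refine hnd' y y.2 (fun b hb => ?_)
    refine isNilpotent_of_chain _ (fun i => (D.lcs V i).toSubmodule) ?_ ?_ k ?_
    · simp
    · intro i v hv
      have h1 : b v ∈ D.lcs V i := by
        refine hstab (D.lcs V i).toSubmodule ?_ b hb v hv
        intro X hX w hw
        exact (D.lcs V i).lie_mem (x := ⟨X, hX⟩) hw
      change ⁅y, b v⁆ ∈ D.lcs V (i + 1)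
      rw [LieIdeal.lcs_succ]
      exact LieSubmodule.lie_mem_lie hy h1
    · have := LieIdeal.coe_lcs_eq (I := D) (M := V) (k := k) (R := K)
      rw [this, hk]
      simp
  have hrad : LieAlgebra.radical K g = LieAlgebra.center K g := by
    apply le_antisymm _ (LieAlgebra.center_le_radical K g)
    intro x hx
    rw [LieModule.mem_maxTrivSubmodule]
    intro y
    exact hD _ (LieSubmodule.lie_mem_lie (LieSubmodule.mem_top _) hx)
  have hcen : ∀ x : g, x ∈ LieAlgebra.center K g ↔ ∀ y : g, (y : Module.End K V) * x = x * y := by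
    intro x
    rw [LieModule.mem_maxTrivSubmodule]
    refine forall_congr' (fun y => ?_)
    rw [← sub_eq_zero (a := (y : Module.End K V) * x)]
    constructor
    · intro h
      exact congrArg Subtype.val h
    · intro h
      ext1
      exact h
  -- step b
  refine ⟨hrad, hcen, ?_⟩
  · intro x hx
    obtain ⟨N, hN, S, hS, hNn, hSs, hxe⟩ :=
      Module.End.exists_isNilpotent_isSemisimple (f := (x : Module.End K V))
    have hcomm : ∀ p ∈ Algebra.adjoin K {(x : Module.End K V)}, ∀ q : Module.End K V,
        Commute q (x : Module.End K V) → Commute q p := by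
      intro p hp q hq
      refine Algebra.adjoin_induction (p := fun p _ => Commute q p) ?_ ?_ ?_ ?_ hp
      · rintro _ rfl
        exact hq
      · intro r; exact (Algebra.commutes r q).symm
      · intro a b _ _ h1 h2; exact h1.add_right h2
      · intro a b _ _ h1 h2; exact h1.mul_right h2
    have hNS : Commute N S := by
      apply hcomm S hS
      exact (hcomm N hN _ (Commute.refl _)).symm
    have hNg : N ∈ g := hJ x x.2 N S hNS hNn hSs hxe
    have hNc : ∀ y ∈ g, Commute y N := by
      intro y hy
      exact hcomm N hN y ((hcen x).mp hx ⟨y, hy⟩)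
    have hN0 : N = 0 := by
      refine hnd' N hNg (fun b hb => ?_)
      obtain ⟨k, hk⟩ := hNn
      refine isNilpotent_of_chain _ (fun i => LinearMap.range (N ^ i)) ?_ ?_ k ?_
      · simp [Module.End.one_eq_id]
      · intro i v hv
        have h1 : b v ∈ LinearMap.range (N ^ i) := by
          refine hstab _ ?_ b hb v hv
          rintro X hX _ ⟨u, rfl⟩
          refine ⟨X u, ?_⟩
          have := (hNc X hX).pow_right i
          exact (LinearMap.congr_fun this.eq u).symm
        obtain ⟨u, hu⟩ := h1
        refine ⟨u, ?_⟩
        rw [Module.End.mul_apply, ← hu, pow_succ', Module.End.mul_apply]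
      · simp [hk]
    rw [hxe, hN0, zero_add]
    exact hSs

/-- cocycles on a reductive Lie algebra that vanish on the center -/
theorem H1_vanish_red (K L E : Type) [Field K] [CharZero K] [LieRing L] [LieAlgebra K L]
    [FiniteDimensional K L] (hrad : LieAlgebra.radical K L = LieAlgebra.center K L)
    [AddCommGroup E] [Module K E] [LieRingModule L E] [LieModule K L E] [FiniteDimensional K E]
    (htriv : ∀ x ∈ LieAlgebra.center K L, ∀ e : E, ⁅x, e⁆ = 0)
    (c0 : L →ₗ[K] E) (hc0 : ∀ x y, c0 ⁅x, y⁆ = ⁅x, c0 y⁆ - ⁅y, c0 x⁆)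
    (hcz : ∀ x ∈ LieAlgebra.center K L, c0 x = 0) : ∃ m, ∀ x, c0 x = ⁅x, m⁆ := by
  let Z := LieAlgebra.center K L
  let Φ0 : L →ₗ[K] Module.End K E := (LieModule.toEnd K L E : L →ₗ[K] Module.End K E)
  have hleΦ : Z.toSubmodule ≤ LinearMap.ker Φ0 := by
    intro X hX
    change Φ0 X = 0
    ext1 φ
    exact htriv X hX φ
  let Φ1 : (L ⧸ Z) →ₗ[K] Module.End K E := (Z.toSubmodule.liftQ Φ0 hleΦ :)
  have hΦ1 : ∀ X : L, Φ1 (LieSubmodule.Quotient.mk X) = LieModule.toEnd K L E X := fun X => rfl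
  let Φ : (L ⧸ Z) →ₗ⁅K⁆ Module.End K E :=
    { Φ1 with
      map_lie' := by
        intro x y
        obtain ⟨x, rfl⟩ := LieSubmodule.Quotient.surjective_mk' _ x
        obtain ⟨y, rfl⟩ := LieSubmodule.Quotient.surjective_mk' _ y
        change Φ1 ⁅LieSubmodule.Quotient.mk x, LieSubmodule.Quotient.mk y⁆ =
          ⁅Φ1 (LieSubmodule.Quotient.mk x), Φ1 (LieSubmodule.Quotient.mk y)⁆
        rw [← LieSubmodule.Quotient.mk_bracket, hΦ1, hΦ1, hΦ1, LieHom.map_lie] }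
  have hKill : LieAlgebra.IsKilling K (L ⧸ Z) := by
    have := trivialRadical_quotient K L hrad
    infer_instance
  let _ : LieRingModule (L ⧸ Z) E := LieRingModule.compLieHom E Φ
  have _ : LieModule K (L ⧸ Z) E := LieModule.compLieHom E Φ
  have hbr : ∀ (X : L) (φ : E), ⁅(LieSubmodule.Quotient.mk X : L ⧸ Z), φ⁆ = ⁅X, φ⁆ :=
    fun X φ => rfl
  have hlec : Z.toSubmodule ≤ LinearMap.ker c0 := by
    intro X hX
    exact hcz X hX
  let c : (L ⧸ Z) →ₗ[K] E := (Z.toSubmodule.liftQ c0 hlec :)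
  have hcc : ∀ X : L, c (LieSubmodule.Quotient.mk X) = c0 X := fun X => rfl
  obtain ⟨m, hm⟩ := H1_vanish K (L ⧸ Z) E c (by
    intro x y
    obtain ⟨x, rfl⟩ := LieSubmodule.Quotient.surjective_mk' _ x
    obtain ⟨y, rfl⟩ := LieSubmodule.Quotient.surjective_mk' _ y
    change c ⁅LieSubmodule.Quotient.mk x, LieSubmodule.Quotient.mk y⁆ =
          ⁅LieSubmodule.Quotient.mk x, c (LieSubmodule.Quotient.mk y)⁆ -
          ⁅LieSubmodule.Quotient.mk y, c (LieSubmodule.Quotient.mk x)⁆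
    rw [← LieSubmodule.Quotient.mk_bracket, hcc, hcc, hcc, hbr, hbr, hc0])
  exact ⟨m, fun x => hm (LieSubmodule.Quotient.mk x)⟩

theorem complete_red (g : LieSubalgebra K (Module.End K V)) (A : Subalgebra K (Module.End K V))
    (hstab : ∀ W : Submodule K V, (∀ X ∈ g, ∀ w ∈ W, X w ∈ W) → ∀ b ∈ A, ∀ w ∈ W, b w ∈ W)
    (hnd : ∀ X ∈ g, (∀ b ∈ A, LinearMap.trace K V (X * b) = 0) → X = 0)
    (hJ : ∀ X ∈ g, ∀ N S : Module.End K V, Commute N S → IsNilpotent N → S.IsSemisimple → X = N + S → N ∈ g)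
    (W : Submodule K V) (hW : ∀ X ∈ g, ∀ w ∈ W, X w ∈ W) :
    ∃ U : Submodule K V, (∀ X ∈ g, ∀ u ∈ U, X u ∈ U) ∧ IsCompl W U := by
  obtain ⟨hrad, hcen, hsemi⟩ := reductive_structure g A hstab hnd hJ
  have hgfd : FiniteDimensional K g := inferInstanceAs (FiniteDimensional K g.toSubmodule)
  -- step c
  let z : Set (Module.End K V) := {x | ∃ x' ∈ LieAlgebra.center K g, (x' : Module.End K V) = x}
  obtain ⟨U0, hU0, hWU0⟩ := exists_stable_compl z
    (by
      rintro _ ⟨a, ha, rfl⟩ _ ⟨b, hb, rfl⟩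
      exact (hcen b).mp hb a)
    (by
      rintro _ ⟨a, ha, rfl⟩
      exact hsemi a ha) W
    (by
      rintro _ ⟨a, ha, rfl⟩
      exact hW a a.2)
  let p0 : Module.End K V := W.subtype ∘ₗ W.projectionOnto U0 hWU0
  have hp0W : ∀ v, p0 v ∈ W := fun v => Subtype.property _
  have hp0w : ∀ w ∈ W, p0 w = w := by
    intro w hw
    simp [p0, Submodule.projectionOnto_apply_left hWU0 ⟨w, hw⟩]
  have hp0U : ∀ u ∈ U0, p0 u = 0 := by
    intro u hu
    simp [p0, Submodule.projectionOnto_apply_right hWU0 ⟨u, hu⟩]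
  have hp0z : ∀ x ∈ z, x * p0 = p0 * x := by
    rintro x hx
    ext v
    have hv : v ∈ W ⊔ U0 := by rw [hWU0.sup_eq_top]; trivial
    obtain ⟨a, ha, b, hb, rfl⟩ := Submodule.mem_sup.mp hv
    have hxa : x a ∈ W := by
      obtain ⟨x', -, rfl⟩ := hx
      exact hW x' x'.2 a ha
    simp [hp0w a ha, hp0U b hb, hp0w _ hxa, hp0U _ (hU0 x hx b hb)]
  -- step d
  let E0 : Submodule K (Module.End K V) :=
    { carrier := {φ | (∀ x ∈ z, x * φ = φ * x) ∧ (∀ v, φ v ∈ W) ∧ ∀ w ∈ W, φ w = 0}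
      add_mem' := by
        rintro a b ⟨h1, h2, h3⟩ ⟨h1', h2', h3'⟩
        refine ⟨fun x hx => by rw [mul_add, add_mul, h1 x hx, h1' x hx],
          fun v => W.add_mem (h2 v) (h2' v), fun w hw => ?_⟩
        rw [LinearMap.add_apply, h3 w hw, h3' w hw, add_zero]
      zero_mem' := ⟨fun x hx => by simp, fun v => W.zero_mem, fun w hw => rfl⟩
      smul_mem' := by
        rintro c a ⟨h1, h2, h3⟩
        refine ⟨fun x hx => by rw [mul_smul_comm, smul_mul_assoc, h1 x hx],
          fun v => W.smul_mem c (h2 v), fun w hw => ?_⟩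
        rw [LinearMap.smul_apply, h3 w hw, smul_zero] }
  have hzg : ∀ x ∈ z, ∀ y ∈ g, x * y = y * x := by
    rintro _ ⟨x, hx, rfl⟩ y hy
    exact ((hcen x).mp hx ⟨y, hy⟩).symm
  have hEact : ∀ X ∈ g, ∀ φ ∈ E0, X * φ - φ * X ∈ E0 := by
    rintro X hX φ ⟨h1, h2, h3⟩
    refine ⟨fun x hx => ?_, fun v => ?_, fun w hw => ?_⟩
    · have e1 := hzg x hx X hX
      have e2 := h1 x hx
      rw [mul_sub, sub_mul, ← mul_assoc, ← mul_assoc, e1, e2, mul_assoc, e2, mul_assoc, e1]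
      simp only [mul_assoc]
    · exact W.sub_mem (hW X hX _ (h2 v)) (h2 _)
    · simp [h3 w hw, h3 _ (hW X hX w hw)]
  let E : LieSubmodule K g (V →ₗ[K] V) :=
    { E0 with lie_mem := fun {X φ} hφ => hEact X X.2 φ hφ }
  have hEfd : FiniteDimensional K E := inferInstanceAs (FiniteDimensional K E0)
  have hbr : ∀ (X : g) (φ : E), ((⁅X, φ⁆ : E) : Module.End K V) =
      (X : Module.End K V) * φ - φ * X := fun X φ => rfl
  let c0 : g →ₗ[K] E :=
    { toFun := fun X => ⟨(X : Module.End K V) * p0 - p0 * X, by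
        refine ⟨fun x hx => ?_, fun v => ?_, fun w hw => ?_⟩
        · have e1 := hzg x hx X X.2
          have e2 := hp0z x hx
          rw [mul_sub, sub_mul, ← mul_assoc, ← mul_assoc, e1, e2, mul_assoc, e2, mul_assoc, e1]
          simp only [mul_assoc]
        · exact W.sub_mem (hW X X.2 _ (hp0W v)) (hp0W _)
        · simp [hp0w w hw, hp0w _ (hW X X.2 w hw)]⟩
      map_add' := by intro a b; ext1; simp [add_mul, mul_add]; abel
      map_smul' := by intro a b; ext1; simp [smul_sub] }
  have hc0 : ∀ X : g, ((c0 X : E) : Module.End K V) = (X : Module.End K V) * p0 - p0 * X :=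
    fun X => rfl
  obtain ⟨m, hm⟩ := H1_vanish_red K g E hrad
    (by
      intro x hx e
      ext1
      refine (hbr x e).trans ?_
      rw [e.2.1 x ⟨x, hx, rfl⟩, sub_self]; rfl) c0
    (by
      intro x y
      ext1
      rw [LieSubmodule.coe_sub]
      refine (hc0 _).trans ?_
      refine Eq.trans ?_ (congrArg₂ (· - ·) (hbr x (c0 y)) (hbr y (c0 x))).symm
      rw [hc0, hc0, LieSubalgebra.coe_bracket, LieRing.of_associative_ring_bracket]
      noncomm_ring)
    (by
      intro x hx
      ext1
      refine (hc0 x).trans ?_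
      rw [hp0z x ⟨x, hx, rfl⟩, sub_self]; rfl)
  have hm' : ∀ X ∈ g, X * (p0 - m) = (p0 - m) * X := by
    intro X hX
    have h1 : X * p0 - p0 * X = X * (m : Module.End K V) - (m : Module.End K V) * X :=
      (hc0 ⟨X, hX⟩).symm.trans ((congrArg Subtype.val (hm ⟨X, hX⟩)).trans (hbr ⟨X, hX⟩ m))
    rw [mul_sub, sub_mul, sub_eq_sub_iff_sub_eq_sub, h1]
  obtain ⟨hm1, hm2, hm3⟩ := m.2
  refine ⟨LinearMap.ker (p0 - (m : Module.End K V)), ?_, ?_⟩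
  · intro X hX u hu
    rw [LinearMap.mem_ker] at hu ⊢
    have := LinearMap.congr_fun (hm' X hX) u
    simp only [Module.End.mul_apply] at this
    rw [← this, hu, map_zero]
  · have hpw : ∀ w ∈ W, (p0 - (m : Module.End K V)) w = w := by
      intro w hw
      rw [LinearMap.sub_apply, hp0w w hw, hm3 w hw, sub_zero]
    have hpW : ∀ v, (p0 - (m : Module.End K V)) v ∈ W := fun v => W.sub_mem (hp0W v) (hm2 v)
    rw [isCompl_iff, disjoint_iff, codisjoint_iff]
    constructor
    · rw [eq_bot_iff]
      rintro x ⟨h1, h2⟩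
      rw [SetLike.mem_coe, LinearMap.mem_ker] at h2
      rw [hpw x h1] at h2
      simpa using h2
    · rw [eq_top_iff]
      intro x _
      refine Submodule.mem_sup.mpr ⟨_, hpW x, x - (p0 - (m : Module.End K V)) x, ?_, by abel⟩
      change (p0 - (m : Module.End K V)) _ = 0
      rw [map_sub, hpw _ (hpW x), sub_self]

end LiePart

section AlgGroup
open MvPolynomial

variable {F : Type} [Field F] {n : ℕ}

/-- evaluation of a polynomial at a matrix -/
noncomputable abbrev mev (x : Matrix (Fin n) (Fin n) F) : MvPolynomial (Fin n × Fin n) F →+* F :=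
  MvPolynomial.eval (fun q => x q.1 q.2)

/-- vanishing ideal -/
noncomputable def zideal (S : Set (GL (Fin n) F)) : Ideal (MvPolynomial (Fin n × Fin n) F) where
  carrier := {p | ∀ g ∈ S, mev (g : Matrix (Fin n) (Fin n) F) p = 0}
  add_mem' := by intro a b ha hb g hg; rw [map_add, ha g hg, hb g hg, add_zero]
  zero_mem' := by intro g _; simp
  smul_mem' := by intro c x hx g hg; rw [smul_eq_mul, map_mul, hx g hg, mul_zero]

theorem mem_zideal {S : Set (GL (Fin n) F)} {p : MvPolynomial (Fin n × Fin n) F} :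
    p ∈ zideal S ↔ ∀ g ∈ S, mev (g : Matrix (Fin n) (Fin n) F) p = 0 := Iff.rfl

theorem mem_of_zclosed {S : Set (GL (Fin n) F)} (hS : IsZClosed S) (g : GL (Fin n) F)
    (h : ∀ p ∈ zideal S, mev (g : Matrix (Fin n) (Fin n) F) p = 0) : g ∈ S := by
  obtain ⟨I, hI⟩ := hS
  rw [hI]
  intro p hp
  apply h
  intro g' hg'
  rw [hI] at hg'
  exact hg' p hp

/-- left translation -/
noncomputable def ltr (h : Matrix (Fin n) (Fin n) F) :
    MvPolynomial (Fin n × Fin n) F →ₐ[F] MvPolynomial (Fin n × Fin n) F :=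
  MvPolynomial.aeval (fun q => ∑ l, C (h q.1 l) * X (l, q.2))

/-- right translation -/
noncomputable def rtr (h : Matrix (Fin n) (Fin n) F) :
    MvPolynomial (Fin n × Fin n) F →ₐ[F] MvPolynomial (Fin n × Fin n) F :=
  MvPolynomial.aeval (fun q => ∑ l, C (h l q.2) * X (q.1, l))

theorem mev_ltr (h x : Matrix (Fin n) (Fin n) F) (p : MvPolynomial (Fin n × Fin n) F) :
    mev x (ltr h p) = mev (h * x) p := by
  induction p using MvPolynomial.induction_on with
  | C a => simp [ltr]
  | add p q hp hq => rw [map_add, map_add, map_add, hp, hq]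
  | mul_X p q hp =>
    rw [map_mul, map_mul, map_mul, hp]
    congr 1
    simp [ltr, Matrix.mul_apply]

theorem mev_rtr (h x : Matrix (Fin n) (Fin n) F) (p : MvPolynomial (Fin n × Fin n) F) :
    mev x (rtr h p) = mev (x * h) p := by
  induction p using MvPolynomial.induction_on with
  | C a => simp [rtr]
  | add p q hp hq => rw [map_add, map_add, map_add, hp, hq]
  | mul_X p q hp =>
    rw [map_mul, map_mul, map_mul, hp]
    congr 1
    simp [rtr, Matrix.mul_apply, mul_comm]

/-- the invariant derivation attached to a matrix -/
noncomputable def der (Y : Matrix (Fin n) (Fin n) F) :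
    Derivation F (MvPolynomial (Fin n × Fin n) F) (MvPolynomial (Fin n × Fin n) F) :=
  MvPolynomial.mkDerivation F (fun q => ∑ k, C (Y k q.2) * X (q.1, k))

theorem der_X (Y : Matrix (Fin n) (Fin n) F) (q : Fin n × Fin n) :
    der Y (X q) = ∑ k, C (Y k q.2) * X (q.1, k) := by
  simp [der]

theorem der_C (Y : Matrix (Fin n) (Fin n) F) (a : F) : der Y (C a) = 0 := by
  simp [der]

theorem der_CX (Y : Matrix (Fin n) (Fin n) F) (a : F) (q : Fin n × Fin n) :
    der Y (C a * X q) = C a * der Y (X q) := by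
  rw [Derivation.leibniz, der_C, smul_zero, add_zero, smul_eq_mul]

theorem der_add (Y Z : Matrix (Fin n) (Fin n) F) (p : MvPolynomial (Fin n × Fin n) F) :
    der (Y + Z) p = der Y p + der Z p := by
  have : der (Y + Z) = der Y + der Z := by
    apply MvPolynomial.derivation_ext
    intro q
    rw [Derivation.add_apply, der_X, der_X, der_X, ← Finset.sum_add_distrib]
    simp [add_mul]
  rw [this]; rfl

theorem der_smul (c : F) (Y : Matrix (Fin n) (Fin n) F) (p : MvPolynomial (Fin n × Fin n) F) :
    der (c • Y) p = c • der Y p := by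
  have : der (c • Y) = c • der Y := by
    apply MvPolynomial.derivation_ext
    intro q
    rw [Derivation.smul_apply, der_X, der_X, Finset.smul_sum]
    simp [MvPolynomial.smul_eq_C_mul, mul_assoc]
  rw [this]; rfl

theorem der_der_X (Y Z : Matrix (Fin n) (Fin n) F) (q : Fin n × Fin n) :
    der Y (der Z (X q)) = der (Y * Z) (X q) := by
  rw [der_X, der_X, map_sum]
  simp only [der_CX, der_X, Finset.mul_sum, Matrix.mul_apply, map_sum, Finset.sum_mul]
  rw [Finset.sum_comm]
  refine Finset.sum_congr rfl (fun k _ => Finset.sum_congr rfl fun l _ => ?_)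
  rw [C_mul]; ring

theorem der_comm (Y Z : Matrix (Fin n) (Fin n) F) (p : MvPolynomial (Fin n × Fin n) F) :
    der Y (der Z p) - der Z (der Y p) = der (Y * Z - Z * Y) p := by
  have : ⁅der Y, der Z⁆ = der (Y * Z - Z * Y) := by
    apply MvPolynomial.derivation_ext
    intro q
    rw [Derivation.commutator_apply, der_der_X, der_der_X, sub_eq_add_neg, sub_eq_add_neg, der_add,
      ← neg_one_smul F (Z * Y), der_smul, neg_one_smul]
  rw [← this, Derivation.commutator_apply]

theorem ltr_der (h Y : Matrix (Fin n) (Fin n) F) (p : MvPolynomial (Fin n × Fin n) F) :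
    ltr h (der Y p) = der Y (ltr h p) := by
  induction p using MvPolynomial.induction_on with
  | C a => rw [der_C, map_zero, ltr, aeval_C, MvPolynomial.algebraMap_eq, der_C]
  | add p q hp hq => simp only [map_add, hp, hq]
  | mul_X p q hp =>
    have hX : ltr h (der Y (X q)) = der Y (ltr h (X q)) := by
      rw [der_X, map_sum]
      simp only [ltr, map_mul, aeval_X, aeval_C, MvPolynomial.algebraMap_eq, map_sum, der_CX, der_X,
        Finset.mul_sum]
      rw [Finset.sum_comm]
      refine Finset.sum_congr rfl (fun k _ => Finset.sum_congr rfl fun l _ => ?_)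
      ring
    rw [Derivation.leibniz, map_mul (ltr h) p (X q), Derivation.leibniz, map_add, smul_eq_mul,
      smul_eq_mul, smul_eq_mul, smul_eq_mul, map_mul, map_mul, hp, hX]

theorem mev_der (x Y : Matrix (Fin n) (Fin n) F) (p : MvPolynomial (Fin n × Fin n) F) :
    mev x (der Y p) = mev 1 (der Y (ltr x p)) := by
  rw [← ltr_der, mev_ltr, mul_one]

/-- the Lie algebra of a subset -/
noncomputable def zlie (S : Set (GL (Fin n) F)) : Submodule F (Matrix (Fin n) (Fin n) F) where
  carrier := {Y | ∀ p ∈ zideal S, mev 1 (der Y p) = 0}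
  add_mem' := by intro a b ha hb p hp; rw [der_add, map_add, ha p hp, hb p hp, add_zero]
  zero_mem' := by
    intro p hp
    rw [← zero_smul F (0 : Matrix (Fin n) (Fin n) F), der_smul, zero_smul, map_zero]
  smul_mem' := by
    intro c Y hY p hp
    rw [der_smul, MvPolynomial.smul_eq_C_mul, map_mul, hY p hp, mul_zero]

theorem mem_zlie {S : Set (GL (Fin n) F)} {Y : Matrix (Fin n) (Fin n) F} :
    Y ∈ zlie S ↔ ∀ p ∈ zideal S, mev 1 (der Y p) = 0 := Iff.rfl

variable (G : Subgroup (GL (Fin n) F))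

theorem ltr_mem_zideal {h : GL (Fin n) F} (hh : h ∈ G) {p : MvPolynomial (Fin n × Fin n) F}
    (hp : p ∈ zideal (G : Set (GL (Fin n) F))) :
    ltr (h : Matrix (Fin n) (Fin n) F) p ∈ zideal (G : Set (GL (Fin n) F)) := by
  intro g hg
  rw [mev_ltr]
  exact hp (h * g) (G.mul_mem hh hg)

theorem rtr_mem_zideal {h : GL (Fin n) F} (hh : h ∈ G) {p : MvPolynomial (Fin n × Fin n) F}
    (hp : p ∈ zideal (G : Set (GL (Fin n) F))) :
    rtr (h : Matrix (Fin n) (Fin n) F) p ∈ zideal (G : Set (GL (Fin n) F)) := by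
  intro g hg
  rw [mev_rtr]
  exact hp (g * h) (G.mul_mem hg hh)

theorem der_mem_zideal {Y : Matrix (Fin n) (Fin n) F} (hY : Y ∈ zlie (G : Set (GL (Fin n) F)))
    {p : MvPolynomial (Fin n × Fin n) F} (hp : p ∈ zideal (G : Set (GL (Fin n) F))) :
    der Y p ∈ zideal (G : Set (GL (Fin n) F)) := by
  intro g hg
  rw [mev_der]
  exact hY _ (ltr_mem_zideal G hg hp)

theorem zlie_of_der_mem {Y : Matrix (Fin n) (Fin n) F}
    (h : ∀ p ∈ zideal (G : Set (GL (Fin n) F)), der Y p ∈ zideal (G : Set (GL (Fin n) F))) :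
    Y ∈ zlie (G : Set (GL (Fin n) F)) := by
  intro p hp
  have := h p hp 1 G.one_mem
  simpa using this

theorem zlie_bracket {Y Z : Matrix (Fin n) (Fin n) F} (hY : Y ∈ zlie (G : Set (GL (Fin n) F)))
    (hZ : Z ∈ zlie (G : Set (GL (Fin n) F))) : Y * Z - Z * Y ∈ zlie (G : Set (GL (Fin n) F)) := by
  apply zlie_of_der_mem
  intro p hp
  rw [← der_comm]
  exact Ideal.sub_mem _ (der_mem_zideal G hY (der_mem_zideal G hZ hp))
    (der_mem_zideal G hZ (der_mem_zideal G hY hp))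

/-- linear polynomial with coefficients `a` -/
noncomputable def linpoly (a : Fin n × Fin n → F) : MvPolynomial (Fin n × Fin n) F :=
  ∑ q, C (a q) * X q

theorem mev_linpoly (a : Fin n × Fin n → F) (x : Matrix (Fin n) (Fin n) F) :
    mev x (linpoly a) = ∑ q : Fin n × Fin n, a q * x q.1 q.2 := by
  simp [linpoly]

theorem mev_one_der_linpoly (a : Fin n × Fin n → F) (x Y : Matrix (Fin n) (Fin n) F) :
    mev x (der Y (linpoly a)) = mev (x * Y) (linpoly a) := by
  rw [mev_linpoly, linpoly, map_sum, map_sum]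
  refine Finset.sum_congr rfl (fun q _ => ?_)
  rw [der_CX, der_X]
  simp only [map_mul, eval_C, map_sum, eval_X, Matrix.mul_apply]
  congr 1
  exact Finset.sum_congr rfl fun k _ => mul_comm _ _

/-- A linear condition on `G` passes to the Lie algebra. -/
theorem zlie_linear {Y : Matrix (Fin n) (Fin n) F} (hY : Y ∈ zlie (G : Set (GL (Fin n) F)))
    (φ : Matrix (Fin n) (Fin n) F →ₗ[F] F) (hφ : ∀ g ∈ G, φ (g : Matrix (Fin n) (Fin n) F) = 0) :
    φ Y = 0 := by
  have hφe : ∀ x : Matrix (Fin n) (Fin n) F,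
      φ x = mev x (linpoly (fun q => φ (Matrix.single q.1 q.2 1))) := by
    intro x
    rw [mev_linpoly]
    conv_lhs => rw [Matrix.matrix_eq_sum_single x]
    rw [map_sum, Fintype.sum_prod_type]
    refine Finset.sum_congr rfl (fun i _ => ?_)
    rw [map_sum]
    refine Finset.sum_congr rfl (fun j _ => ?_)
    rw [← mul_one (x i j), ← smul_eq_mul, ← Matrix.smul_single, map_smul]
    simp [mul_comm]
  have h1 : linpoly (fun q => φ (Matrix.single q.1 q.2 1)) ∈ zideal (G : Set (GL (Fin n) F)) := by
    intro g hg
    rw [← hφe]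
    exact hφ g hg
  have := hY _ h1
  rw [mev_one_der_linpoly, one_mul, ← hφe] at this
  exact this

theorem zlie_mem_span {Y : Matrix (Fin n) (Fin n) F} (hY : Y ∈ zlie (G : Set (GL (Fin n) F))) :
    Y ∈ Submodule.span F (Set.image (fun g : GL (Fin n) F => (g : Matrix (Fin n) (Fin n) F)) (G : Set (GL (Fin n) F))) := by
  by_contra h
  obtain ⟨f, hf, hle⟩ := Submodule.exists_le_ker_of_notMem h
  apply hf
  apply zlie_linear G hY
  intro g hg
  exact hle (Submodule.subset_span ⟨g, hg, rfl⟩)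

end AlgGroup

section AlgGroup2
open MvPolynomial

variable {F : Type} [Field F] {n : ℕ}

/-- coordinates centered at the identity -/
noncomputable def ycoord (q : Fin n × Fin n) : MvPolynomial (Fin n × Fin n) F :=
  X q - C ((1 : Matrix (Fin n) (Fin n) F) q.1 q.2)

/-- maximal ideal at the identity -/
noncomputable def mone : Ideal (MvPolynomial (Fin n × Fin n) F) :=
  RingHom.ker (mev (1 : Matrix (Fin n) (Fin n) F))

theorem mem_mone {p : MvPolynomial (Fin n × Fin n) F} :
    p ∈ (mone : Ideal (MvPolynomial (Fin n × Fin n) F)) ↔ mev 1 p = 0 := Iff.rfl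

theorem ycoord_mem (q : Fin n × Fin n) :
    (ycoord q : MvPolynomial (Fin n × Fin n) F) ∈ (mone : Ideal (MvPolynomial (Fin n × Fin n) F)) := by
  rw [mem_mone]
  simp [ycoord]

theorem sub_C_mem_mone (p : MvPolynomial (Fin n × Fin n) F) : p - C (mev 1 p) ∈
    (mone : Ideal (MvPolynomial (Fin n × Fin n) F)) := by
  rw [mem_mone]; simp

theorem mone_eq : (mone : Ideal (MvPolynomial (Fin n × Fin n) F)) =
    Ideal.span (Set.range ycoord) := by
  apply le_antisymm
  · have key : ∀ p : MvPolynomial (Fin n × Fin n) F,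
        p - C (mev 1 p) ∈ Ideal.span (Set.range (ycoord : Fin n × Fin n → MvPolynomial (Fin n × Fin n) F)) := by
      intro p
      induction p using MvPolynomial.induction_on with
      | C a => simp
      | add p q hp hq =>
        have := Ideal.add_mem _ hp hq
        convert this using 1
        rw [map_add, C_add]; ring
      | mul_X p q hp =>
        have h2 : (ycoord q : MvPolynomial (Fin n × Fin n) F) ∈
          Ideal.span (Set.range (ycoord : Fin n × Fin n → MvPolynomial (Fin n × Fin n) F)) :=
          Ideal.subset_span ⟨q, rfl⟩
        have := Ideal.add_mem _ (Ideal.mul_mem_right (C (mev 1 (X q))) _ hp) (Ideal.mul_mem_left _ p h2)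
        convert this using 1
        rw [map_mul, C_mul, ycoord, eval_X]; ring
    intro p hp
    have := key p
    rw [mem_mone] at hp
    rwa [hp, C_0, sub_zero] at this
  · rw [Ideal.span_le]
    rintro _ ⟨q, rfl⟩
    exact ycoord_mem q

/-- differential at the identity -/
noncomputable def dlam (p : MvPolynomial (Fin n × Fin n) F) : Module.Dual F (Matrix (Fin n) (Fin n) F) where
  toFun Y := mev 1 (der Y p)
  map_add' Y Z := by rw [der_add, map_add]
  map_smul' c Y := by rw [der_smul, MvPolynomial.smul_eq_C_mul, map_mul, eval_C]; rfl

theorem dlam_apply (p : MvPolynomial (Fin n × Fin n) F) (Y : Matrix (Fin n) (Fin n) F) :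
    dlam p Y = mev 1 (der Y p) := rfl

theorem dlam_ycoord (q q' : Fin n × Fin n) :
    dlam (ycoord q' : MvPolynomial (Fin n × Fin n) F) (Matrix.single q.1 q.2 1) = if q = q' then 1 else 0 := by
  rw [dlam_apply, ycoord, map_sub, der_C, sub_zero, der_X, map_sum]
  simp only [map_mul, eval_C, eval_X, Matrix.single_apply, Matrix.one_apply]
  rw [Finset.sum_eq_single q'.1]
  · simp [Prod.ext_iff]
  · intro b _ hb; simp [Ne.symm hb]
  · simp

theorem sum_ycoord_dlam {p : MvPolynomial (Fin n × Fin n) F}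
    (hp : p ∈ (mone : Ideal (MvPolynomial (Fin n × Fin n) F))) :
    ∑ q, ycoord q * C (dlam p (Matrix.single q.1 q.2 1)) - p ∈
      (mone : Ideal (MvPolynomial (Fin n × Fin n) F)) ^ 2 := by
  rw [mone_eq] at hp
  induction hp using Submodule.span_induction with
  | mem x hx =>
    obtain ⟨q', rfl⟩ := hx
    simp only [dlam_ycoord]
    simp
  | zero =>
    simp [dlam_apply]
  | add x y _ _ hx hy =>
    convert Ideal.add_mem _ hx hy using 1
    have : ∀ Y, dlam (x + y) Y = dlam x Y + dlam y Y := by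
      intro Y; simp only [dlam_apply]; rw [map_add, map_add]
    simp only [this, C_add, mul_add, Finset.sum_add_distrib]
    ring
  | smul a x hxm hx =>
    have hx1 : x ∈ (mone : Ideal (MvPolynomial (Fin n × Fin n) F)) := by rw [mone_eq]; exact hxm
    have : ∀ Y, dlam (a • x) Y = mev 1 a * dlam x Y := by
      intro Y; simp only [dlam_apply, smul_eq_mul]
      rw [Derivation.leibniz, map_add, smul_eq_mul, smul_eq_mul, map_mul, map_mul,
        (mem_mone.1 hx1 : mev 1 x = 0)]; ring
    have h2 : (a - C (mev 1 a)) * x ∈ (mone : Ideal (MvPolynomial (Fin n × Fin n) F)) ^ 2 := by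
      rw [sq]; exact Ideal.mul_mem_mul (sub_C_mem_mone a) hx1
    have h3 := Ideal.sub_mem _ (Ideal.mul_mem_left _ (C (mev 1 a)) hx) h2
    convert h3 using 1
    simp only [this, C_mul]
    rw [mul_sub, Finset.mul_sum, smul_eq_mul]
    have : ∀ q : Fin n × Fin n, ycoord q * (C (mev 1 a) * C (dlam x (Matrix.single q.1 q.2 1)))
       = C (mev 1 a) * (ycoord q * C (dlam x (Matrix.single q.1 q.2 1))) := by intro q; ring
    simp only [this]; ring

variable (G : Subgroup (GL (Fin n) F))

theorem zideal_le_mone : zideal (G : Set (GL (Fin n) F)) ≤ mone := by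
  intro p hp
  have := hp 1 G.one_mem
  rw [mem_mone]
  simpa using this

theorem exists_euler : ∃ π : Matrix (Fin n) (Fin n) F →ₗ[F] Matrix (Fin n) (Fin n) F,
    (∀ Y, π Y ∈ zlie (G : Set (GL (Fin n) F))) ∧ ∀ p ∈ (mone : Ideal (MvPolynomial (Fin n × Fin n) F)),
      (∑ q, ycoord q * der (π (Matrix.single q.1 q.2 1)) p) - p ∈
        (mone : Ideal (MvPolynomial (Fin n × Fin n) F)) ^ 2 ⊔ zideal (G : Set (GL (Fin n) F)) := by
  obtain ⟨π0, hπ0⟩ := (zlie (G : Set (GL (Fin n) F))).subtype.exists_leftInverse_of_injective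
    (Submodule.ker_subtype _)
  refine ⟨(zlie (G : Set (GL (Fin n) F))).subtype ∘ₗ π0, fun Y => (π0 Y).2, ?_⟩
  intro p hp
  set π := (zlie (G : Set (GL (Fin n) F))).subtype ∘ₗ π0 with hπ
  let Φ : Submodule F (Module.Dual F (Matrix (Fin n) (Fin n) F)) :=
    { carrier := {l | ∃ r ∈ zideal (G : Set (GL (Fin n) F)), l = dlam r}
      add_mem' := by
        rintro _ _ ⟨r, hr, rfl⟩ ⟨s, hs, rfl⟩
        refine ⟨r + s, Ideal.add_mem _ hr hs, ?_⟩
        ext1 Y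
        simp only [dlam_apply, LinearMap.add_apply, map_add]
      zero_mem' := ⟨0, Ideal.zero_mem _, by ext1 Y; simp [dlam_apply]⟩
      smul_mem' := by
        rintro c _ ⟨r, hr, rfl⟩
        refine ⟨c • r, by rw [MvPolynomial.smul_eq_C_mul]; exact Ideal.mul_mem_left _ _ hr, ?_⟩
        ext1 Y
        rw [LinearMap.smul_apply, dlam_apply, dlam_apply, Derivation.map_smul,
          MvPolynomial.smul_eq_C_mul, map_mul (mev 1), eval_C]; rfl }
  have hΦ : Φ.dualCoannihilator = zlie (G : Set (GL (Fin n) F)) := by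
    ext Y
    rw [Submodule.mem_dualCoannihilator, mem_zlie]
    constructor
    · intro h p hp; exact h _ ⟨p, hp, rfl⟩
    · rintro h _ ⟨p, hp, rfl⟩; exact h p hp
  have hmem : dlam p - dlam p ∘ₗ π ∈ Φ := by
    rw [← Subspace.dualCoannihilator_dualAnnihilator_eq (W := Φ), hΦ, Submodule.mem_dualAnnihilator]
    intro Y hY
    have : π Y = Y := by
      have := LinearMap.congr_fun hπ0 ⟨Y, hY⟩
      simp only [LinearMap.comp_apply, Submodule.subtype_apply, LinearMap.id_apply] at this
      rw [hπ, LinearMap.comp_apply, this]; rfl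
    rw [LinearMap.sub_apply, LinearMap.comp_apply, this, sub_self]
  obtain ⟨r, hr, hrr⟩ := hmem
  have hlam : ∀ Y, dlam p (π Y) = dlam p Y - dlam r Y := by
    intro Y
    rw [← hrr]; simp
  have h1 : ∑ q, ycoord q * (der (π (Matrix.single q.1 q.2 1)) p - C (dlam p (π (Matrix.single q.1 q.2 1))))
      ∈ (mone : Ideal (MvPolynomial (Fin n × Fin n) F)) ^ 2 := by
    apply Ideal.sum_mem
    intro q _
    rw [sq]
    exact Ideal.mul_mem_mul (ycoord_mem q) (sub_C_mem_mone _)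
  have h2 := sum_ycoord_dlam hp
  have h3 := sum_ycoord_dlam (zideal_le_mone G hr)
  have h4 := Ideal.add_mem _ h1 (Ideal.sub_mem _ h2 h3)
  have h5 := Ideal.sub_mem _ ((le_sup_left : _ ≤ (mone : Ideal (MvPolynomial (Fin n × Fin n) F)) ^ 2 ⊔ zideal (G : Set (GL (Fin n) F))) h4)
    ((le_sup_right : _ ≤ (mone : Ideal (MvPolynomial (Fin n × Fin n) F)) ^ 2 ⊔ zideal (G : Set (GL (Fin n) F))) hr)
  convert h5 using 1
  simp only [hlam, C_sub, mul_sub, Finset.sum_sub_distrib]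
  ring

/-- Euler-type derivation -/
theorem exists_euler2 : ∃ E : Derivation F (MvPolynomial (Fin n × Fin n) F) (MvPolynomial (Fin n × Fin n) F),
    (∀ p ∈ zideal (G : Set (GL (Fin n) F)), E p ∈ zideal (G : Set (GL (Fin n) F))) ∧
    (∀ (J K : Ideal (MvPolynomial (Fin n × Fin n) F)) p, (∀ Y ∈ zlie (G : Set (GL (Fin n) F)), der Y p ∈ J) →
       mone * J ≤ K → E p ∈ K) ∧
    ∀ k : ℕ, ∀ p ∈ (mone : Ideal (MvPolynomial (Fin n × Fin n) F)) ^ k,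
      E p - (k : MvPolynomial (Fin n × Fin n) F) * p ∈
        (mone : Ideal (MvPolynomial (Fin n × Fin n) F)) ^ (k + 1) ⊔ zideal (G : Set (GL (Fin n) F)) := by
  obtain ⟨π, hπ, hE⟩ := exists_euler G
  let E : Derivation F (MvPolynomial (Fin n × Fin n) F) (MvPolynomial (Fin n × Fin n) F) :=
    ∑ q, (ycoord q : MvPolynomial (Fin n × Fin n) F) • der (π (Matrix.single q.1 q.2 1))
  have hEd : ∀ p, E p = ∑ q, ycoord q * der (π (Matrix.single q.1 q.2 1)) p := by
    intro p
    have : E p = (Derivation.coeFnAddMonoidHom E) p := rfl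
    rw [this, map_sum, Finset.sum_apply]
    rfl
  refine ⟨E, ?_, ?_, ?_⟩
  · intro p hp
    rw [hEd]
    exact Ideal.sum_mem _ fun q _ => Ideal.mul_mem_left _ _ (der_mem_zideal G (hπ _) hp)
  · intro J K p hp hJK
    rw [hEd]
    exact Ideal.sum_mem _ fun q _ => hJK (Ideal.mul_mem_mul (ycoord_mem q) (hp _ (hπ _)))
  · intro k
    induction k with
    | zero =>
      intro p _
      apply le_sup_left (α := Ideal (MvPolynomial (Fin n × Fin n) F))
      rw [hEd]
      simp only [Nat.cast_zero, zero_mul, sub_zero, zero_add, pow_one]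
      exact Ideal.sum_mem _ fun q _ => Ideal.mul_mem_right _ _ (ycoord_mem q)
    | succ k ih =>
      intro p hp
      rw [pow_succ] at hp
      induction hp using Submodule.mul_induction_on' with
      | mem_mul_mem a ha b hb =>
        have h1 := ih a ha
        have h2 := hE b hb
        rw [← hEd] at h2
        have h3 : a * (E b - b) ∈ (mone : Ideal (MvPolynomial (Fin n × Fin n) F)) ^ (k + 1 + 1) ⊔ zideal (G : Set (GL (Fin n) F)) := by
          obtain ⟨u, hu, v, hv, huv⟩ := Submodule.mem_sup.1 h2
          rw [← huv, mul_add]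
          refine Submodule.add_mem_sup ?_ (Ideal.mul_mem_left _ _ hv)
          rw [add_assoc, pow_add]
          exact Ideal.mul_mem_mul ha hu
        have h4 : b * (E a - (k : MvPolynomial (Fin n × Fin n) F) * a) ∈ (mone : Ideal (MvPolynomial (Fin n × Fin n) F)) ^ (k + 1 + 1) ⊔ zideal (G : Set (GL (Fin n) F)) := by
          obtain ⟨u, hu, v, hv, huv⟩ := Submodule.mem_sup.1 h1
          rw [← huv, mul_add]
          refine Submodule.add_mem_sup ?_ (Ideal.mul_mem_left _ _ hv)
          rw [pow_succ']
          exact Ideal.mul_mem_mul hb hu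
        convert Ideal.add_mem _ h3 h4 using 1
        rw [Derivation.leibniz, smul_eq_mul, smul_eq_mul]
        push_cast; ring
      | add x _ y _ hx hy =>
        convert Ideal.add_mem _ hx hy using 1
        rw [map_add]; ring

end AlgGroup2

section AlgGroup3
open MvPolynomial

variable {F : Type} [Field F] {n : ℕ} (G : Subgroup (GL (Fin n) F))

theorem vanish_step [CharZero F] (S : Set (MvPolynomial (Fin n × Fin n) F))
    (hS1 : ∀ s ∈ S, mev 1 s = 0)
    (hSd : ∀ s ∈ S, ∀ Y ∈ zlie (G : Set (GL (Fin n) F)), der Y s ∈ Ideal.span S) (k : ℕ) :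
    ∀ s ∈ S, s ∈ (mone : Ideal (MvPolynomial (Fin n × Fin n) F)) ^ (k + 1) ⊔
      zideal (G : Set (GL (Fin n) F)) := by
  obtain ⟨E, hEI, hEJ, hEk⟩ := exists_euler2 G
  induction k with
  | zero =>
    intro s hs
    apply le_sup_left (α := Ideal (MvPolynomial (Fin n × Fin n) F))
    rw [zero_add, pow_one]
    exact hS1 s hs
  | succ k ih =>
    intro s hs
    have hspan : Ideal.span S ≤ (mone : Ideal (MvPolynomial (Fin n × Fin n) F)) ^ (k + 1) ⊔
      zideal (G : Set (GL (Fin n) F)) := Ideal.span_le.2 ih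
    have h1 : E s ∈ (mone : Ideal (MvPolynomial (Fin n × Fin n) F)) ^ (k + 1 + 1) ⊔
        zideal (G : Set (GL (Fin n) F)) := by
      apply hEJ _ _ s (fun Y hY => hspan (hSd s hs Y hY))
      rw [Ideal.mul_sup, pow_succ' _ (k+1)]
      exact sup_le_sup le_rfl Ideal.mul_le_right
    obtain ⟨a, ha, b, hb, hab⟩ := Submodule.mem_sup.1 (ih s hs)
    have h2 := hEk (k + 1) a ha
    have h3 : E b - ((k + 1 : ℕ) : MvPolynomial (Fin n × Fin n) F) * b ∈
        (mone : Ideal (MvPolynomial (Fin n × Fin n) F)) ^ (k + 1 + 1) ⊔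
        zideal (G : Set (GL (Fin n) F)) :=
      (le_sup_right : _ ≤ (mone : Ideal (MvPolynomial (Fin n × Fin n) F)) ^ (k + 1 + 1) ⊔
        zideal (G : Set (GL (Fin n) F))) (Ideal.sub_mem _ (hEI b hb) (Ideal.mul_mem_left _ _ hb))
    have h4 := Ideal.sub_mem _ h1 (Ideal.add_mem _ h2 h3)
    have h5 := Ideal.mul_mem_left _ (C (((k + 1 : ℕ) : F)⁻¹)) h4
    convert h5 using 1
    rw [← hab, map_add]
    have hk : (((k + 1 : ℕ) : F)) ≠ 0 := by exact_mod_cast Nat.succ_ne_zero k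
    have hc : (C (((k + 1 : ℕ) : F)⁻¹) : MvPolynomial (Fin n × Fin n) F) *
        ((k + 1 : ℕ) : MvPolynomial (Fin n × Fin n) F) = 1 := by
      rw [show (((k + 1 : ℕ) : MvPolynomial (Fin n × Fin n) F)) = C (((k+1 : ℕ) : F)) by simp,
        ← C_mul, inv_mul_cancel₀ hk, C_1]
    linear_combination (-a - b) * hc

theorem vanish_local [CharZero F] (S : Set (MvPolynomial (Fin n × Fin n) F))
    (hS1 : ∀ s ∈ S, mev 1 s = 0)
    (hSd : ∀ s ∈ S, ∀ Y ∈ zlie (G : Set (GL (Fin n) F)), der Y s ∈ Ideal.span S) :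
    ∃ u : MvPolynomial (Fin n × Fin n) F, mev 1 u = 1 ∧
      ∀ s ∈ S, u * s ∈ zideal (G : Set (GL (Fin n) F)) := by
  have h1 : ∀ s ∈ S, ∃ u : MvPolynomial (Fin n × Fin n) F, mev 1 u = 1 ∧
      u * s ∈ zideal (G : Set (GL (Fin n) F)) := by
    intro s hs
    have hk : (Submodule.Quotient.mk s : MvPolynomial (Fin n × Fin n) F ⧸ zideal (G : Set (GL (Fin n) F))) ∈
        ⨅ i : ℕ, (mone : Ideal (MvPolynomial (Fin n × Fin n) F)) ^ i •
        (⊤ : Submodule (MvPolynomial (Fin n × Fin n) F) (MvPolynomial (Fin n × Fin n) F ⧸ zideal (G : Set (GL (Fin n) F)))) := by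
      rw [Submodule.mem_iInf]
      intro i
      cases i with
      | zero => simp
      | succ k =>
        obtain ⟨a, ha, b, hb, hab⟩ := Submodule.mem_sup.1 (vanish_step G S hS1 hSd k s hs)
        have : (Submodule.Quotient.mk s : MvPolynomial (Fin n × Fin n) F ⧸ zideal (G : Set (GL (Fin n) F))) =
            a • Submodule.Quotient.mk 1 := by
          rw [← Submodule.Quotient.mk_smul, Submodule.Quotient.eq, ← hab, smul_eq_mul, mul_one,
            add_sub_cancel_left]
          exact hb
        rw [this]
        exact Submodule.smul_mem_smul ha trivial
    rw [Ideal.mem_iInf_smul_pow_eq_bot_iff] at hk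
    obtain ⟨r, hr⟩ := hk
    refine ⟨1 - r, ?_, ?_⟩
    · rw [map_sub, map_one, (mem_mone.1 r.2 : mev 1 (r : MvPolynomial (Fin n × Fin n) F) = 0), sub_zero]
    · rw [← Submodule.Quotient.mk_smul, Submodule.Quotient.eq] at hr
      have := Ideal.neg_mem_iff _ |>.2 hr
      convert this using 1
      rw [smul_eq_mul]; ring
  classical
  choose! u hu1 hu using h1
  obtain ⟨t, htS, ht⟩ := (Submodule.fg_span_iff_fg_span_finset_subset S).1
    (IsNoetherian.noetherian (Ideal.span S))
  refine ⟨∏ s ∈ t, u s, ?_, ?_⟩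
  · rw [map_prod]
    exact Finset.prod_eq_one fun s hs => hu1 s (htS hs)
  · intro s hs
    have hs' : s ∈ Submodule.span (MvPolynomial (Fin n × Fin n) F) (t : Set (MvPolynomial (Fin n × Fin n) F)) := by
      rw [← ht]; exact Submodule.subset_span hs
    clear hs
    induction hs' using Submodule.span_induction with
    | mem x hx =>
      rw [← Finset.mul_prod_erase t u hx]
      have := Ideal.mul_mem_left _ (∏ s ∈ t.erase x, u s) (hu x (htS hx))
      convert this using 1; ring
    | zero => simp
    | add x y _ _ hx hy => rw [mul_add]; exact Ideal.add_mem _ hx hy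
    | smul a x _ hx =>
      have := Ideal.mul_mem_left _ a hx
      convert this using 1; rw [smul_eq_mul]; ring
  
theorem vanish_connected [CharZero F] (hconn : IsZConnected (G : Set (GL (Fin n) F)))
    (S : Set (MvPolynomial (Fin n × Fin n) F))
    (hS1 : ∀ s ∈ S, mev 1 s = 0)
    (hSd : ∀ s ∈ S, ∀ Y ∈ zlie (G : Set (GL (Fin n) F)), der Y s ∈ Ideal.span S)
    (hmul : ∀ g h : GL (Fin n) F, (∀ s ∈ S, mev (g : Matrix (Fin n) (Fin n) F) s = 0) →
      (∀ s ∈ S, mev (h : Matrix (Fin n) (Fin n) F) s = 0) →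
      ∀ s ∈ S, mev ((g * h : GL (Fin n) F) : Matrix (Fin n) (Fin n) F) s = 0) :
    ∀ g ∈ G, ∀ s ∈ S, mev (g : Matrix (Fin n) (Fin n) F) s = 0 := by
  obtain ⟨u, hu1, hu⟩ := vanish_local G S hS1 hSd
  by_contra hcon
  push Not at hcon
  obtain ⟨g0, hg0, s0, hs0, hne⟩ := hcon
  let C1 : Set (GL (Fin n) F) := {g | ∀ s ∈ S, mev (g : Matrix (Fin n) (Fin n) F) s = 0}
  let P2 : Set (MvPolynomial (Fin n × Fin n) F) :=
    {p | ∃ h : GL (Fin n) F, h ∈ G ∧ h ∈ C1 ∧ p = ltr ((h⁻¹ : GL (Fin n) F) : Matrix (Fin n) (Fin n) F) u}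
  let C2 : Set (GL (Fin n) F) := {g | ∀ p ∈ P2, mev (g : Matrix (Fin n) (Fin n) F) p = 0}
  have hcov : ∀ g ∈ G, g ∈ C1 ∨ g ∈ C2 := by
    intro g hg
    by_contra hh
    push Not at hh
    obtain ⟨h1, h2⟩ := hh
    apply h2
    rintro _ ⟨h, hh, hhC, rfl⟩
    by_contra h3
    apply h1
    rw [mev_ltr] at h3
    have h4 : (h⁻¹ * g) ∈ C1 := by
      intro s hs
      have := hu s hs (h⁻¹ * g) (G.mul_mem (G.inv_mem hh) hg)
      rw [map_mul] at this
      rcases mul_eq_zero.1 this with h5 | h5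
      · exact absurd h5 h3
      · exact h5
    have := hmul h (h⁻¹ * g) hhC h4
    rw [mul_inv_cancel_left] at this
    exact this
  obtain ⟨g, hg, hgC1, hgC2⟩ := hconn C1 C2 ⟨S, rfl⟩ ⟨P2, rfl⟩ hcov
    ⟨1, G.one_mem, by intro s hs; simpa using hS1 s hs⟩
    ⟨g0, hg0, by
      rcases hcov g0 hg0 with h | h
      · exact absurd (h s0 hs0) hne
      · exact h⟩
  have := hgC2 _ ⟨g, hg, hgC1, rfl⟩
  rw [mev_ltr] at this
  have h2 : ((g⁻¹ : GL (Fin n) F) : Matrix (Fin n) (Fin n) F) * (g : Matrix (Fin n) (Fin n) F) = 1 := by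
    rw [← Units.val_mul, inv_mul_cancel, Units.val_one]
  rw [h2, hu1] at this
  exact one_ne_zero this

/-- the polynomial `x ↦ ℓ (x w)` -/
noncomputable def lwpoly (l : Module.Dual F (Fin n → F)) (w : Fin n → F) :
    MvPolynomial (Fin n × Fin n) F :=
  linpoly (fun q => l (Pi.single q.1 1) * w q.2)

theorem mev_lwpoly (l : Module.Dual F (Fin n → F)) (w : Fin n → F) (x : Matrix (Fin n) (Fin n) F) :
    mev x (lwpoly l w) = l (x.mulVec w) := by
  rw [lwpoly, mev_linpoly, Fintype.sum_prod_type]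
  have : x.mulVec w = ∑ i, (x.mulVec w) i • (Pi.single i 1 : Fin n → F) := by
    ext j; simp [Pi.single_apply]
  rw [this, map_sum]
  refine Finset.sum_congr rfl fun i _ => ?_
  rw [map_smul, smul_eq_mul, Matrix.mulVec, dotProduct, Finset.sum_mul]
  exact Finset.sum_congr rfl fun j _ => by ring

theorem der_lwpoly (l : Module.Dual F (Fin n → F)) (w : Fin n → F) (Y : Matrix (Fin n) (Fin n) F) :
    der Y (lwpoly l w) = lwpoly l (Y.mulVec w) := by
  rw [lwpoly, lwpoly, linpoly, linpoly, map_sum, Fintype.sum_prod_type, Fintype.sum_prod_type]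
  refine Finset.sum_congr rfl fun i _ => ?_
  simp only [der_CX]
  simp only [der_X, Finset.mul_sum, Matrix.mulVec, dotProduct, C_mul, map_sum,
    Finset.sum_mul]
  rw [Finset.sum_comm]
  refine Finset.sum_congr rfl fun j _ => Finset.sum_congr rfl fun k _ => ?_
  ring

/-- (L1) Lie-algebra stable subspaces are stable under the connected group -/
theorem stable_of_zlie_stable [CharZero F] (hconn : IsZConnected (G : Set (GL (Fin n) F)))
    (W : Submodule F (Fin n → F))
    (hW : ∀ Y ∈ zlie (G : Set (GL (Fin n) F)), ∀ w ∈ W, Y.mulVec w ∈ W) :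
    ∀ g ∈ G, ∀ w ∈ W, (g : Matrix (Fin n) (Fin n) F).mulVec w ∈ W := by
  have := vanish_connected G hconn {p | ∃ l : Module.Dual F (Fin n → F), ∃ w ∈ W, W ≤ LinearMap.ker l ∧
      p = lwpoly l w} (by
        rintro _ ⟨l, w, hw, hl, rfl⟩
        rw [mev_lwpoly, Matrix.one_mulVec]; exact hl hw) (by
        rintro _ ⟨l, w, hw, hl, rfl⟩ Y hY
        rw [der_lwpoly]
        exact Ideal.subset_span ⟨l, _, hW Y hY w hw, hl, rfl⟩) (by
        rintro g h hg hh _ ⟨l, w, hw, hl, rfl⟩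
        rw [mev_lwpoly, Units.val_mul, ← Matrix.mulVec_mulVec]
        have h1 : (h : Matrix (Fin n) (Fin n) F).mulVec w ∈ W := by
          by_contra hn
          obtain ⟨f, hf, hle⟩ := Submodule.exists_le_ker_of_notMem hn
          apply hf
          rw [← mev_lwpoly]
          exact hh _ ⟨f, w, hw, hle, rfl⟩
        rw [← mev_lwpoly]
        exact hg _ ⟨l, _, h1, hl, rfl⟩)
  intro g hg w hw
  by_contra hn
  obtain ⟨f, hf, hle⟩ := Submodule.exists_le_ker_of_notMem hn
  apply hf
  rw [← mev_lwpoly]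
  exact this g hg _ ⟨f, w, hw, hle, rfl⟩

/-- (L2) -/
theorem zlie_stable_of_stable (W : Submodule F (Fin n → F))
    (hW : ∀ g ∈ G, ∀ w ∈ W, (g : Matrix (Fin n) (Fin n) F).mulVec w ∈ W) :
    ∀ Y ∈ zlie (G : Set (GL (Fin n) F)), ∀ w ∈ W, Y.mulVec w ∈ W := by
  intro Y hY w hw
  have := zlie_mem_span G hY
  clear hY
  induction this using Submodule.span_induction with
  | mem x hx => obtain ⟨g, hg, rfl⟩ := hx; exact hW g hg w hw
  | zero => simp
  | add x y _ _ hx hy => rw [Matrix.add_mulVec]; exact W.add_mem hx hy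
  | smul a x _ hx => rw [Matrix.smul_mulVec]; exact W.smul_mem _ hx

end AlgGroup3

section AlgGroup4
open MvPolynomial

/-- eigen-decomposition is inherited by stable subspaces -/
theorem mem_iSup_inf_of_stable {K M ι : Type} [Field K] [AddCommGroup M] [Module K M]
    (f : Module.End K M) (I : Submodule K M) (hI : ∀ x ∈ I, f x ∈ I)
    (c : ι → K) (hc : Function.Injective c) (B : ι → Submodule K M)
    (hB : ∀ i, B i ≤ f.maxGenEigenspace (c i)) (x : M) (hx : x ∈ I) (hxB : x ∈ ⨆ i, B i) :
    x ∈ ⨆ i, B i ⊓ I := by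
  obtain ⟨v, hv, rfl⟩ := (Submodule.mem_iSup_iff_exists_finsupp _ _).1 hxB
  let f' : Module.End K (M ⧸ I) := I.mapQ I f hI
  have hind : iSupIndep (fun i => f'.maxGenEigenspace (c i)) :=
    (Module.End.independent_maxGenEigenspace f').comp hc
  have hpow : ∀ (a : K) (k : ℕ) (y : M), ((f' - a • 1) ^ k) (I.mkQ y) = I.mkQ (((f - a • 1) ^ k) y) := by
    intro a k
    induction k with
    | zero => intro y; simp
    | succ k ih =>
      intro y
      rw [pow_succ, pow_succ, Module.End.mul_apply, Module.End.mul_apply, ← ih]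
      congr 1
  have h0 := (iSupIndep_iff_finsetSum_eq_zero_imp_eq_zero _).1 hind v.support (fun i => I.mkQ (v i))
    (by
      intro i _
      obtain ⟨k, hk⟩ := (Module.End.mem_maxGenEigenspace _ _ _).1 (hB i (hv i))
      rw [Module.End.mem_maxGenEigenspace]
      exact ⟨k, by rw [hpow, hk, map_zero]⟩)
    (by
      rw [← map_sum]
      exact (Submodule.Quotient.mk_eq_zero I).2 hx)
  apply Submodule.sum_mem
  intro i hi
  exact Submodule.mem_iSup_of_mem i ⟨hv i, (Submodule.Quotient.mk_eq_zero I).1 (h0 i hi)⟩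

variable {F : Type} [Field F] {n : ℕ} (G : Subgroup (GL (Fin n) F))

theorem gen_mul (D : Derivation F (MvPolynomial (Fin n × Fin n) F) (MvPolynomial (Fin n × Fin n) F))
    (c d : F) : ∀ (m k l : ℕ) (p q : MvPolynomial (Fin n × Fin n) F), k + l = m →
    (((D : Module.End F (MvPolynomial (Fin n × Fin n) F)) - c • 1) ^ k) p = 0 →
    (((D : Module.End F (MvPolynomial (Fin n × Fin n) F)) - d • 1) ^ l) q = 0 →
    (((D : Module.End F (MvPolynomial (Fin n × Fin n) F)) - (c + d) • 1) ^ m) (p * q) = 0 := by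
  intro m
  induction m with
  | zero =>
    intro k l p q hkl hp hq
    have : k = 0 := by omega
    subst this
    have : p = 0 := by simpa using hp
    simp [this]
  | succ m ih =>
    intro k l p q hkl hp hq
    cases k with
    | zero =>
      have : p = 0 := by simpa using hp
      simp [this]
    | succ k =>
      cases l with
      | zero =>
        have : q = 0 := by simpa using hq
        simp [this]
      | succ l =>
        rw [pow_succ, Module.End.mul_apply]
        have h1 : ((D : Module.End F (MvPolynomial (Fin n × Fin n) F)) - (c + d) • 1) (p * q) =
          (((D : Module.End F (MvPolynomial (Fin n × Fin n) F)) - c • 1) p) * q +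
          p * (((D : Module.End F (MvPolynomial (Fin n × Fin n) F)) - d • 1) q) := by
          simp only [LinearMap.sub_apply, LinearMap.smul_apply, Module.End.one_apply,
            Derivation.coeFn_coe, Derivation.leibniz, smul_eq_mul, MvPolynomial.smul_eq_C_mul, C_add]
          ring
        rw [h1, map_add]
        rw [ih k (l+1) _ q (by omega) (by rw [pow_succ, Module.End.mul_apply] at hp; exact hp) hq,
          ih (k+1) l p _ (by omega) hp (by rw [pow_succ, Module.End.mul_apply] at hq; exact hq), add_zero]

theorem rtr_lwpoly (l : Module.Dual F (Fin n → F)) (w : Fin n → F) (Y : Matrix (Fin n) (Fin n) F) :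
    rtr Y (lwpoly l w) = lwpoly l (Y.mulVec w) := by
  rw [lwpoly, lwpoly, linpoly, linpoly, map_sum, Fintype.sum_prod_type, Fintype.sum_prod_type]
  refine Finset.sum_congr rfl fun i _ => ?_
  simp only [rtr, map_mul, aeval_X, aeval_C, MvPolynomial.algebraMap_eq]
  simp only [Finset.mul_sum, Matrix.mulVec, dotProduct, C_mul, map_sum,
    Finset.sum_mul]
  rw [Finset.sum_comm]
  refine Finset.sum_congr rfl fun j _ => Finset.sum_congr rfl fun k _ => ?_
  ring

theorem lwpoly_add (l : Module.Dual F (Fin n → F)) (w w' : Fin n → F) :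
    lwpoly l (w + w') = lwpoly l w + lwpoly l w' := by
  rw [lwpoly, lwpoly, lwpoly, linpoly, linpoly, linpoly, ← Finset.sum_add_distrib]
  refine Finset.sum_congr rfl fun i _ => ?_
  simp only [Pi.add_apply, mul_add, C_add, add_mul]

theorem lwpoly_smul (l : Module.Dual F (Fin n → F)) (c : F) (w : Fin n → F) :
    lwpoly l (c • w) = c • lwpoly l w := by
  rw [lwpoly, lwpoly, linpoly, linpoly, Finset.smul_sum]
  refine Finset.sum_congr rfl fun i _ => ?_
  simp only [Pi.smul_apply, smul_eq_mul, MvPolynomial.smul_eq_C_mul, C_mul]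
  ring

theorem X_eq_lwpoly (q : Fin n × Fin n) :
    (X q : MvPolynomial (Fin n × Fin n) F) = lwpoly (LinearMap.proj q.1) (Pi.single q.2 1) := by
  rw [lwpoly, linpoly, Finset.sum_eq_single q]
  · simp
  · intro b _ hb
    by_cases h : q.1 = b.1
    · have : b.2 ≠ q.2 := fun h2 => hb (Prod.ext h.symm h2)
      simp [this, Pi.single_apply]
    · simp [Pi.single_apply, h]
  · simp

/-- the weight pieces -/
noncomputable def wpiece (X S μ : Matrix (Fin n) (Fin n) F) (c d : F) :
    Submodule F (MvPolynomial (Fin n × Fin n) F) :=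
  (Module.End.eigenspace (der S : Module.End F (MvPolynomial (Fin n × Fin n) F)) c ⊓
  Module.End.eigenspace ((rtr μ).toLinearMap : Module.End F (MvPolynomial (Fin n × Fin n) F)) d) ⊓
  Module.End.maxGenEigenspace (der X : Module.End F (MvPolynomial (Fin n × Fin n) F)) c

theorem mem_wpiece {X S μ : Matrix (Fin n) (Fin n) F} {c d : F} {p : MvPolynomial (Fin n × Fin n) F} :
    p ∈ wpiece X S μ c d ↔ (der S p = c • p ∧ rtr μ p = d • p) ∧
      ∃ k : ℕ, (((der X : Module.End F (MvPolynomial (Fin n × Fin n) F)) - c • 1) ^ k) p = 0 := by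
  rw [wpiece, Submodule.mem_inf, Submodule.mem_inf, Module.End.mem_maxGenEigenspace,
    Module.End.mem_eigenspace_iff, Module.End.mem_eigenspace_iff]
  rfl

theorem wpiece_mul {X S μ : Matrix (Fin n) (Fin n) F} {c d c' d' : F} {p q : MvPolynomial (Fin n × Fin n) F}
    (hp : p ∈ wpiece X S μ c d) (hq : q ∈ wpiece X S μ c' d') : p * q ∈ wpiece X S μ (c + c') (d * d') := by
  rw [mem_wpiece] at *
  obtain ⟨⟨h1, h2⟩, k, hk⟩ := hp
  obtain ⟨⟨h1', h2'⟩, l, hl⟩ := hq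
  refine ⟨⟨?_, ?_⟩, k + l, gen_mul _ _ _ _ k l p q rfl hk hl⟩
  · rw [Derivation.leibniz, h1, h1']
    simp only [smul_eq_mul, MvPolynomial.smul_eq_C_mul, C_add]; ring
  · rw [map_mul, h2, h2']
    simp only [MvPolynomial.smul_eq_C_mul, C_mul]; ring

theorem wpiece_C {X S μ : Matrix (Fin n) (Fin n) F} (a : F) :
    (C a : MvPolynomial (Fin n × Fin n) F) ∈ wpiece X S μ 0 1 := by
  rw [mem_wpiece]
  refine ⟨⟨by rw [der_C, zero_smul], by rw [rtr, aeval_C, one_smul]; rfl⟩, 1, ?_⟩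
  rw [pow_one, zero_smul, sub_zero]
  exact der_C X a

theorem wpiece_lw {X S N μ : Matrix (Fin n) (Fin n) F} {a b : F} (l : Module.Dual F (Fin n → F)) (w : Fin n → F)
    (hX : X = S + N) (hc : S * N = N * S) (hN : IsNilpotent N) (hS : S.mulVec w = a • w)
    (hμ : μ.mulVec w = b • w) : lwpoly l w ∈ wpiece X S μ a b := by
  rw [mem_wpiece]
  refine ⟨⟨by rw [der_lwpoly, hS, lwpoly_smul], by rw [rtr_lwpoly, hμ, lwpoly_smul]⟩, ?_⟩
  obtain ⟨k, hk⟩ := hN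
  refine ⟨k, ?_⟩
  have key : ∀ (k : ℕ) (w : Fin n → F), S.mulVec w = a • w →
    (((der X : Module.End F (MvPolynomial (Fin n × Fin n) F)) - a • 1) ^ k) (lwpoly l w) =
      lwpoly l ((N ^ k).mulVec w) := by
    intro k
    induction k with
    | zero => intro w _; simp
    | succ k ih =>
      intro w hw
      rw [pow_succ, Module.End.mul_apply, pow_succ N, ← Matrix.mulVec_mulVec, ← ih]
      · congr 1
        rw [LinearMap.sub_apply, LinearMap.smul_apply, Module.End.one_apply, Derivation.coeFn_coe,
          der_lwpoly, hX, Matrix.add_mulVec, hw, lwpoly_add, lwpoly_smul, add_sub_cancel_left]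
      · rw [Matrix.mulVec_mulVec, hc, ← Matrix.mulVec_mulVec, hw, Matrix.mulVec_smul]
  rw [key k w hS, hk, Matrix.zero_mulVec]
  rw [← zero_smul F (0 : Fin n → F), lwpoly_smul, zero_smul]

theorem iSup_wpiece {X S N μ : Matrix (Fin n) (Fin n) F} {ι : Type} (w : ι → Fin n → F)
    (hw : Submodule.span F (Set.range w) = ⊤) (a : ι → F) (Λ : AddSubgroup F) (ha : ∀ i, a i ∈ Λ)
    (e : Λ → F) (he0 : e 0 = 1) (he : ∀ x y, e (x + y) = e x * e y)
    (hX : X = S + N) (hc : S * N = N * S) (hN : IsNilpotent N)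
    (hS : ∀ i, S.mulVec (w i) = a i • w i)
    (hμ : ∀ i, μ.mulVec (w i) = e ⟨a i, ha i⟩ • w i) (p : MvPolynomial (Fin n × Fin n) F) :
    p ∈ ⨆ c : Λ, wpiece X S μ c (e c) := by
  have hmul : ∀ p q : MvPolynomial (Fin n × Fin n) F, p ∈ ⨆ c : Λ, wpiece X S μ c (e c) →
      q ∈ ⨆ c : Λ, wpiece X S μ c (e c) → p * q ∈ ⨆ c : Λ, wpiece X S μ c (e c) := by
    intro p q hp hq
    induction hp using Submodule.iSup_induction' with
    | mem i x hx =>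
      induction hq using Submodule.iSup_induction' with
      | mem j y hy =>
        apply Submodule.mem_iSup_of_mem (i + j)
        have := wpiece_mul hx hy
        rw [he]
        exact this
      | zero => rw [mul_zero]; exact Submodule.zero_mem _
      | add x y _ _ hx hy => rw [mul_add]; exact Submodule.add_mem _ hx hy
    | zero => rw [zero_mul]; exact Submodule.zero_mem _
    | add x y _ _ hx hy => rw [add_mul]; exact Submodule.add_mem _ hx hy
  have hlw : ∀ (l : Module.Dual F (Fin n → F)) (v : Fin n → F), lwpoly l v ∈ ⨆ c : Λ, wpiece X S μ c (e c) := by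
    intro l v
    have hv : v ∈ Submodule.span F (Set.range w) := by rw [hw]; trivial
    induction hv using Submodule.span_induction with
    | mem x hx =>
      obtain ⟨i, rfl⟩ := hx
      exact Submodule.mem_iSup_of_mem ⟨a i, ha i⟩ (wpiece_lw l (w i) hX hc hN (hS i) (hμ i))
    | zero => rw [← zero_smul F (0 : Fin n → F), lwpoly_smul, zero_smul]; exact Submodule.zero_mem _
    | add x y _ _ hx hy => rw [lwpoly_add]; exact Submodule.add_mem _ hx hy
    | smul c x _ hx => rw [lwpoly_smul]; exact Submodule.smul_mem _ _ hx
  induction p using MvPolynomial.induction_on with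
  | C b =>
    apply Submodule.mem_iSup_of_mem 0
    rw [he0]; exact wpiece_C b
  | add p q hp hq => exact Submodule.add_mem _ hp hq
  | mul_X p q hp => exact hmul _ _ hp (by rw [X_eq_lwpoly]; exact hlw _ _)

theorem zideal_iSup_wpiece {X S N μ : Matrix (Fin n) (Fin n) F} {ι : Type} (w : ι → Fin n → F)
    (hw : Submodule.span F (Set.range w) = ⊤) (a : ι → F) (Λ : AddSubgroup F) (ha : ∀ i, a i ∈ Λ)
    (e : Λ → F) (he0 : e 0 = 1) (he : ∀ x y, e (x + y) = e x * e y)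
    (hX : X = S + N) (hc : S * N = N * S) (hN : IsNilpotent N)
    (hS : ∀ i, S.mulVec (w i) = a i • w i)
    (hμ : ∀ i, μ.mulVec (w i) = e ⟨a i, ha i⟩ • w i) (hXg : X ∈ zlie (G : Set (GL (Fin n) F)))
    (p : MvPolynomial (Fin n × Fin n) F)
    (hp : p ∈ zideal (G : Set (GL (Fin n) F))) :
    p ∈ ⨆ c : Λ, wpiece X S μ c (e c) ⊓ (zideal (G : Set (GL (Fin n) F))).restrictScalars F := by
  apply mem_iSup_inf_of_stable (der X : Module.End F (MvPolynomial (Fin n × Fin n) F))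
    ((zideal (G : Set (GL (Fin n) F))).restrictScalars F) (fun x hx => der_mem_zideal G hXg hx)
    (fun c : Λ => (c : F)) Subtype.val_injective (fun c : Λ => wpiece X S μ c (e c))
    (fun i => inf_le_right) p hp (iSup_wpiece w hw a Λ ha e he0 he hX hc hN hS hμ p)

/-- Jordan parts stay in the Lie algebra -/
theorem zlie_jordan {X S N : Matrix (Fin n) (Fin n) F} {ι : Type} (w : ι → Fin n → F)
    (hw : Submodule.span F (Set.range w) = ⊤) (a : ι → F)
    (hX : X = S + N) (hc : S * N = N * S) (hN : IsNilpotent N)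
    (hS : ∀ i, S.mulVec (w i) = a i • w i) (hXg : X ∈ zlie (G : Set (GL (Fin n) F))) :
    S ∈ zlie (G : Set (GL (Fin n) F)) ∧ N ∈ zlie (G : Set (GL (Fin n) F)) := by
  have hSg : S ∈ zlie (G : Set (GL (Fin n) F)) := by
    apply zlie_of_der_mem
    intro p hp
    have := zideal_iSup_wpiece G (μ := 1) w hw a ⊤ (fun i => trivial) (fun _ => 1) rfl
      (fun _ _ => by rw [one_mul]) hX hc hN hS (fun i => by rw [Matrix.one_mulVec, one_smul]) hXg p hp
    clear hp
    induction this using Submodule.iSup_induction' with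
    | mem i x hx =>
      rw [(mem_wpiece.1 hx.1).1.1]
      exact ((zideal (G : Set (GL (Fin n) F))).restrictScalars F).smul_mem _ hx.2
    | zero => rw [map_zero]; exact Ideal.zero_mem _
    | add x y _ _ hx hy => rw [map_add]; exact Ideal.add_mem _ hx hy
  refine ⟨hSg, ?_⟩
  have : N = X - S := by rw [hX, add_sub_cancel_left]
  rw [this]
  exact Submodule.sub_mem _ hXg hSg

/-- torus elements from the semisimple part -/
theorem torus_mem {X S N : Matrix (Fin n) (Fin n) F} {ι : Type} (w : ι → Fin n → F)
    (hw : Submodule.span F (Set.range w) = ⊤) (a : ι → F) (Λ : AddSubgroup F) (ha : ∀ i, a i ∈ Λ)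
    (e : Λ → F) (he0 : e 0 = 1) (he : ∀ x y, e (x + y) = e x * e y)
    (hX : X = S + N) (hc : S * N = N * S) (hN : IsNilpotent N)
    (hS : ∀ i, S.mulVec (w i) = a i • w i) (hXg : X ∈ zlie (G : Set (GL (Fin n) F)))
    (hG : IsZClosed (G : Set (GL (Fin n) F))) (μ : GL (Fin n) F)
    (hμ : ∀ i, (μ : Matrix (Fin n) (Fin n) F).mulVec (w i) = e ⟨a i, ha i⟩ • w i) : μ ∈ G := by
  apply mem_of_zclosed hG
  intro p hp
  have := zideal_iSup_wpiece G w hw a Λ ha e he0 he hX hc hN hS hμ hXg p hp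
  clear hp
  rw [← one_mul (μ : Matrix (Fin n) (Fin n) F), ← mev_rtr]
  induction this using Submodule.iSup_induction' with
  | mem i x hx =>
    rw [(mem_wpiece.1 hx.1).1.2, MvPolynomial.smul_eq_C_mul, map_mul,
      (by simpa using hx.2 1 G.one_mem : mev 1 x = 0), mul_zero]
  | zero => simp
  | add x y _ _ hx hy => rw [map_add, map_add, hx, hy, add_zero]

end AlgGroup4

section AlgGroup5
open MvPolynomial

variable {F : Type} [Field F] {n : ℕ} (G : Subgroup (GL (Fin n) F))

/-- truncated exponential -/
noncomputable def texp (X : Matrix (Fin n) (Fin n) F) (k : ℕ) : Matrix (Fin n) (Fin n) F :=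
  ∑ i ∈ Finset.range k, ((i.factorial : F)⁻¹) • X ^ i

noncomputable def texpoly (X : Matrix (Fin n) (Fin n) F) (k : ℕ) (q : Fin n × Fin n) : Polynomial F :=
  ∑ i ∈ Finset.range k, Polynomial.C (((i.factorial : F)⁻¹ • X ^ i) q.1 q.2) * Polynomial.X ^ i

theorem texpoly_coeff (X : Matrix (Fin n) (Fin n) F) (k : ℕ) (q : Fin n × Fin n) (m : ℕ) :
    (texpoly X k q).coeff m = if m < k then (((m.factorial : F)⁻¹ • X ^ m) q.1 q.2) else 0 := by
  rw [texpoly, Polynomial.finsetSum_coeff]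
  simp only [Polynomial.coeff_C_mul, Polynomial.coeff_X_pow]
  simp [Finset.sum_ite_eq]

/-- pullback along the exponential curve -/
noncomputable def texpull (X : Matrix (Fin n) (Fin n) F) (k : ℕ) :
    MvPolynomial (Fin n × Fin n) F →ₐ[F] Polynomial F :=
  MvPolynomial.aeval (texpoly X k)

theorem texpull_der [CharZero F] (X : Matrix (Fin n) (Fin n) F) (k : ℕ) (hk : X ^ k = 0)
    (p : MvPolynomial (Fin n × Fin n) F) :
    Polynomial.derivative (texpull X k p) = texpull X k (der X p) := by
  induction p using MvPolynomial.induction_on with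
  | C a => rw [der_C, map_zero, texpull, aeval_C]; simp
  | add p q hp hq => rw [map_add, map_add, map_add, map_add, hp, hq]
  | mul_X p q hp =>
    have hX : Polynomial.derivative (texpull X k (MvPolynomial.X q)) =
        texpull X k (der X (MvPolynomial.X q)) := by
      rw [der_X, map_sum]
      simp only [texpull, map_mul, aeval_X, aeval_C, Polynomial.algebraMap_eq]
      ext m
      rw [Polynomial.coeff_derivative, texpoly_coeff, Polynomial.finsetSum_coeff]
      simp only [Polynomial.coeff_C_mul, texpoly_coeff]
      have h1 : ((((m + 1).factorial : F)⁻¹ • X ^ (m + 1)) q.1 q.2) * ((m : F) + 1) =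
          ∑ l, X l q.2 * ((((m).factorial : F)⁻¹ • X ^ m) q.1 l) := by
        rw [pow_succ, Matrix.smul_apply, Matrix.mul_apply, Nat.factorial_succ, smul_eq_mul,
          Finset.mul_sum, Finset.sum_mul]
        refine Finset.sum_congr rfl fun l _ => ?_
        rw [Matrix.smul_apply, smul_eq_mul]
        have hm : ((m : F) + 1) ≠ 0 := by exact_mod_cast Nat.succ_ne_zero m
        push_cast
        rw [mul_inv]
        field_simp
      by_cases hm : m + 1 < k
      · rw [if_pos hm, h1]
        refine Finset.sum_congr rfl fun l _ => ?_
        rw [if_pos (by omega)]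
      · rw [if_neg hm, zero_mul]
        by_cases hm2 : m < k
        · have : m + 1 = k := by omega
          subst this
          rw [hk] at h1
          simp only [hm2, if_true]
          rw [← h1]; simp
        · simp [hm2]
    rw [map_mul, Polynomial.derivative_mul, Derivation.leibniz, map_add, smul_eq_mul, smul_eq_mul,
      map_mul, map_mul, hp, hX]
    ring

theorem texpull_eval (X : Matrix (Fin n) (Fin n) F) (k : ℕ) (s : F)
    (p : MvPolynomial (Fin n × Fin n) F) :
    Polynomial.eval s (texpull X k p) = mev (∑ i ∈ Finset.range k, s ^ i • ((i.factorial : F)⁻¹) • X ^ i) p := by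
  induction p using MvPolynomial.induction_on with
  | C a => rw [texpull, aeval_C]; simp
  | add p q hp hq => rw [map_add, Polynomial.eval_add, map_add, hp, hq]
  | mul_X p q hp =>
    rw [map_mul, Polynomial.eval_mul, map_mul, hp]
    congr 1
    rw [texpull, aeval_X, texpoly, Polynomial.eval_finsetSum, eval_X, Matrix.sum_apply]
    refine Finset.sum_congr rfl fun i _ => ?_
    simp [mul_comm]

theorem texp_mem [CharZero F] (hG : IsZClosed (G : Set (GL (Fin n) F)))
    (X : Matrix (Fin n) (Fin n) F) (hX : X ∈ zlie (G : Set (GL (Fin n) F))) (k : ℕ) (hk : X ^ k = 0)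
    (g : GL (Fin n) F) (hg : (g : Matrix (Fin n) (Fin n) F) = texp X k) : g ∈ G := by
  apply mem_of_zclosed hG
  intro p hp
  cases k with
  | zero =>
    rw [pow_zero] at hk
    have : (g : Matrix (Fin n) (Fin n) F) = ((1 : GL (Fin n) F) : Matrix (Fin n) (Fin n) F) := by
      rw [Units.val_one, ← mul_one (g : Matrix (Fin n) (Fin n) F), hk, mul_zero]
    rw [this]
    exact hp 1 G.one_mem
  | succ k =>
  have hit : ∀ m : ℕ, ∀ p ∈ zideal (G : Set (GL (Fin n) F)),
      Polynomial.eval 0 (Polynomial.derivative^[m] (texpull X (k + 1) p)) = 0 := by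
    intro m
    induction m with
    | zero =>
      intro p hp
      rw [Function.iterate_zero, id, texpull_eval]
      have : (∑ i ∈ Finset.range (k + 1), (0 : F) ^ i • ((i.factorial : F)⁻¹) • X ^ i) = 1 := by
        rw [Finset.sum_range_succ']
        simp
      rw [this]
      exact zideal_le_mone G hp
    | succ m ih =>
      intro p hp
      rw [Function.iterate_succ_apply, texpull_der X (k + 1) hk]
      exact ih _ (der_mem_zideal G hX hp)
  have h0 : texpull X (k + 1) p = 0 := by
    ext m
    have := hit m p hp
    rw [← Polynomial.coeff_zero_eq_eval_zero, Polynomial.coeff_iterate_derivative, zero_add,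
      Nat.descFactorial_self, nsmul_eq_mul] at this
    rcases mul_eq_zero.1 this with h | h
    · exact absurd h (by exact_mod_cast Nat.factorial_ne_zero m)
    · rw [h, Polynomial.coeff_zero]
  have h1 := texpull_eval X (k + 1) 1 p
  rw [h0, Polynomial.eval_zero] at h1
  simp only [one_pow, one_smul] at h1
  rw [hg, texp]
  exact h1.symm

theorem texp_unit (X : Matrix (Fin n) (Fin n) F) (hX : IsNilpotent X) (k : ℕ) :
    ∃ g : GL (Fin n) F, (g : Matrix (Fin n) (Fin n) F) = texp X (k + 1) := by
  have h : IsUnit (texp X (k + 1)) := by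
    have : texp X (k + 1) = 1 + X * ∑ i ∈ Finset.range k, (((i + 1).factorial : F)⁻¹) • X ^ i := by
      rw [texp, Finset.sum_range_succ', add_comm, Finset.mul_sum]
      simp [pow_succ']
    rw [this]
    apply IsNilpotent.isUnit_one_add
    apply Commute.isNilpotent_mul_right _ hX
    apply Commute.sum_right
    intro i _
    exact (Commute.pow_right rfl i).smul_right _
  obtain ⟨g, hg⟩ := h
  exact ⟨g, hg⟩

theorem eq_zero_of_texp_eq_one (X : Matrix (Fin n) (Fin n) F) (hX : IsNilpotent X) (k : ℕ)
    (h : texp X (k + 2) = 1) : X = 0 := by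
  have h1 : texp X (k + 2) = 1 + X * ∑ i ∈ Finset.range (k + 1), (((i + 1).factorial : F)⁻¹) • X ^ i := by
    rw [texp, Finset.sum_range_succ', add_comm, Finset.mul_sum]
    simp [pow_succ']
  have hu : IsUnit (∑ i ∈ Finset.range (k + 1), (((i + 1).factorial : F)⁻¹) • X ^ i) := by
    have : (∑ i ∈ Finset.range (k + 1), (((i + 1).factorial : F)⁻¹) • X ^ i) =
        1 + X * ∑ i ∈ Finset.range k, (((i + 1 + 1).factorial : F)⁻¹) • X ^ i := by
      rw [Finset.sum_range_succ', add_comm, Finset.mul_sum]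
      simp [pow_succ']
    rw [this]
    apply IsNilpotent.isUnit_one_add
    apply Commute.isNilpotent_mul_right _ hX
    apply Commute.sum_right
    intro i _
    exact (Commute.pow_right rfl i).smul_right _
  rw [h, left_eq_add] at h1
  exact (hu.mul_left_eq_zero).1 h1

/-- Laurent polynomial functions -/
def LaurentFn (f : Fˣ → F) : Prop :=
  ∃ (M : ℕ) (P : Polynomial F), ∀ s : Fˣ, (s : F) ^ M * f s = P.eval (s : F)

theorem LaurentFn.const (a : F) : LaurentFn (fun _ : Fˣ => a) :=
  ⟨0, Polynomial.C a, fun s => by simp⟩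

theorem LaurentFn.add {f g : Fˣ → F} (hf : LaurentFn f) (hg : LaurentFn g) :
    LaurentFn (fun s => f s + g s) := by
  obtain ⟨M, P, hP⟩ := hf
  obtain ⟨L, Q, hQ⟩ := hg
  refine ⟨M + L, Polynomial.X ^ L * P + Polynomial.X ^ M * Q, fun s => ?_⟩
  simp only [Polynomial.eval_add, Polynomial.eval_mul, Polynomial.eval_pow, Polynomial.eval_X, ← hP, ← hQ]
  ring

theorem LaurentFn.mul {f g : Fˣ → F} (hf : LaurentFn f) (hg : LaurentFn g) :
    LaurentFn (fun s => f s * g s) := by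
  obtain ⟨M, P, hP⟩ := hf
  obtain ⟨L, Q, hQ⟩ := hg
  refine ⟨M + L, P * Q, fun s => ?_⟩
  simp only [Polynomial.eval_mul, ← hP, ← hQ]
  ring

theorem LaurentFn.sum {ι : Type} (t : Finset ι) (f : ι → Fˣ → F) (hf : ∀ i ∈ t, LaurentFn (f i)) :
    LaurentFn (fun s => ∑ i ∈ t, f i s) := by
  classical
  induction t using Finset.induction_on with
  | empty => simpa using LaurentFn.const (0 : F)
  | insert a t ha ih =>
    simp only [Finset.sum_insert ha]
    exact (hf a (Finset.mem_insert_self _ _)).add (ih fun i hi => hf i (Finset.mem_insert_of_mem hi))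

theorem LaurentFn.poly (P : Polynomial F) : LaurentFn (fun s : Fˣ => P.eval (s : F)) :=
  ⟨0, P, fun s => by simp⟩

theorem LaurentFn.zpow (z : ℤ) : LaurentFn (fun s : Fˣ => ((s ^ z : Fˣ) : F)) := by
  obtain ⟨k, rfl | rfl⟩ := z.eq_nat_or_neg
  · exact ⟨0, Polynomial.X ^ k, fun s => by simp⟩
  · exact ⟨k, 1, fun s => by simp⟩

theorem LaurentFn.mev {c : Fˣ → Matrix (Fin n) (Fin n) F} (hc : ∀ i j, LaurentFn (fun s => c s i j))
    (p : MvPolynomial (Fin n × Fin n) F) : LaurentFn (fun s => mev (c s) p) := by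
  induction p using MvPolynomial.induction_on with
  | C a => simpa using LaurentFn.const a
  | add p q hp hq => simpa only [map_add] using hp.add hq
  | mul_X p q hp => simpa only [map_mul, eval_X] using hp.mul (hc q.1 q.2)

theorem LaurentFn.eq_zero [Infinite F] {f : Fˣ → F} (hf : LaurentFn f) (T : Set Fˣ) (hT : T.Infinite)
    (h : ∀ s ∈ T, f s = 0) : ∀ s, f s = 0 := by
  obtain ⟨M, P, hP⟩ := hf
  have : P = 0 := by
    apply Polynomial.eq_zero_of_infinite_isRoot
    apply (hT.image (f := fun s : Fˣ => (s : F)) (Units.val_injective.injOn)).mono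
    rintro _ ⟨s, hs, rfl⟩
    change P.eval (s : F) = 0
    rw [← hP, h s hs, mul_zero]
  intro s
  have h2 := hP s
  rw [this, Polynomial.eval_zero] at h2
  exact (mul_eq_zero.1 h2).resolve_left (pow_ne_zero _ s.ne_zero)

theorem LaurentFn.domain [Infinite F] {f g : Fˣ → F} (hf : LaurentFn f) (hg : LaurentFn g)
    (h : ∀ s, f s * g s = 0) : (∀ s, f s = 0) ∨ ∀ s, g s = 0 := by
  have hinf : (Set.univ : Set Fˣ).Infinite := by
    intro hfin
    have h1 : ({0}ᶜ : Set F).Finite := by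
      apply (hfin.image (fun s : Fˣ => (s : F))).subset
      intro x hx
      exact ⟨Units.mk0 x hx, trivial, rfl⟩
    exact (Set.finite_singleton (0 : F)).infinite_compl h1
  by_cases hfz : {s | f s = 0}.Infinite
  · exact Or.inl (hf.eq_zero _ hfz fun s hs => hs)
  · right
    apply hg.eq_zero {s | g s = 0} _ fun s hs => hs
    intro hgz
    apply hinf
    apply ((Set.not_infinite.1 hfz).union hgz).subset
    intro s _
    exact mul_eq_zero.1 (h s)

/-- a Laurent curve covered by two closed sets lies in one of them -/
theorem curve_dichotomy [Infinite F] (c : Fˣ → GL (Fin n) F)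
    (hc : ∀ i j, LaurentFn (fun s => (c s : Matrix (Fin n) (Fin n) F) i j))
    (C₁ C₂ : Set (GL (Fin n) F)) (h₁ : IsZClosed C₁) (h₂ : IsZClosed C₂)
    (hcov : ∀ s, c s ∈ C₁ ∨ c s ∈ C₂) : (∀ s, c s ∈ C₁) ∨ ∀ s, c s ∈ C₂ := by
  obtain ⟨I₁, rfl⟩ := h₁
  obtain ⟨I₂, rfl⟩ := h₂
  by_contra hcon
  push Not at hcon
  obtain ⟨⟨s, hs⟩, t, ht⟩ := hcon
  simp only [Set.mem_setOf_eq, not_forall] at hs ht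
  obtain ⟨p, hp, hps⟩ := hs
  obtain ⟨q, hq, hqt⟩ := ht
  rcases (LaurentFn.mev hc p).domain (LaurentFn.mev hc q) (fun s => by
    rcases hcov s with h | h
    · rw [show mev (c s : Matrix (Fin n) (Fin n) F) p = 0 from h p hp, zero_mul]
    · rw [show mev (c s : Matrix (Fin n) (Fin n) F) q = 0 from h q hq, mul_zero]) with h | h
  · exact hps (h s)
  · exact hqt (h t)

theorem zconnected_of_curves [Infinite F] (S : Set (GL (Fin n) F))
    (h : ∀ x ∈ S, ∀ y ∈ S, ∃ c : Fˣ → GL (Fin n) F,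
      (∀ i j, LaurentFn (fun s => (c s : Matrix (Fin n) (Fin n) F) i j)) ∧ (∀ s, c s ∈ S) ∧
      (∃ s, c s = x) ∧ ∃ s, c s = y) : IsZConnected S := by
  rintro C₁ C₂ h₁ h₂ hcov ⟨x, hx, hxC⟩ ⟨y, hy, hyC⟩
  obtain ⟨c, hc, hcS, ⟨s, hs⟩, t, ht⟩ := h x hx y hy
  rcases curve_dichotomy c hc C₁ C₂ h₁ h₂ (fun s => hcov (hcS s)) with h | h
  · exact ⟨y, hy, by rw [← ht]; exact h t, hyC⟩
  · exact ⟨x, hx, hxC, by rw [← hs]; exact h s⟩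

theorem LaurentFn.mul_left {c : Fˣ → Matrix (Fin n) (Fin n) F} (hc : ∀ i j, LaurentFn (fun s => c s i j))
    (x : Matrix (Fin n) (Fin n) F) (i j) : LaurentFn (fun s => (x * c s) i j) := by
  simp only [Matrix.mul_apply]
  exact LaurentFn.sum _ _ fun k _ => (LaurentFn.const _).mul (hc k j)

theorem LaurentFn.mul_right {c : Fˣ → Matrix (Fin n) (Fin n) F} (hc : ∀ i j, LaurentFn (fun s => c s i j))
    (x : Matrix (Fin n) (Fin n) F) (i j) : LaurentFn (fun s => (c s * x) i j) := by
  simp only [Matrix.mul_apply]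
  exact LaurentFn.sum _ _ fun k _ => (hc i k).mul (LaurentFn.const _)

end AlgGroup5

section AlgGroup6

open Polynomial in
theorem isNilpotent_of_trace_pow {K V : Type} [Field K] [CharZero K] [AddCommGroup V] [Module K V]
    [FiniteDimensional K V] (f : Module.End K V)
    (h : ∀ k : ℕ, LinearMap.trace K V (f ^ (k + 1)) = 0) : IsNilpotent f := by
  have hmon := LinearMap.charpoly_monic f
  obtain ⟨r, hr, hrd⟩ := exists_eq_pow_rootMultiplicity_mul_and_not_dvd f.charpoly hmon.ne_zero 0
  rw [C_0, sub_zero] at hr hrd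
  set a := rootMultiplicity 0 f.charpoly
  have hcop : IsCoprime ((X : K[X]) ^ (a + 1)) r :=
    IsCoprime.pow_left ((Polynomial.irreducible_X.coprime_iff_not_dvd).2 hrd)
  obtain ⟨u, v, huv⟩ := hcop
  have hch : aeval f (X ^ a * r) = 0 := by rw [← hr]; exact LinearMap.aeval_self_charpoly f
  have he : IsIdempotentElem (aeval f (u * X ^ (a + 1)) : Module.End K V) := by
    rw [IsIdempotentElem, ← map_mul, ← sub_eq_zero, ← map_sub]
    have : u * X ^ (a + 1) * (u * X ^ (a + 1)) - u * X ^ (a + 1) = -(u * X * v) * (X ^ a * r) := by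
      linear_combination (u * X ^ (a + 1)) * huv
    rw [this, map_mul, hch, mul_zero]
  have htr : ∀ p : K[X], LinearMap.trace K V (aeval f (p * X)) = 0 := by
    intro p
    induction p using Polynomial.induction_on' with
    | add p q hp hq => rw [add_mul, map_add, map_add, hp, hq, add_zero]
    | monomial k c =>
      rw [monomial_mul_X, aeval_monomial, ← Algebra.smul_def, map_smul, h, smul_zero]
  have he0 : (aeval f (u * X ^ (a + 1)) : Module.End K V) = 0 := by
    apply LinearMap.IsIdempotentElem.eq_zero_of_trace_eq_zero he
    rw [pow_succ, ← mul_assoc]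
    exact htr _
  refine ⟨a, ?_⟩
  have h1 : (X : Polynomial K) ^ a = X ^ a * (u * X ^ (a + 1)) + v * (X ^ a * r) := by
    linear_combination (-(X : Polynomial K) ^ a) * huv
  have h2 : (aeval f ((X : Polynomial K) ^ a) : Module.End K V) = 0 := by
    rw [h1, map_add, map_mul (aeval f) _ (u * X ^ (a + 1)), map_mul (aeval f) v, he0, hch, mul_zero, mul_zero, add_zero]
  simpa using h2

open MvPolynomial

variable {F : Type} [Field F] {n : ℕ} (G : Subgroup (GL (Fin n) F))

theorem matrix_nilp_pow (M : Matrix (Fin n) (Fin n) F) (h : IsNilpotent M) : M ^ n = 0 := by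
  have h1 : IsNilpotent (Matrix.toLin' M) := (Matrix.isNilpotent_toLin'_iff M).2 h
  have h2 := ((LinearMap.charpoly_nilpotent_tfae (Matrix.toLin' M)).out 0 1).1 h1
  have h3 := LinearMap.aeval_self_charpoly (Matrix.toLin' M)
  rw [h2, Module.finrank_fin_fun, Polynomial.aeval_X_pow, ← Matrix.toLin'_pow] at h3
  exact (LinearEquiv.map_eq_zero_iff Matrix.toLin').1 h3

theorem matrix_nilp_of_trace [CharZero F] (M : Matrix (Fin n) (Fin n) F)
    (h : ∀ k : ℕ, (M ^ (k + 1)).trace = 0) : IsNilpotent M := by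
  rw [← Matrix.isNilpotent_toLin'_iff]
  apply isNilpotent_of_trace_pow
  intro k
  rw [← Matrix.toLin'_pow, Matrix.trace_toLin'_eq, h]

theorem exists_linpoly (φ : Matrix (Fin n) (Fin n) F →ₗ[F] F) :
    ∃ p : MvPolynomial (Fin n × Fin n) F, ∀ x, mev x p = φ x := by
  refine ⟨linpoly (fun q => φ (Matrix.single q.1 q.2 1)), fun x => ?_⟩
  rw [mev_linpoly]
  conv_rhs => rw [Matrix.matrix_eq_sum_single x]
  rw [map_sum, Fintype.sum_prod_type]
  refine Finset.sum_congr rfl (fun i _ => ?_)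
  rw [map_sum]
  refine Finset.sum_congr rfl (fun j _ => ?_)
  have h : Matrix.single i j (x i j) = x i j • Matrix.single i j (1:F) := by
    rw [Matrix.smul_single, smul_eq_mul, mul_one]
  rw [h, map_smul, smul_eq_mul, mul_comm]

theorem IsZClosed.inter' {S T : Set (GL (Fin n) F)} (hS : IsZClosed S) (hT : IsZClosed T) :
    IsZClosed (S ∩ T) := by
  obtain ⟨I, rfl⟩ := hS
  obtain ⟨J, rfl⟩ := hT
  refine ⟨I ∪ J, ?_⟩
  ext g
  constructor
  · rintro ⟨h1, h2⟩ p (hp | hp)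
    · exact h1 p hp
    · exact h2 p hp
  · intro h
    exact ⟨fun p hp => h p (Or.inl hp), fun p hp => h p (Or.inr hp)⟩

theorem isZClosed_polys {ι : Type} (P : ι → MvPolynomial (Fin n × Fin n) F) :
    IsZClosed {g : GL (Fin n) F | ∀ i, mev (g : Matrix (Fin n) (Fin n) F) (P i) = 0} := by
  refine ⟨Set.range P, ?_⟩
  ext g
  constructor
  · rintro h _ ⟨i, rfl⟩; exact h i
  · intro h i; exact h _ ⟨i, rfl⟩

theorem isZClosed_affine {ι : Type} (φ : ι → Matrix (Fin n) (Fin n) F →ₗ[F] F) (c : ι → F) :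
    IsZClosed {g : GL (Fin n) F | ∀ i, φ i (g : Matrix (Fin n) (Fin n) F) = c i} := by
  choose p hp using fun i => exists_linpoly (φ i)
  have := isZClosed_polys (fun i => p i - C (c i))
  simp only [map_sub, hp, eval_C, sub_eq_zero] at this
  exact this

theorem IsZClosed.preimage {S : Set (GL (Fin n) F)} (hS : IsZClosed S) (a b : GL (Fin n) F) :
    IsZClosed {g | a * g * b ∈ S} := by
  obtain ⟨I, rfl⟩ := hS
  have := isZClosed_polys (fun p : I => ltr (a : Matrix (Fin n) (Fin n) F)
    (rtr (b : Matrix (Fin n) (Fin n) F) (p : MvPolynomial (Fin n × Fin n) F)))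
  convert this using 1
  ext g
  simp only [mev_ltr, mev_rtr]
  constructor
  · intro h p
    have := h p p.2
    rw [Units.val_mul, Units.val_mul] at this
    exact this
  · intro h p hp
    have := h ⟨p, hp⟩
    rw [← Units.val_mul, ← Units.val_mul] at this
    exact this

theorem IsZConnected.image {S : Set (GL (Fin n) F)} (hS : IsZConnected S) (a b : GL (Fin n) F) :
    IsZConnected (Set.image (fun g => a * g * b) S) := by
  rintro C₁ C₂ h₁ h₂ hcov ⟨_, ⟨x, hx, rfl⟩, hxC⟩ ⟨_, ⟨y, hy, rfl⟩, hyC⟩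
  obtain ⟨z, hz, hz1, hz2⟩ := hS _ _ (h₁.preimage a b) (h₂.preimage a b)
    (fun s hs => hcov ⟨s, hs, rfl⟩) ⟨x, hx, hxC⟩ ⟨y, hy, hyC⟩
  exact ⟨_, ⟨z, hz, rfl⟩, hz1, hz2⟩

theorem idcomp_normal {G12 : Subgroup (GL (Fin n) F)} (hG : IsIdentityComponent G G12) :
    ∀ k ∈ G12, ∀ g ∈ G, k * g * k⁻¹ ∈ G := by
  intro k hk g hg
  apply hG.2.2.2 (G.map (MulAut.conj k).toMonoidHom)
  · rintro _ ⟨x, hx, rfl⟩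
    exact G12.mul_mem (G12.mul_mem hk (hG.1 hx)) (G12.inv_mem hk)
  · have := hG.2.1.preimage k⁻¹ k
    convert this using 1
    ext x
    constructor
    · rintro ⟨y, hy, rfl⟩
      simp only [Set.mem_ofPred_eq]
      change k⁻¹ * (k * y * k⁻¹) * k ∈ G
      have : k⁻¹ * (k * y * k⁻¹) * k = y := by group
      rw [this]; exact hy
    · intro hx
      refine ⟨k⁻¹ * x * k, hx, ?_⟩
      change k * (k⁻¹ * x * k) * k⁻¹ = x
      group
  · exact hG.2.2.1.image k k⁻¹
  · exact ⟨g, hg, rfl⟩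

/-- the span of the group as an algebra -/
noncomputable def galg : Subalgebra F (Matrix (Fin n) (Fin n) F) :=
  Algebra.adjoin F (G.toSubmonoid.map (Units.coeHom (Matrix (Fin n) (Fin n) F)) : Set (Matrix (Fin n) (Fin n) F))

theorem galg_eq : Subalgebra.toSubmodule (galg G) =
    Submodule.span F (Set.image (fun g : GL (Fin n) F => (g : Matrix (Fin n) (Fin n) F)) (G : Set (GL (Fin n) F))) := by
  rw [galg, Algebra.adjoin_eq_span, Submonoid.closure_eq]
  rfl

theorem mem_galg_of_mem {g : GL (Fin n) F} (hg : g ∈ G) : (g : Matrix (Fin n) (Fin n) F) ∈ galg G :=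
  Algebra.subset_adjoin ⟨g, hg, rfl⟩

theorem zlie_le_galg {X : Matrix (Fin n) (Fin n) F} (hX : X ∈ zlie (G : Set (GL (Fin n) F))) :
    X ∈ galg G := by
  rw [← Subalgebra.mem_toSubmodule, galg_eq]
  exact zlie_mem_span G hX

theorem galg_induction {P : Matrix (Fin n) (Fin n) F → Prop} (h : ∀ g ∈ G, P (g : Matrix (Fin n) (Fin n) F))
    (h0 : P 0) (hadd : ∀ x y, P x → P y → P (x + y)) (hsmul : ∀ (c : F) x, P x → P (c • x)) :
    ∀ b ∈ galg G, P b := by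
  intro b hb
  rw [← Subalgebra.mem_toSubmodule, galg_eq] at hb
  induction hb using Submodule.span_induction with
  | mem x hx => obtain ⟨g, hg, rfl⟩ := hx; exact h g hg
  | zero => exact h0
  | add x y _ _ hx hy => exact hadd _ _ hx hy
  | smul a x _ hx => exact hsmul _ _ hx

/-- the radical of the trace form, as a group -/
def trrad : Subgroup (GL (Fin n) F) where
  carrier := {g | g ∈ G ∧ ∀ h ∈ G, ((g : Matrix (Fin n) (Fin n) F) * (h : Matrix (Fin n) (Fin n) F)).trace =
    (h : Matrix (Fin n) (Fin n) F).trace}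
  mul_mem' := by
    rintro a b ⟨ha, ha'⟩ ⟨hb, hb'⟩
    refine ⟨G.mul_mem ha hb, fun h hh => ?_⟩
    have := ha' (b * h) (G.mul_mem hb hh)
    rw [Units.val_mul, mul_assoc, ← Units.val_mul b h, this, Units.val_mul, hb' h hh]
  one_mem' := ⟨G.one_mem, fun h _ => by rw [Units.val_one, one_mul]⟩
  inv_mem' := by
    rintro a ⟨ha, ha'⟩
    refine ⟨G.inv_mem ha, fun h hh => ?_⟩
    have := ha' (a⁻¹ * h) (G.mul_mem (G.inv_mem ha) hh)
    rw [← Units.val_mul, mul_inv_cancel_left, Units.val_mul] at this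
    exact this.symm

theorem mem_trrad {g : GL (Fin n) F} : g ∈ trrad G ↔ g ∈ G ∧ ∀ h ∈ G,
    ((g : Matrix (Fin n) (Fin n) F) * (h : Matrix (Fin n) (Fin n) F)).trace =
    (h : Matrix (Fin n) (Fin n) F).trace := Iff.rfl

theorem trrad_closed (hG : IsZClosed (G : Set (GL (Fin n) F))) :
    IsZClosed (trrad G : Set (GL (Fin n) F)) := by
  have := hG.inter' (isZClosed_affine (fun h : G => (Matrix.traceLinearMap (Fin n) F F) ∘ₗ
    LinearMap.mulRight F ((h : GL (Fin n) F) : Matrix (Fin n) (Fin n) F))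
    (fun h : G => ((h : GL (Fin n) F) : Matrix (Fin n) (Fin n) F).trace))
  convert this using 1
  ext g
  constructor
  · rintro ⟨h1, h2⟩
    exact ⟨h1, fun h => h2 h h.2⟩
  · rintro ⟨h1, h2⟩
    exact ⟨h1, fun h hh => h2 ⟨h, hh⟩⟩

theorem trrad_unip [CharZero F] {u : GL (Fin n) F} (hu : u ∈ trrad G) : IsUnipotentElem u := by
  apply matrix_nilp_pow
  have h1 : ∀ k : ℕ, ((u : Matrix (Fin n) (Fin n) F) ^ k).trace = (1 : Matrix (Fin n) (Fin n) F).trace := by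
    intro k
    have := ((mem_trrad G).1 ((trrad G).pow_mem hu k)).2 1 G.one_mem
    rwa [Units.val_pow_eq_pow_val, Units.val_one, mul_one] at this
  apply matrix_nilp_of_trace
  intro k
  rw [sub_eq_add_neg, (Commute.neg_right (Commute.one_right _)).add_pow, Matrix.trace_sum]
  have h2 : ∀ i : ℕ, ((u : Matrix (Fin n) (Fin n) F) ^ i * (-1) ^ (k + 1 - i) * ((k + 1).choose i : Matrix (Fin n) (Fin n) F)).trace
     = ((1 : F) ^ i * (-1) ^ (k + 1 - i) * ((k + 1).choose i : F)) * (1 : Matrix (Fin n) (Fin n) F).trace := by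
    intro i
    have h3 : (u : Matrix (Fin n) (Fin n) F) ^ i * (-1) ^ (k + 1 - i) * ((k + 1).choose i : Matrix (Fin n) (Fin n) F) =
      (((1 : F) ^ i * (-1) ^ (k + 1 - i) * ((k + 1).choose i : F))) • (u : Matrix (Fin n) (Fin n) F) ^ i := by
      rw [Algebra.smul_def, (Algebra.commutes _ _)]
      simp [mul_assoc]
    rw [h3, Matrix.trace_smul, h1, smul_eq_mul]
  rw [Finset.sum_congr rfl fun i _ => h2 i, ← Finset.sum_mul, ← (Commute.all (1 : F) (-1)).add_pow]
  simp

theorem unit_of_series (z : Matrix (Fin n) (Fin n) F) (hz : IsNilpotent z) (k : ℕ) (b : ℕ → F) (hb : b 0 = 1) :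
    IsUnit (∑ i ∈ Finset.range (k + 1), b i • z ^ i) := by
  have : (∑ i ∈ Finset.range (k + 1), b i • z ^ i) = 1 + z * ∑ i ∈ Finset.range k, b (i + 1) • z ^ i := by
    rw [Finset.sum_range_succ', add_comm, Finset.mul_sum]
    simp [pow_succ', hb]
  rw [this]
  apply IsNilpotent.isUnit_one_add
  apply Commute.isNilpotent_mul_right _ hz
  apply Commute.sum_right
  intro i _
  exact (Commute.pow_right rfl i).smul_right _

theorem zconnected_of_unip [CharZero F] (H : Subgroup (GL (Fin n) F))
    (hH : IsZClosed (H : Set (GL (Fin n) F))) (hu : ∀ h ∈ H, IsUnipotentElem h) :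
    IsZConnected (H : Set (GL (Fin n) F)) := by
  apply zconnected_of_curves
  intro x hx y hy
  set u := x⁻¹ * y with hudef
  have huH : u ∈ H := H.mul_mem (H.inv_mem hx) hy
  set z := (u : Matrix (Fin n) (Fin n) F) - 1 with hz
  have hzn : z ^ n = 0 := hu u huH
  let B : ℕ → Polynomial F := fun i =>
    (Polynomial.C ((i.factorial : F)⁻¹) * descPochhammer F i).comp (Polynomial.X - 1)
  have hB0 : ∀ s, (B 0).eval s = 1 := by intro s; simp [B]
  have hBm : ∀ m i : ℕ, (B i).eval ((m : F) + 1) = (m.choose i : F) := by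
    intro m i
    simp only [B, Polynomial.eval_comp, Polynomial.eval_sub, Polynomial.eval_X, Polynomial.eval_one,
      add_sub_cancel_right, Polynomial.eval_mul, Polynomial.eval_C, descPochhammer_eval_eq_descFactorial]
    rw [Nat.descFactorial_eq_factorial_mul_choose]
    push_cast
    rw [inv_mul_cancel_left₀]
    exact_mod_cast Nat.factorial_ne_zero i
  choose c0 hc0 using fun s : Fˣ => unit_of_series z ⟨n, hzn⟩ n (fun i => (B i).eval (s : F)) (hB0 _)
  have hpow : ∀ m : ℕ, ∑ i ∈ Finset.range (n + 1), (m.choose i : F) • z ^ i = (u : Matrix (Fin n) (Fin n) F) ^ m := by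
    intro m
    have hu1 : (u : Matrix (Fin n) (Fin n) F) = z + 1 := by rw [hz, sub_add_cancel]
    rw [hu1, (Commute.one_right z).add_pow]
    have e1 : ∀ i, z ^ i * 1 ^ (m - i) * ((m.choose i : ℕ) : Matrix (Fin n) (Fin n) F) = (m.choose i : F) • z ^ i := by
      intro i
      rw [one_pow, mul_one, Algebra.smul_def, (Algebra.commutes _ _)]
      simp
    rw [Finset.sum_congr rfl fun i _ => e1 i]
    have hbig : ∀ L, n + 1 ≤ L → m + 1 ≤ L → ∑ i ∈ Finset.range (n + 1), (m.choose i : F) • z ^ i =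
        ∑ i ∈ Finset.range (m + 1), (m.choose i : F) • z ^ i := by
      intro L h1 h2
      rw [Finset.sum_subset (Finset.range_mono h1), ← Finset.sum_subset (Finset.range_mono h2)]
      · intro i _ hi
        rw [Nat.choose_eq_zero_of_lt (by simpa using hi), Nat.cast_zero, zero_smul]
      · intro i _ hi
        have : n ≤ i := by have := Finset.mem_range.not.1 hi; omega
        rw [pow_eq_zero_of_le this hzn, smul_zero]
    exact hbig (n + m + 1) (by omega) (by omega)
  have hnat : ∀ m : ℕ, ((m : F) + 1) ≠ 0 := fun m => by exact_mod_cast Nat.succ_ne_zero m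
  have hcm : ∀ m : ℕ, c0 (Units.mk0 ((m : F) + 1) (hnat m)) = u ^ m := by
    intro m
    apply Units.ext
    rw [hc0, Units.val_pow_eq_pow_val, ← hpow m]
    refine Finset.sum_congr rfl fun i _ => ?_
    rw [Units.val_mk0, hBm]
  have hL : ∀ i j, LaurentFn (fun s => ((x * c0 s : GL (Fin n) F) : Matrix (Fin n) (Fin n) F) i j) := by
    simp only [Units.val_mul]
    apply LaurentFn.mul_left
    intro i j
    simp only [hc0, Matrix.sum_apply]
    apply LaurentFn.sum
    intro k _
    simp only [Matrix.smul_apply, smul_eq_mul]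
    exact (LaurentFn.poly _).mul (LaurentFn.const _)
  refine ⟨fun s => x * c0 s, hL, ?_, ⟨Units.mk0 (((0 : ℕ) : F) + 1) (hnat 0), ?_⟩, ⟨Units.mk0 (((1 : ℕ) : F) + 1) (hnat 1), ?_⟩⟩
  · intro s
    apply mem_of_zclosed hH
    intro p hp
    refine (LaurentFn.mev hL p).eq_zero (Set.range fun m : ℕ => Units.mk0 ((m : F) + 1) (hnat m)) ?_ ?_ s
    · apply Set.infinite_range_of_injective
      intro a b hab
      have := congrArg (Units.val) hab
      simpa using this
    · rintro _ ⟨m, rfl⟩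
      apply hp
      rw [hcm]
      exact H.mul_mem hx (H.pow_mem huH m)
  · change x * c0 _ = x
    rw [hcm, pow_zero, mul_one]
  · change x * c0 _ = y
    rw [hcm, pow_one, hudef, mul_inv_cancel_left]

theorem trace_nondeg [CharZero F] {G12 : Subgroup (GL (Fin n) F)} (hred : IsReductive G12)
    (hG : IsIdentityComponent G G12) (X : Matrix (Fin n) (Fin n) F) (hX : X ∈ zlie (G : Set (GL (Fin n) F)))
    (htr : ∀ h ∈ G, (X * (h : Matrix (Fin n) (Fin n) F)).trace = 0) : X = 0 := by
  have hbot : trrad G = ⊥ := by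
    apply hred _ _ (trrad_closed G hG.2.1)
      (zconnected_of_unip _ (trrad_closed G hG.2.1) fun h hh => trrad_unip G hh)
      (fun h hh => trrad_unip G hh)
    · intro k hk g hg
      refine ⟨idcomp_normal G hG k hk g hg.1, fun h hh => ?_⟩
      have h1 := hg.2 (k⁻¹ * h * k) (by
        have := idcomp_normal G hG k⁻¹ (G12.inv_mem hk) h hh
        rwa [inv_inv] at this)
      have h2 : ((k * g * k⁻¹ : GL (Fin n) F) : Matrix (Fin n) (Fin n) F) * (h : Matrix (Fin n) (Fin n) F) =
        (k : Matrix (Fin n) (Fin n) F) * ((g * (k⁻¹ * h) : GL (Fin n) F) : Matrix (Fin n) (Fin n) F) := by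
        rw [← Units.val_mul, ← Units.val_mul]; congr 1; group
      have h3 : ((g : Matrix (Fin n) (Fin n) F) * ((k⁻¹ * h * k : GL (Fin n) F) : Matrix (Fin n) (Fin n) F)) =
        ((g * (k⁻¹ * h) : GL (Fin n) F) : Matrix (Fin n) (Fin n) F) * (k : Matrix (Fin n) (Fin n) F) := by
        rw [← Units.val_mul, ← Units.val_mul]; congr 1; group
      rw [h3] at h1
      rw [h2, Matrix.trace_mul_comm, h1, Units.val_mul, Units.val_mul, mul_assoc, Matrix.trace_mul_comm, mul_assoc]
      rw [← Units.val_mul, mul_inv_cancel, Units.val_one, mul_one]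
    · intro g hg; exact hG.1 hg.1
  have htr2 : ∀ b ∈ galg G, (X * b).trace = 0 := by
    refine galg_induction G (P := fun b => (X * b).trace = 0) htr ?_ ?_ ?_
    · simp
    · intro x y hx hy; rw [mul_add, Matrix.trace_add, hx, hy, add_zero]
    · intro c x hx; rw [Matrix.mul_smul, Matrix.trace_smul, hx, smul_zero]
  have hnil : IsNilpotent X := by
    apply matrix_nilp_of_trace
    intro k
    rw [pow_succ']
    exact htr2 _ (Subalgebra.pow_mem _ (zlie_le_galg G hX) k)
  have hXn : X ^ (n + 2) = 0 := pow_eq_zero_of_le (by omega) (matrix_nilp_pow X hnil)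
  obtain ⟨g, hg⟩ := texp_unit X hnil (n + 1)
  have hgG : g ∈ G := texp_mem G hG.2.1 X hX (n + 2) hXn g hg
  have hgN : g ∈ trrad G := by
    refine ⟨hgG, fun h hh => ?_⟩
    rw [hg, texp, Finset.sum_range_succ', add_mul, Matrix.trace_add, Finset.sum_mul, Matrix.trace_sum]
    rw [Finset.sum_eq_zero]
    · simp
    · intro i _
      rw [Matrix.smul_mul, Matrix.trace_smul, pow_succ', mul_assoc, htr2, smul_zero]
      exact Subalgebra.mul_mem _ (Subalgebra.pow_mem _ (zlie_le_galg G hX) i) (mem_galg_of_mem G hh)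
  rw [hbot, Subgroup.mem_bot] at hgN
  apply eq_zero_of_texp_eq_one X hnil n
  rw [← hg, hgN, Units.val_one]

end AlgGroup6

section AlgGroup7
attribute [local instance] LieRing.ofAssociativeRing

variable {F : Type} [Field F] {n : ℕ} (G : Subgroup (GL (Fin n) F))

/-- the Lie algebra as a Lie algebra of endomorphisms -/
noncomputable def zlieEnd : LieSubalgebra F (Module.End F (Fin n → F)) where
  __ := (zlie (G : Set (GL (Fin n) F))).comap (LinearMap.toMatrix' : _ ≃ₗ[F] _).toLinearMap
  lie_mem' := by
    intro x y hx hy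
    have := zlie_bracket G hx hy
    change LinearMap.toMatrix' ⁅x, y⁆ ∈ zlie (G : Set (GL (Fin n) F))
    rw [LieRing.of_associative_ring_bracket, map_sub, LinearMap.toMatrix'_mul, LinearMap.toMatrix'_mul]
    exact this

theorem mem_zlieEnd {f : Module.End F (Fin n → F)} :
    f ∈ zlieEnd G ↔ LinearMap.toMatrix' f ∈ zlie (G : Set (GL (Fin n) F)) := Iff.rfl

theorem semisimple_eigen_span [IsAlgClosed F] (S : Module.End F (Fin n → F)) (hS : S.IsSemisimple) :
    Submodule.span F (Set.range (fun x : {x : (Fin n → F) × F // S x.1 = x.2 • x.1} => x.1.1)) = ⊤ := by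
  rw [eq_top_iff, ← hS.iSup_eigenspace_eq_top]
  refine iSup_le fun μ x hx => ?_
  exact Submodule.subset_span ⟨⟨(x, μ), Module.End.mem_eigenspace_iff.1 hx⟩, rfl⟩

theorem exists_group_compl [IsAlgClosed F] [CharZero F] {G12 : Subgroup (GL (Fin n) F)} (hred : IsReductive G12)
    (hG : IsIdentityComponent G G12) (W : Submodule F (Fin n → F))
    (hW : ∀ g ∈ G, ∀ w ∈ W, (g : Matrix (Fin n) (Fin n) F).mulVec w ∈ W) :
    ∃ U : Submodule F (Fin n → F),
      (∀ g ∈ G, ∀ w ∈ U, (g : Matrix (Fin n) (Fin n) F).mulVec w ∈ U) ∧ IsCompl W U := by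
  have tr : ∀ W : Submodule F (Fin n → F), (∀ X ∈ zlieEnd G, ∀ w ∈ W, X w ∈ W) →
      ∀ Y ∈ zlie (G : Set (GL (Fin n) F)), ∀ w ∈ W, Y.mulVec w ∈ W := by
    intro W h Y hY w hw
    have := h (Matrix.toLin' Y) (by rw [mem_zlieEnd, LinearMap.toMatrix'_toLin']; exact hY) w hw
    rwa [Matrix.toLin'_apply] at this
  obtain ⟨U, hU, hc⟩ := complete_red (zlieEnd G)
    ((galg G).comap (LinearMap.toMatrixAlgEquiv' : _ ≃ₐ[F] _).toAlgHom)
    (by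
      intro W hW b hb w hw
      have := galg_induction G (P := fun b => ∀ w ∈ W, b.mulVec w ∈ W)
        (stable_of_zlie_stable G hG.2.2.1 W (tr W hW))
        (fun w _ => by rw [Matrix.zero_mulVec]; exact W.zero_mem)
        (fun x y hx hy w hw => by rw [Matrix.add_mulVec]; exact W.add_mem (hx w hw) (hy w hw))
        (fun c x hx w hw => by rw [Matrix.smul_mulVec]; exact W.smul_mem c (hx w hw)) _ hb w hw
      rw [← Matrix.toLin'_apply] at this
      change Matrix.toLin' (LinearMap.toMatrix' b) w ∈ W at this
      rwa [Matrix.toLin'_toMatrix'] at this)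
    (by
      intro X hX h
      have h0 : LinearMap.toMatrix' X = 0 := trace_nondeg G hred hG _ hX (by
        intro g hg
        have := h (Matrix.toLin' (g : Matrix (Fin n) (Fin n) F)) (by
          change LinearMap.toMatrix' (Matrix.toLin' (g : Matrix (Fin n) (Fin n) F)) ∈ galg G
          rw [LinearMap.toMatrix'_toLin']
          exact mem_galg_of_mem G hg)
        rw [← Matrix.trace_toLin'_eq, Matrix.toLin'_mul, Matrix.toLin'_toMatrix']
        exact this)
      exact (LinearEquiv.map_eq_zero_iff _).1 h0)
    (by
      intro X hX N S hc hN hS hXNS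
      refine (zlie_jordan G _ (semisimple_eigen_span S hS) (fun x => x.1.2)
        (X := LinearMap.toMatrix' X) (S := LinearMap.toMatrix' S) (N := LinearMap.toMatrix' N) ?_ ?_ ?_ ?_ hX).2
      · rw [hXNS, map_add, add_comm]
      · rw [← LinearMap.toMatrix'_mul, ← LinearMap.toMatrix'_mul, hc.eq]
      · rw [← Matrix.isNilpotent_toLin'_iff, Matrix.toLin'_toMatrix']; exact hN
      · rintro ⟨x, hx⟩
        rw [← Matrix.toLin'_apply, Matrix.toLin'_toMatrix']; exact hx)
    W (by
      intro X hX w hw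
      have := zlie_stable_of_stable G W hW (LinearMap.toMatrix' X) hX w hw
      rwa [← Matrix.toLin'_apply, Matrix.toLin'_toMatrix'] at this)
  exact ⟨U, stable_of_zlie_stable G hG.2.2.1 U (tr U hU), hc⟩

end AlgGroup7

section AlgGroup8
open MvPolynomial

variable {F : Type} [Field F] {n : ℕ}

theorem dense_affine {T : Set (GL (Fin n) F)} {t : GL (Fin n) F}
    (hd : IsZClosure (Set.range fun k : ℤ => t ^ k) T) (φ : Matrix (Fin n) (Fin n) F →ₗ[F] F) (c : F)
    (h : ∀ k : ℤ, φ ((t ^ k : GL (Fin n) F) : Matrix (Fin n) (Fin n) F) = c) :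
    ∀ τ ∈ T, φ (τ : Matrix (Fin n) (Fin n) F) = c := by
  intro τ hτ
  exact hd.2.2 _ (isZClosed_affine (fun _ : Unit => φ) (fun _ => c))
    (by rintro _ ⟨k, rfl⟩ _; exact h k) hτ ()

theorem mem_of_dense {T : Set (GL (Fin n) F)} {t : GL (Fin n) F}
    (hd : IsZClosure (Set.range fun k : ℤ => t ^ k) T) : t ∈ T :=
  hd.2.1 ⟨1, zpow_one t⟩

theorem eigen_zpow (t : GL (Fin n) F) {lam : F} {v : Fin n → F} (hv : v ≠ 0)
    (h : (t : Matrix (Fin n) (Fin n) F).mulVec v = lam • v) (k : ℤ) :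
    ((t ^ k : GL (Fin n) F) : Matrix (Fin n) (Fin n) F).mulVec v = lam ^ k • v := by
  have hinv : ((t⁻¹ : GL (Fin n) F) : Matrix (Fin n) (Fin n) F).mulVec
      ((t : Matrix (Fin n) (Fin n) F).mulVec v) = v := by
    rw [Matrix.mulVec_mulVec, ← Units.val_mul, inv_mul_cancel, Units.val_one, Matrix.one_mulVec]
  have h0 : lam ≠ 0 := by
    rintro rfl
    rw [h, zero_smul, Matrix.mulVec_zero] at hinv
    exact hv hinv.symm
  induction k using Int.induction_on with
  | zero => simp
  | succ k ih =>
    rw [zpow_add_one, Units.val_mul, ← Matrix.mulVec_mulVec, h, Matrix.mulVec_smul, ih, smul_smul,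
      zpow_add_one₀ h0, mul_comm]
  | pred k ih =>
    rw [zpow_sub_one, Units.val_mul, ← Matrix.mulVec_mulVec]
    rw [h, Matrix.mulVec_smul] at hinv
    have : ((t⁻¹ : GL (Fin n) F) : Matrix (Fin n) (Fin n) F).mulVec v = lam⁻¹ • v := by
      rw [eq_inv_smul_iff₀ h0]; exact hinv
    rw [this, Matrix.mulVec_smul, ih, smul_smul, zpow_sub_one₀ h0, mul_comm]

theorem exists_dual_one {v : Fin n → F} (hv : v ≠ 0) : ∃ l : Module.Dual F (Fin n → F), l v = 1 := by
  obtain ⟨i, hi⟩ := Function.ne_iff.1 hv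
  exact ⟨(v i)⁻¹ • LinearMap.proj i, by simpa using inv_mul_cancel₀ hi⟩

/-- evaluation of a matrix on a vector followed by a functional -/
noncomputable def evl (l : Module.Dual F (Fin n → F)) (v : Fin n → F) : Matrix (Fin n) (Fin n) F →ₗ[F] F where
  toFun x := l (x.mulVec v)
  map_add' x y := by rw [Matrix.add_mulVec, map_add]
  map_smul' c x := by rw [Matrix.smul_mulVec, map_smul]; rfl

theorem evl_apply (l : Module.Dual F (Fin n → F)) (v : Fin n → F) (x) : evl l v x = l (x.mulVec v) := rfl

theorem torus_scalar {T : Set (GL (Fin n) F)} {t : GL (Fin n) F}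
    (hd : IsZClosure (Set.range fun k : ℤ => t ^ k) T) {lam : F} {v₀ : Fin n → F} (hv₀ : v₀ ≠ 0)
    (h₀ : (t : Matrix (Fin n) (Fin n) F).mulVec v₀ = lam • v₀) (l : Module.Dual F (Fin n → F)) (hl : l v₀ = 1)
    {τ : GL (Fin n) F} (hτ : τ ∈ T) {v : Fin n → F} (hv : (t : Matrix (Fin n) (Fin n) F).mulVec v = lam • v) :
    (τ : Matrix (Fin n) (Fin n) F).mulVec v = l ((τ : Matrix (Fin n) (Fin n) F).mulVec v₀) • v := by
  by_cases hv' : v = 0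
  · subst hv'; simp
  ext i
  have := dense_affine hd (evl (LinearMap.proj i) v - v i • evl l v₀) 0 (by
    intro k
    simp only [LinearMap.sub_apply, LinearMap.smul_apply, evl_apply, eigen_zpow t hv' hv, eigen_zpow t hv₀ h₀,
      map_smul, hl]
    simp [mul_comm]) τ hτ
  simp only [LinearMap.sub_apply, LinearMap.smul_apply, evl_apply, sub_eq_zero, smul_eq_mul] at this
  rw [Pi.smul_apply, smul_eq_mul, mul_comm, ← this]
  rfl

theorem torus_tf [CharZero F] {T : Subgroup (GL (Fin n) F)} {t : GL (Fin n) F}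
    (hd : IsZClosure (Set.range fun k : ℤ => t ^ k) (T : Set (GL (Fin n) F)))
    (hconn : IsZConnected (T : Set (GL (Fin n) F))) {a b : F} {v w : Fin n → F} (hv : v ≠ 0) (hw : w ≠ 0)
    (hva : (t : Matrix (Fin n) (Fin n) F).mulVec v = a • v)
    (hwb : (t : Matrix (Fin n) (Fin n) F).mulVec w = b • w) {m : ℕ} (hm : 1 ≤ m) (hab : a ^ m = b ^ m) : a = b := by
  obtain ⟨l, hl⟩ := exists_dual_one hv
  obtain ⟨k, hk⟩ := exists_dual_one hw
  set p := lwpoly l v with hp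
  set q := lwpoly k w with hq
  have hT0 : (T : Set (GL (Fin n) F)) ⊆ {g | ∀ _ : Unit, mev (g : Matrix (Fin n) (Fin n) F) (p ^ m - q ^ m) = 0} := by
    refine hd.2.2 _ (isZClosed_polys _) ?_
    rintro _ ⟨z, rfl⟩ _
    rw [map_sub, map_pow, map_pow, hp, hq, mev_lwpoly, mev_lwpoly, eigen_zpow t hv hva, eigen_zpow t hw hwb,
      map_smul, map_smul, hl, hk, smul_eq_mul, smul_eq_mul, mul_one, mul_one, ← zpow_natCast, ← zpow_mul,
      ← zpow_natCast, ← zpow_mul, mul_comm, zpow_mul, zpow_natCast, hab, zpow_mul, zpow_natCast, sub_self]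
  by_contra hne
  obtain ⟨τ, hτ, h1, h2⟩ := hconn _ _ (isZClosed_polys (fun _ : Unit => p - q))
    (isZClosed_polys (fun _ : Unit => ∑ i ∈ Finset.range m, p ^ i * q ^ (m - 1 - i))) (by
      intro g hg
      have := hT0 hg ()
      rw [← geom_sum₂_mul, map_mul, mul_eq_zero] at this
      rcases this with h | h
      · exact Or.inr fun _ => h
      · exact Or.inl fun _ => h)
    ⟨1, T.one_mem, fun _ => by
      rw [map_sub, hp, hq, mev_lwpoly, mev_lwpoly, Units.val_one, Matrix.one_mulVec, Matrix.one_mulVec, hl, hk,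
        sub_self]⟩
    ⟨t, mem_of_dense hd, fun _ => by
      have h3 := hT0 (mem_of_dense hd) ()
      rw [← geom_sum₂_mul, map_mul, mul_eq_zero] at h3
      refine h3.resolve_right fun h4 => hne ?_
      rw [map_sub, hp, hq, mev_lwpoly, mev_lwpoly, hva, hwb, map_smul, map_smul, hl, hk, sub_eq_zero] at h4
      simpa using h4⟩
  have h3 := h1 ()
  have h4 := h2 ()
  rw [map_sub, sub_eq_zero] at h3
  simp only [map_sum, map_mul, map_pow, h3, ← pow_add] at h4
  rw [Finset.sum_congr rfl (g := fun _ => (mev (τ : Matrix (Fin n) (Fin n) F) q) ^ (m - 1))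
    (fun i hi => by congr 1; have := Finset.mem_range.1 hi; omega)] at h4
  rw [Finset.sum_const, Finset.card_range, nsmul_eq_mul, mul_eq_zero] at h4
  rcases h4 with h4 | h4
  · have : m = 0 := by exact_mod_cast h4
    omega
  · have h5 := eq_zero_of_pow_eq_zero h4
    rw [hq, mev_lwpoly] at h5
    have h6 := torus_scalar hd hw hwb k hk hτ hwb
    rw [h5, zero_smul] at h6
    apply hw
    have : ((τ⁻¹ : GL (Fin n) F) : Matrix (Fin n) (Fin n) F).mulVec
      ((τ : Matrix (Fin n) (Fin n) F).mulVec w) = w := by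
      rw [Matrix.mulVec_mulVec, ← Units.val_mul, inv_mul_cancel, Units.val_one, Matrix.one_mulVec]
    rw [← this, h6, Matrix.mulVec_zero]

/-- the closed subgroup generated by a set -/
def zgen (S : Set (GL (Fin n) F)) : Subgroup (GL (Fin n) F) :=
  sInf {H | IsZClosed (H : Set (GL (Fin n) F)) ∧ S ⊆ H}

theorem subset_zgen (S : Set (GL (Fin n) F)) : S ⊆ zgen S := by
  intro s hs
  exact Subgroup.mem_sInf.2 fun H hH => hH.2 hs

theorem zgen_le {S : Set (GL (Fin n) F)} {H : Subgroup (GL (Fin n) F)} (hH : IsZClosed (H : Set (GL (Fin n) F)))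
    (hS : S ⊆ H) : zgen S ≤ H := sInf_le ⟨hH, hS⟩

theorem IsZClosed.iInter' {ι : Type} (S : ι → Set (GL (Fin n) F)) (h : ∀ i, IsZClosed (S i)) :
    IsZClosed {g | ∀ i, g ∈ S i} := by
  choose I hI using h
  refine ⟨{p | ∃ i, p ∈ I i}, ?_⟩
  ext g
  constructor
  · rintro h p ⟨i, hp⟩
    have := h i
    rw [hI i] at this
    exact this p hp
  · intro h i
    rw [hI i]
    exact fun p hp => h p ⟨i, hp⟩

theorem zgen_closed (S : Set (GL (Fin n) F)) : IsZClosed (zgen S : Set (GL (Fin n) F)) := by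
  have := IsZClosed.iInter' (fun H : {H : Subgroup (GL (Fin n) F) // IsZClosed (H : Set (GL (Fin n) F)) ∧ S ⊆ H} =>
    ((H : Subgroup (GL (Fin n) F)) : Set (GL (Fin n) F))) (fun H => H.2.1)
  convert this using 1
  ext g
  constructor
  · intro h H; exact Subgroup.mem_sInf.1 h H H.2
  · intro h; exact Subgroup.mem_sInf.2 fun H hH => h ⟨H, hH⟩

theorem zgen_connected (S : Set (GL (Fin n) F))
    (hS : ∀ s ∈ S, ∃ Z : Set (GL (Fin n) F), Z ⊆ zgen S ∧ IsZConnected Z ∧ 1 ∈ Z ∧ s ∈ Z) :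
    IsZConnected (zgen S : Set (GL (Fin n) F)) := by
  intro C₁ C₂ h₁ h₂ hcov hn₁ hn₂
  by_contra hdisj
  have hd : ∀ x ∈ zgen S, x ∈ C₁ → x ∈ C₂ → False := fun x hx h h' => hdisj ⟨x, hx, h, h'⟩
  -- key step
  have key : ∀ (D₁ D₂ : Set (GL (Fin n) F)), IsZClosed D₁ → IsZClosed D₂ →
      (∀ x ∈ zgen S, x ∈ D₁ ∨ x ∈ D₂) → (∀ x ∈ zgen S, x ∈ D₁ → x ∈ D₂ → False) →
      ∀ s ∈ S, ∀ x ∈ zgen S, x ∈ D₁ → s * x ∈ D₁ := by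
    intro D₁ D₂ h₁ h₂ hc hd s hs x hx hx1
    obtain ⟨Z, hZ, hZc, h1, hsZ⟩ := hS s hs
    refine (hc (s * x) ((zgen S).mul_mem (hZ hsZ) hx)).resolve_right fun h => ?_
    obtain ⟨_, ⟨z, hz, rfl⟩, hz1, hz2⟩ := (hZc.image 1 x) D₁ D₂ h₁ h₂
      (by rintro _ ⟨z, hz, rfl⟩; exact hc _ (by simpa using (zgen S).mul_mem (hZ hz) hx))
      ⟨x, ⟨1, h1, by group⟩, hx1⟩ ⟨s * x, ⟨s, hsZ, by group⟩, h⟩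
    exact hd _ (by simpa using (zgen S).mul_mem (hZ hz) hx) hz1 hz2
  let K : Subgroup (GL (Fin n) F) :=
    { carrier := {g | g ∈ zgen S ∧ (∀ x ∈ zgen S, x ∈ C₁ → g * x ∈ C₁) ∧ ∀ x ∈ zgen S, x ∈ C₂ → g * x ∈ C₂}
      mul_mem' := by
        rintro a b ⟨ha, ha1, ha2⟩ ⟨hb, hb1, hb2⟩
        refine ⟨(zgen S).mul_mem ha hb, fun x hx h => ?_, fun x hx h => ?_⟩
        · rw [mul_assoc]; exact ha1 _ ((zgen S).mul_mem hb hx) (hb1 x hx h)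
        · rw [mul_assoc]; exact ha2 _ ((zgen S).mul_mem hb hx) (hb2 x hx h)
      one_mem' := ⟨(zgen S).one_mem, fun x _ h => by rwa [one_mul], fun x _ h => by rwa [one_mul]⟩
      inv_mem' := by
        rintro a ⟨ha, ha1, ha2⟩
        have hm : ∀ x ∈ zgen S, a⁻¹ * x ∈ zgen S := fun x hx => (zgen S).mul_mem ((zgen S).inv_mem ha) hx
        refine ⟨(zgen S).inv_mem ha, fun x hx h => ?_, fun x hx h => ?_⟩
        · refine (hcov (hm x hx)).resolve_right fun h' => hd x hx h ?_
          simpa using ha2 _ (hm x hx) h'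
        · refine (hcov (hm x hx)).resolve_left fun h' => hd x hx ?_ h
          simpa using ha1 _ (hm x hx) h' }
  have hK : IsZClosed (K : Set (GL (Fin n) F)) := by
    have e1 := IsZClosed.iInter' (fun x : {x // x ∈ zgen S ∧ x ∈ C₁} => {g | 1 * g * x.1 ∈ C₁})
      (fun x => h₁.preimage 1 x.1)
    have e2 := IsZClosed.iInter' (fun x : {x // x ∈ zgen S ∧ x ∈ C₂} => {g | 1 * g * x.1 ∈ C₂})
      (fun x => h₂.preimage 1 x.1)
    convert (zgen_closed S).inter' (e1.inter' e2) using 1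
    ext g
    constructor
    · rintro ⟨hg, h1, h2⟩
      refine ⟨hg, fun x => ?_, fun x => ?_⟩
      · change 1 * g * x.1 ∈ C₁
        rw [one_mul]; exact h1 _ x.2.1 x.2.2
      · change 1 * g * x.1 ∈ C₂
        rw [one_mul]; exact h2 _ x.2.1 x.2.2
    · rintro ⟨hg, h1, h2⟩
      refine ⟨hg, fun x hx h => ?_, fun x hx h => ?_⟩
      · have : 1 * g * x ∈ C₁ := h1 ⟨x, hx, h⟩
        rwa [one_mul] at this
      · have : 1 * g * x ∈ C₂ := h2 ⟨x, hx, h⟩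
        rwa [one_mul] at this
  have hle : zgen S ≤ K := zgen_le hK (fun s hs => ⟨subset_zgen S hs,
    key C₁ C₂ h₁ h₂ (fun x hx => hcov hx) hd s hs,
    key C₂ C₁ h₂ h₁ (fun x hx => (hcov hx).symm) (fun x hx a b => hd x hx b a) s hs⟩)
  obtain ⟨x, hx, hx1⟩ := hn₁
  obtain ⟨y, hy, hy2⟩ := hn₂
  have h1 := (hle ((zgen S).mul_mem hy ((zgen S).inv_mem hx))).2.1 x hx hx1
  rw [inv_mul_cancel_right] at h1
  exact hd y hy h1 hy2

end AlgGroup8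

section AlgGroup9
open MvPolynomial

variable {F : Type} [Field F] {n : ℕ}

theorem eigen_top_of_semisimple {t : GL (Fin n) F} (hss : IsSemisimpleElem t) :
    ⨆ μ, Module.End.eigenspace (Matrix.toLin' (t : Matrix (Fin n) (Fin n) F)) μ = ⊤ := by
  obtain ⟨P, hP⟩ := hss
  rw [eq_top_iff]
  intro v _
  have hv : v = (P : Matrix (Fin n) (Fin n) F).mulVec
      (((P⁻¹ : GL (Fin n) F) : Matrix (Fin n) (Fin n) F).mulVec v) := by
    rw [Matrix.mulVec_mulVec, ← Units.val_mul, mul_inv_cancel, Units.val_one, Matrix.one_mulVec]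
  rw [hv]
  generalize ((P⁻¹ : GL (Fin n) F) : Matrix (Fin n) (Fin n) F).mulVec v = u
  rw [← Finset.univ_sum_single u, Matrix.mulVec_sum]
  refine Submodule.sum_mem _ fun i _ => ?_
  refine Submodule.mem_iSup_of_mem (((P⁻¹ * t * P : GL (Fin n) F) : Matrix (Fin n) (Fin n) F) i i) ?_
  rw [Module.End.mem_eigenspace_iff, Matrix.toLin'_apply, Matrix.mulVec_mulVec, ← Units.val_mul]
  have : t * P = P * (P⁻¹ * t * P) := by group
  rw [this, Units.val_mul, ← Matrix.mulVec_mulVec, ← Matrix.mulVec_smul]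
  congr 1
  ext j
  rw [Matrix.mulVec_single, Pi.smul_apply, Pi.smul_apply]
  by_cases h : j = i
  · subst h; simp [mul_comm]
  · have h0 := hP h
    simp only [Units.val_mul, Matrix.coe_units_inv] at h0
    simp [h, h0]

theorem simul_diag (S T : Module.End F (Fin n → F)) (hc : ∀ x, T (S x) = S (T x))
    (hS : ⨆ μ, S.eigenspace μ = ⊤) (hT : ⨆ μ, T.eigenspace μ = ⊤) :
    ∃ (b : Module.Basis (Fin n) F (Fin n → F)) (a d : Fin n → F),
      (∀ i, S (b i) = a i • b i) ∧ ∀ i, T (b i) = d i • b i := by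
  have hspan : Submodule.span F {x | (∃ a : F, S x = a • x) ∧ ∃ d : F, T x = d • x} = ⊤ := by
    rw [eq_top_iff, ← hS]
    refine iSup_le fun μ => ?_
    rw [Submodule.eq_iSup_inf_genEigenspace (p := S.eigenspace μ) (f := T) 1 (by
      intro x hx
      rw [Module.End.mem_eigenspace_iff] at hx ⊢
      rw [← hc, hx, map_smul]) hT]
    refine iSup_le fun ν x hx => ?_
    exact Submodule.subset_span ⟨⟨μ, Module.End.mem_eigenspace_iff.1 hx.1⟩, ⟨ν, Module.End.mem_eigenspace_iff.1 hx.2⟩⟩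
  obtain ⟨b, hb, hbs, hli⟩ := exists_linearIndependent F {x | (∃ a : F, S x = a • x) ∧ ∃ d : F, T x = d • x}
  rw [hspan] at hbs
  let b0 : Module.Basis b F (Fin n → F) := Module.Basis.mk hli (by rw [Subtype.range_coe, hbs])
  have hb0 : ∀ i : b, b0 i = i := fun i => by simp [b0]
  let e := b0.indexEquiv (Pi.basisFun F (Fin n))
  choose a ha using fun i : b => (hb i.2).1
  choose d hd using fun i : b => (hb i.2).2
  refine ⟨b0.reindex e, fun i => a (e.symm i), fun i => d (e.symm i), fun i => ?_, fun i => ?_⟩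
  · rw [Module.Basis.reindex_apply, hb0, ha]
  · rw [Module.Basis.reindex_apply, hb0, hd]

theorem basis_matrix (b : Module.Basis (Fin n) F (Fin n → F)) :
    ∃ P : GL (Fin n) F, ∀ j, (P : Matrix (Fin n) (Fin n) F).mulVec (Pi.single j 1) = b j := by
  have h : IsUnit (Matrix.of fun i j => b j i) := by
    rw [← Matrix.linearIndependent_cols_iff_isUnit]
    exact b.linearIndependent
  obtain ⟨P, hP⟩ := h
  refine ⟨P, fun j => ?_⟩
  rw [hP]
  ext i
  simp

/-- invertible diagonal matrix -/
def dgl (d : Fin n → Fˣ) : GL (Fin n) F where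
  val := Matrix.diagonal fun i => (d i : F)
  inv := Matrix.diagonal fun i => ((d i)⁻¹ : Fˣ)
  val_inv := by simp [Matrix.diagonal_mul_diagonal]
  inv_val := by simp [Matrix.diagonal_mul_diagonal]

theorem isDiag_inv {g : GL (Fin n) F} (h : (g : Matrix (Fin n) (Fin n) F).IsDiag) :
    ((g⁻¹ : GL (Fin n) F) : Matrix (Fin n) (Fin n) F).IsDiag := by
  intro i j hij
  have h1 : (g : Matrix (Fin n) (Fin n) F) * ((g⁻¹ : GL (Fin n) F) : Matrix (Fin n) (Fin n) F) = 1 := by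
    rw [← Units.val_mul, mul_inv_cancel, Units.val_one]
  rw [← h.diagonal_diag] at h1
  have h2 := congrFun (congrFun h1 i) j
  have h3 := congrFun (congrFun h1 i) i
  rw [Matrix.diagonal_mul] at h2 h3
  rw [Matrix.one_apply_ne hij] at h2
  rw [Matrix.one_apply_eq] at h3
  exact (mul_eq_zero.1 h2).resolve_left (left_ne_zero_of_mul_eq_one h3)

/-- matrices diagonal in the basis given by `P` -/
def diagGrp (P : GL (Fin n) F) : Subgroup (GL (Fin n) F) where
  carrier := {g | ((P⁻¹ * g * P : GL (Fin n) F) : Matrix (Fin n) (Fin n) F).IsDiag}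
  mul_mem' := by
    intro a b ha hb
    change Matrix.IsDiag _
    have : P⁻¹ * (a * b) * P = (P⁻¹ * a * P) * (P⁻¹ * b * P) := by group
    rw [this, Units.val_mul, ← Matrix.IsDiag.diagonal_diag ha, ← Matrix.IsDiag.diagonal_diag hb,
      Matrix.diagonal_mul_diagonal]
    exact Matrix.isDiag_diagonal _
  one_mem' := by
    change Matrix.IsDiag _
    rw [mul_one, inv_mul_cancel, Units.val_one]; exact Matrix.isDiag_one
  inv_mem' := by
    intro a ha
    change Matrix.IsDiag _
    have : P⁻¹ * a⁻¹ * P = (P⁻¹ * a * P)⁻¹ := by group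
    rw [this]
    exact isDiag_inv ha

theorem mem_diagGrp {P g : GL (Fin n) F} :
    g ∈ diagGrp P ↔ ((P⁻¹ * g * P : GL (Fin n) F) : Matrix (Fin n) (Fin n) F).IsDiag := Iff.rfl

theorem diagGrp_closed (P : GL (Fin n) F) : IsZClosed (diagGrp P : Set (GL (Fin n) F)) := by
  have : IsZClosed {g : GL (Fin n) F | (g : Matrix (Fin n) (Fin n) F).IsDiag} := by
    have := isZClosed_affine (fun q : {q : Fin n × Fin n // q.1 ≠ q.2} =>
      Matrix.entryLinearMap F F q.1.1 q.1.2) (fun _ => 0)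
    convert this using 1
    ext g
    constructor
    · intro h q; exact h q.2
    · intro h i j hij; exact h ⟨(i, j), hij⟩
  exact this.preimage P⁻¹ P

theorem diagGrp_comm {P a b : GL (Fin n) F} (ha : a ∈ diagGrp P) (hb : b ∈ diagGrp P) : a * b = b * a := by
  have h : (P⁻¹ * a * P) * (P⁻¹ * b * P) = (P⁻¹ * b * P) * (P⁻¹ * a * P) := by
    apply Units.ext
    rw [Units.val_mul _ (P⁻¹ * b * P), Units.val_mul _ (P⁻¹ * a * P), ← Matrix.IsDiag.diagonal_diag ha,
      ← Matrix.IsDiag.diagonal_diag hb, Matrix.diagonal_mul_diagonal, Matrix.diagonal_mul_diagonal]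
    congr 1; ext i; exact mul_comm _ _
  calc a * b = P * ((P⁻¹ * a * P) * (P⁻¹ * b * P)) * P⁻¹ := by group
    _ = b * a := by rw [h]; group

theorem adjoin_scalar {f g : Module.End F (Fin n → F)} (hg : g ∈ Algebra.adjoin F {f}) {v : Fin n → F} {a : F}
    (hv : f v = a • v) : ∃ c : F, g v = c • v := by
  induction hg using Algebra.adjoin_induction with
  | mem x hx => rw [Set.mem_singleton_iff.1 hx]; exact ⟨a, hv⟩
  | algebraMap r => exact ⟨r, rfl⟩
  | add x y _ _ hx hy =>
    obtain ⟨c, hc⟩ := hx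
    obtain ⟨d, hd⟩ := hy
    exact ⟨c + d, by rw [LinearMap.add_apply, hc, hd, add_smul]⟩
  | mul x y _ _ hx hy =>
    obtain ⟨c, hc⟩ := hx
    obtain ⟨d, hd⟩ := hy
    exact ⟨d * c, by rw [Module.End.mul_apply, hd, map_smul, hc, smul_smul]⟩

theorem nilp_eigen_zero {N : Module.End F (Fin n → F)} (hN : IsNilpotent N) {v : Fin n → F} {c : F}
    (hv : N v = c • v) : N v = 0 := by
  obtain ⟨k, hk⟩ := hN
  have : ∀ k : ℕ, (N ^ k) v = c ^ k • v := by
    intro k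
    induction k with
    | zero => simp
    | succ k ih => rw [pow_succ, Module.End.mul_apply, hv, map_smul, ih, smul_smul, pow_succ, mul_comm]
  have h := this k
  rw [hk, LinearMap.zero_apply] at h
  rcases smul_eq_zero.1 h.symm with h | h
  · rw [hv, eq_zero_of_pow_eq_zero h, zero_smul]
  · rw [h, map_zero]

theorem diag_eigen {P : GL (Fin n) F} {b : Module.Basis (Fin n) F (Fin n → F)}
    (hP : ∀ j, (P : Matrix (Fin n) (Fin n) F).mulVec (Pi.single j 1) = b j) (d : Fin n → Fˣ) (i : Fin n) :
    ((P * dgl d * P⁻¹ : GL (Fin n) F) : Matrix (Fin n) (Fin n) F).mulVec (b i) = (d i : F) • b i := by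
  rw [← hP, Matrix.mulVec_mulVec, ← Units.val_mul, inv_mul_cancel_right, Units.val_mul, ← Matrix.mulVec_mulVec,
    ← Matrix.mulVec_smul]
  congr 1
  ext j
  simp [dgl, Matrix.diagonal_mulVec_single, Pi.single_apply]

theorem eigen_support {S : Module.End F (Fin n → F)} {b : Module.Basis (Fin n) F (Fin n → F)} {α : Fin n → F}
    (hb : ∀ i, S (b i) = α i • b i) {v : Fin n → F} {a : F} (hv : S v = a • v) (i : Fin n) (hi : b.repr v i ≠ 0) :
    α i = a := by
  have h1 : S v = ∑ j, (b.repr v j * α j) • b j := by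
    conv_lhs => rw [← b.sum_repr v]
    rw [map_sum]
    exact Finset.sum_congr rfl fun j _ => by rw [map_smul, hb, smul_smul]
  have h2 := congrArg (fun x => b.repr x i) (h1.symm.trans hv)
  simp only [b.repr_sum_self, map_smul, Finsupp.smul_apply, smul_eq_mul] at h2
  exact mul_left_cancel₀ hi (h2.trans (mul_comm _ _))

theorem single_eigen [IsAlgClosed F] [CharZero F] {G T : Subgroup (GL (Fin n) F)}
    (hG : IsZClosed (G : Set (GL (Fin n) F))) (hT : IsMaximalTorus G T) {t : GL (Fin n) F}
    (hss : IsSemisimpleElem t)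
    (hd : IsZClosure (Set.range fun k : ℤ => t ^ k) (T : Set (GL (Fin n) F)))
    {X : Matrix (Fin n) (Fin n) F} (hX : X ∈ zlie (G : Set (GL (Fin n) F)))
    (hXt : (t : Matrix (Fin n) (Fin n) F) * X = X * t)
    {lam a a' : F} {v v' : Fin n → F} (hv : v ≠ 0) (hv' : v' ≠ 0)
    (htv : (t : Matrix (Fin n) (Fin n) F).mulVec v = lam • v)
    (htv' : (t : Matrix (Fin n) (Fin n) F).mulVec v' = lam • v')
    (hXv : X.mulVec v = a • v) (hXv' : X.mulVec v' = a' • v') : a = a' := by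
  obtain ⟨N, hN, S, hS, hNn, hSs, hXNS⟩ :=
    Module.End.exists_isNilpotent_isSemisimple (K := F) (f := Matrix.toLin' X)
  -- commutation
  have hcomm : ∀ f ∈ Algebra.adjoin F {Matrix.toLin' X}, Commute (Matrix.toLin' (t : Matrix (Fin n) (Fin n) F)) f := by
    intro f hf
    refine Algebra.commute_of_mem_adjoin_singleton_of_commute hf ?_
    rw [Commute, SemiconjBy, Module.End.mul_eq_comp, Module.End.mul_eq_comp, ← Matrix.toLin'_mul, ← Matrix.toLin'_mul, hXt]
  have hNS : Commute N S := Algebra.commute_of_mem_adjoin_singleton_of_commute hS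
    (Algebra.commute_of_mem_adjoin_self hN).symm
  have hSv : ∀ (v : Fin n → F) (a : F), X.mulVec v = a • v → S v = a • v := by
    intro v a h
    obtain ⟨c, hc⟩ := adjoin_scalar hN (v := v) (a := a) h
    have h0 := nilp_eigen_zero hNn hc
    have h1 := LinearMap.congr_fun hXNS v
    rw [LinearMap.add_apply, h0, zero_add, Matrix.toLin'_apply, h] at h1
    exact h1.symm
  obtain ⟨b, α, δ, hbα, hbδ⟩ := simul_diag S (Matrix.toLin' (t : Matrix (Fin n) (Fin n) F))
    (fun x => LinearMap.congr_fun (hcomm S hS).eq x) hSs.iSup_eigenspace_eq_top (eigen_top_of_semisimple hss)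
  obtain ⟨P, hP⟩ := basis_matrix b
  -- exponents
  let Λ : AddSubgroup F := AddSubgroup.closure (Set.range α)
  have hαΛ : ∀ i, α i ∈ Λ := fun i => AddSubgroup.subset_closure ⟨i, rfl⟩
  have hmemΛ : ∀ (v : Fin n → F) (a : F), v ≠ 0 → X.mulVec v = a • v → ∃ i, b.repr v i ≠ 0 ∧ α i = a := by
    intro v a hv h
    have : b.repr v ≠ 0 := fun h => hv ((LinearEquiv.map_eq_zero_iff b.repr).1 h)
    obtain ⟨i, hi⟩ := Finsupp.ne_iff.1 this
    exact ⟨i, hi, eigen_support hbα (hSv v a h) i hi⟩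
  obtain ⟨i, hi, hia⟩ := hmemΛ v a hv hXv
  obtain ⟨i', hi', hia'⟩ := hmemΛ v' a' hv' hXv'
  by_contra hne
  have hne' : (⟨α i, hαΛ i⟩ : Λ) - ⟨α i', hαΛ i'⟩ ≠ 0 := by
    intro h
    rw [sub_eq_zero] at h
    have := congrArg Subtype.val h
    exact hne (by rw [← hia, ← hia']; exact this)
  obtain ⟨θ, hθ⟩ : ∃ θ : Module.Dual ℤ Λ, θ ((⟨α i, hαΛ i⟩ : Λ) - ⟨α i', hαΛ i'⟩) ≠ 0 := by
    by_contra hcon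
    push Not at hcon
    exact hne' ((Module.forall_dual_apply_eq_zero_iff ℤ _).1 hcon)
  let μ : Fˣ → GL (Fin n) F := fun s => P * dgl (fun j => s ^ (θ ⟨α j, hαΛ j⟩)) * P⁻¹
  have hμb : ∀ s j, (μ s : Matrix (Fin n) (Fin n) F).mulVec (b j) = ((s ^ (θ ⟨α j, hαΛ j⟩) : Fˣ) : F) • b j :=
    fun s j => diag_eigen hP _ j
  have hμG : ∀ s, μ s ∈ G := by
    intro s
    refine torus_mem G (X := X) (S := LinearMap.toMatrix' S) (N := LinearMap.toMatrix' N) b b.span_eq α Λ hαΛ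
      (fun x => ((s ^ (θ x) : Fˣ) : F)) (by simp) ?_ ?_ ?_ ?_ ?_ hX hG (μ s) (hμb s)
    · intro x y
      rw [map_add, zpow_add, Units.val_mul]
    · rw [← map_add, add_comm, ← hXNS, LinearMap.toMatrix'_toLin']
    · rw [← LinearMap.toMatrix'_mul, ← LinearMap.toMatrix'_mul, hNS.eq]
    · rw [← Matrix.isNilpotent_toLin'_iff, Matrix.toLin'_toMatrix']; exact hNn
    · intro j
      rw [← Matrix.toLin'_apply, Matrix.toLin'_toMatrix']; exact hbα j
  have hμ1 : μ 1 = 1 := by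
    have : dgl (fun j => (1 : Fˣ) ^ (θ ⟨α j, hαΛ j⟩)) = 1 := by
      apply Units.ext
      simp [dgl]
    simp only [μ, this]
    group
  have hμD : ∀ s, μ s ∈ diagGrp P := by
    intro s
    rw [mem_diagGrp]
    have : P⁻¹ * μ s * P = dgl (fun j => s ^ (θ ⟨α j, hαΛ j⟩)) := by simp only [μ]; group
    rw [this]
    exact Matrix.isDiag_diagonal _
  have htD : t ∈ diagGrp P := by
    rw [mem_diagGrp]
    intro k j hkj
    have h1 : (((P⁻¹ * t * P : GL (Fin n) F) : Matrix (Fin n) (Fin n) F).mulVec (Pi.single j 1)) k = 0 := by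
      rw [Units.val_mul, Units.val_mul, ← Matrix.mulVec_mulVec, hP, ← Matrix.mulVec_mulVec, ← Matrix.toLin'_apply (t : Matrix (Fin n) (Fin n) F),
        hbδ, ← hP, ← Matrix.mulVec_smul, Matrix.mulVec_mulVec, ← Units.val_mul, inv_mul_cancel, Units.val_one,
        Matrix.one_mulVec]
      simp [Pi.single_apply, hkj]
    simpa using h1
  have hTD : (T : Set (GL (Fin n) F)) ⊆ diagGrp P := by
    apply hd.2.2 _ (diagGrp_closed P)
    rintro _ ⟨k, rfl⟩
    exact (diagGrp P).zpow_mem htD k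
  let Sg : Set (GL (Fin n) F) := (T : Set (GL (Fin n) F)) ∪ Set.range μ
  have hle : zgen Sg ≤ diagGrp P := zgen_le (diagGrp_closed P) (by
    rintro x (hx | ⟨s, rfl⟩)
    · exact hTD hx
    · exact hμD s)
  have hleG : zgen Sg ≤ G := zgen_le hG (by
    rintro x (hx | ⟨s, rfl⟩)
    · exact hT.1 hx
    · exact hμG s)
  have htor : IsTorus (zgen Sg) := by
    refine ⟨zgen_closed _, zgen_connected _ ?_, fun x hx => ⟨P, hle hx⟩, fun x hx y hy => diagGrp_comm (hle hx) (hle hy)⟩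
    rintro x (hx | hx)
    · exact ⟨T, fun y hy => subset_zgen _ (Or.inl hy), hT.2.1.2.1, T.one_mem, hx⟩
    · refine ⟨Set.range μ, fun y hy => subset_zgen _ (Or.inr hy), ?_, ⟨1, hμ1⟩, hx⟩
      apply zconnected_of_curves
      intro x hx y hy
      refine ⟨μ, ?_, fun s => ⟨s, rfl⟩, hx, hy⟩
      have h0 : ∀ k j, LaurentFn (fun s : Fˣ => (dgl (fun j => s ^ (θ ⟨α j, hαΛ j⟩)) : Matrix (Fin n) (Fin n) F) k j) := by
        intro k j
        by_cases hkj : k = j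
        · subst hkj
          simpa [dgl] using LaurentFn.zpow (F := F) (θ ⟨α k, hαΛ k⟩)
        · simpa [dgl, hkj] using LaurentFn.const (0 : F)
      intro k j
      exact LaurentFn.mul_right (c := fun s : Fˣ => (P : Matrix (Fin n) (Fin n) F) * (dgl (fun j => s ^ (θ ⟨α j, hαΛ j⟩)) : Matrix (Fin n) (Fin n) F))
        (LaurentFn.mul_left h0 _) _ k j
  have heq : zgen Sg = T := hT.2.2 _ hleG htor (fun x hx => subset_zgen _ (Or.inl hx))
  let two : Fˣ := Units.mk0 2 two_ne_zero
  have hμT : μ two ∈ T := by rw [← heq]; exact subset_zgen _ (Or.inr ⟨two, rfl⟩)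
  -- both basis vectors lie in the same eigenspace of t
  have hδ : δ i = lam := eigen_support hbδ (by rw [Matrix.toLin'_apply]; exact htv) i hi
  have hδ' : δ i' = lam := eigen_support hbδ (by rw [Matrix.toLin'_apply]; exact htv') i' hi'
  have e1 : (t : Matrix (Fin n) (Fin n) F).mulVec (b i) = lam • b i := by
    rw [← hδ, ← hbδ, Matrix.toLin'_apply]
  have e2 : (t : Matrix (Fin n) (Fin n) F).mulVec (b i') = lam • b i' := by
    rw [← hδ', ← hbδ, Matrix.toLin'_apply]
  obtain ⟨l, hl⟩ := exists_dual_one (b.ne_zero i)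
  have e3 := torus_scalar hd (b.ne_zero i) e1 l hl hμT e2
  rw [hμb, hμb, map_smul, hl, smul_eq_mul, mul_one] at e3
  have e4 := smul_left_injective F (b.ne_zero i') e3
  have e5 : (two ^ (θ ⟨α i', hαΛ i'⟩) : Fˣ) = two ^ (θ ⟨α i, hαΛ i⟩) := Units.ext e4
  have e6 : θ ⟨α i', hαΛ i'⟩ = θ ⟨α i, hαΛ i⟩ := by
    have h7 : ((2 : ℚ) ^ (θ ⟨α i', hαΛ i'⟩) : ℚ) = 2 ^ (θ ⟨α i, hαΛ i⟩) := by
      have h8 : (((2 : ℚ) ^ (θ ⟨α i', hαΛ i'⟩) : ℚ) : F) = (((2 : ℚ) ^ (θ ⟨α i, hαΛ i⟩) : ℚ) : F) := by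
        have := e4
        push_cast at this ⊢
        simpa [two] using this
      exact_mod_cast h8
    exact zpow_right_injective₀ (by norm_num) (by norm_num) h7
  apply hθ
  rw [map_sub, e6, sub_self]

end AlgGroup9

section AlgGroup10
open MvPolynomial

variable {F : Type} [Field F] {n : ℕ}

theorem der_rtr (h X Y : Matrix (Fin n) (Fin n) F) (hXY : X * h = h * Y) (p : MvPolynomial (Fin n × Fin n) F) :
    der X (rtr h p) = rtr h (der Y p) := by
  induction p using MvPolynomial.induction_on with
  | C a => rw [der_C, map_zero, rtr, aeval_C, MvPolynomial.algebraMap_eq, der_C]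
  | add p q hp hq => simp only [map_add, hp, hq]
  | mul_X p q hp =>
    have hX : der X (rtr h (MvPolynomial.X q)) = rtr h (der Y (MvPolynomial.X q)) := by
      have key : ∀ k, ∑ l, X k l * h l q.2 = ∑ l, h k l * Y l q.2 := by
        intro k
        have := congrFun (congrFun hXY k) q.2
        rwa [Matrix.mul_apply, Matrix.mul_apply] at this
      rw [der_X, map_sum]
      simp only [rtr, map_mul, aeval_X, aeval_C, MvPolynomial.algebraMap_eq, map_sum, der_CX, der_X,
        Finset.mul_sum, Finset.sum_mul]
      rw [Finset.sum_comm]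
      conv_rhs => rw [Finset.sum_comm]
      refine Finset.sum_congr rfl (fun k _ => ?_)
      have := congrArg (fun z => C z * MvPolynomial.X (q.1, k)) (key k)
      simp only [map_sum, map_mul, Finset.sum_mul] at this
      convert this using 1
      · exact Finset.sum_congr rfl fun l _ => by ring
      · exact Finset.sum_congr rfl fun l _ => by ring
    rw [Derivation.leibniz, map_mul (rtr h) p (MvPolynomial.X q), Derivation.leibniz, map_add, smul_eq_mul,
      smul_eq_mul, smul_eq_mul, smul_eq_mul, map_mul, map_mul, hp, hX]

theorem zlie_Ad (G : Subgroup (GL (Fin n) F)) {t : GL (Fin n) F} (ht : t ∈ G) {X : Matrix (Fin n) (Fin n) F}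
    (hX : X ∈ zlie (G : Set (GL (Fin n) F))) :
    (t : Matrix (Fin n) (Fin n) F) * X * ((t⁻¹ : GL (Fin n) F) : Matrix (Fin n) (Fin n) F)
      ∈ zlie (G : Set (GL (Fin n) F)) := by
  intro p hp
  have h1 := der_mem_zideal G hX (rtr_mem_zideal G (G.inv_mem ht) hp)
  rw [der_rtr _ X ((t : Matrix (Fin n) (Fin n) F) * X * ((t⁻¹ : GL (Fin n) F) : Matrix (Fin n) (Fin n) F)) (by
    rw [mul_assoc, ← mul_assoc, ← Units.val_mul, inv_mul_cancel, Units.val_one, one_mul])] at h1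
  have := h1 t ht
  rw [mev_rtr, ← Units.val_mul, mul_inv_cancel, Units.val_one] at this
  exact this

/-- homogeneous elements for conjugation by `t` span -/
theorem zlie_homog (G : Subgroup (GL (Fin n) F)) {t : GL (Fin n) F} (ht : t ∈ G) (hss : IsSemisimpleElem t)
    {P : Matrix (Fin n) (Fin n) F → Prop} (h0 : P 0) (hadd : ∀ X Y, P X → P Y → P (X + Y))
    (hom : ∀ X ∈ zlie (G : Set (GL (Fin n) F)), ∀ α : F,
      (t : Matrix (Fin n) (Fin n) F) * X = α • (X * t) → P X) :
    ∀ X ∈ zlie (G : Set (GL (Fin n) F)), P X := by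
  let Ad : Module.End F (Matrix (Fin n) (Fin n) F) :=
    { toFun := fun X => (t : Matrix (Fin n) (Fin n) F) * X * ((t⁻¹ : GL (Fin n) F) : Matrix (Fin n) (Fin n) F)
      map_add' := fun X Y => by rw [mul_add, add_mul]
      map_smul' := fun c X => by simp }
  have hAd : ∀ X, Ad X = (t : Matrix (Fin n) (Fin n) F) * X * ((t⁻¹ : GL (Fin n) F) : Matrix (Fin n) (Fin n) F) :=
    fun _ => rfl
  have htt : ((t⁻¹ : GL (Fin n) F) : Matrix (Fin n) (Fin n) F) * t = 1 := by
    rw [← Units.val_mul, inv_mul_cancel, Units.val_one]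
  have htop : ⨆ μ, Ad.eigenspace μ = ⊤ := by
    obtain ⟨Q, hQ⟩ := hss
    rw [eq_top_iff]
    intro M _
    have hM : M = (Q : Matrix (Fin n) (Fin n) F) *
        (((Q⁻¹ : GL (Fin n) F) : Matrix (Fin n) (Fin n) F) * M * Q) * ((Q⁻¹ : GL (Fin n) F) : Matrix (Fin n) (Fin n) F) := by
      have h1 : (Q : Matrix (Fin n) (Fin n) F) * ((Q⁻¹ : GL (Fin n) F) : Matrix (Fin n) (Fin n) F) = 1 := by
        rw [← Units.val_mul, mul_inv_cancel, Units.val_one]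
      simp only [mul_assoc, h1]
      rw [← mul_assoc, h1]; simp
    rw [hM]
    generalize ((Q⁻¹ : GL (Fin n) F) : Matrix (Fin n) (Fin n) F) * M * Q = N
    rw [Matrix.matrix_eq_sum_single N]
    simp only [Finset.mul_sum, Finset.sum_mul]
    refine Submodule.sum_mem _ fun i _ => Submodule.sum_mem _ fun j _ => ?_
    set d := Q⁻¹ * t * Q with hd
    have htQ : t = Q * d * Q⁻¹ := by rw [hd]; group
    have hdi : ((d⁻¹ : GL (Fin n) F) : Matrix (Fin n) (Fin n) F).IsDiag := isDiag_inv hQ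
    refine Submodule.mem_iSup_of_mem ((d : Matrix (Fin n) (Fin n) F) i i *
      ((d⁻¹ : GL (Fin n) F) : Matrix (Fin n) (Fin n) F) j j) ?_
    rw [Module.End.mem_eigenspace_iff, hAd]
    have e1 : (t : Matrix (Fin n) (Fin n) F) * Q = Q * d := by
      rw [← Units.val_mul, ← Units.val_mul, htQ]; congr 1; group
    have e2 : ((Q⁻¹ : GL (Fin n) F) : Matrix (Fin n) (Fin n) F) * ((t⁻¹ : GL (Fin n) F) : Matrix (Fin n) (Fin n) F)
        = ((d⁻¹ : GL (Fin n) F) : Matrix (Fin n) (Fin n) F) * ((Q⁻¹ : GL (Fin n) F) : Matrix (Fin n) (Fin n) F) := by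
      rw [← Units.val_mul, ← Units.val_mul, htQ]; congr 1; group
    have e3 : (d : Matrix (Fin n) (Fin n) F) * Matrix.single i j (N i j) *
        ((d⁻¹ : GL (Fin n) F) : Matrix (Fin n) (Fin n) F) = ((d : Matrix (Fin n) (Fin n) F) i i *
      ((d⁻¹ : GL (Fin n) F) : Matrix (Fin n) (Fin n) F) j j) • Matrix.single i j (N i j) := by
      rw [← hQ.diagonal_diag, ← hdi.diagonal_diag]
      ext k l
      simp only [Matrix.diagonal_mul, Matrix.mul_diagonal, Matrix.smul_apply, Matrix.single_apply, Matrix.diag_apply, Matrix.diagonal_apply_eq,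
        smul_eq_mul]
      split_ifs with h
      · obtain ⟨rfl, rfl⟩ := h; ring
      · simp
    calc _ = ((t : Matrix (Fin n) (Fin n) F) * Q) * Matrix.single i j (N i j) * (((Q⁻¹ : GL (Fin n) F) : Matrix (Fin n) (Fin n) F) * ((t⁻¹ : GL (Fin n) F) : Matrix (Fin n) (Fin n) F)) := by
            simp only [mul_assoc]
      _ = (Q : Matrix (Fin n) (Fin n) F) * ((d : Matrix (Fin n) (Fin n) F) * Matrix.single i j (N i j) *
        ((d⁻¹ : GL (Fin n) F) : Matrix (Fin n) (Fin n) F)) * ((Q⁻¹ : GL (Fin n) F) : Matrix (Fin n) (Fin n) F) := by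
            rw [e1, e2]; simp only [mul_assoc]
      _ = _ := by rw [e3, Matrix.mul_smul, Matrix.smul_mul]
  intro X hX
  rw [Submodule.eq_iSup_inf_genEigenspace (p := zlie (G : Set (GL (Fin n) F))) (f := Ad) 1
    (fun x hx => zlie_Ad G ht hx) htop] at hX
  refine Submodule.iSup_induction _ (motive := P) hX (fun α Y hY => ?_) h0 hadd
  refine hom Y hY.1 α ?_
  have h1 := Module.End.mem_eigenspace_iff.1 hY.2
  rw [hAd] at h1
  have h2 := congrArg (· * (t : Matrix (Fin n) (Fin n) F)) h1
  simp only [Matrix.smul_mul] at h2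
  rw [← h2, mul_assoc, htt, mul_one]

end AlgGroup10

section AlgGroup11
attribute [local instance] LieRing.ofAssociativeRing

theorem exists_height {A : Type} [AddCommGroup A] (S : Finset A)
    (hS : ∀ a ∈ S, ∀ b ∈ S, ∀ m : ℕ, 1 ≤ m → m • a = m • b → a = b) :
    ∃ h : A →+ ℚ, ∀ a ∈ S, ∀ b ∈ S, h a = h b → a = b := by
  let φ := TensorProduct.mk ℤ ℚ A 1
  have hφ : ∀ a ∈ S, ∀ b ∈ S, a ≠ b → φ (a - b) ≠ 0 := by
    intro a ha b hb hab h0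
    obtain ⟨s, hs⟩ := (IsLocalizedModule.eq_zero_iff (nonZeroDivisors ℤ) φ).1 h0
    have hs0 : (s : ℤ) ≠ 0 := nonZeroDivisors.ne_zero s.2
    have hs1 : (s : ℤ) • (a - b) = 0 := hs
    apply hab
    refine hS a ha b hb (s : ℤ).natAbs (Int.natAbs_pos.2 hs0) ?_
    rw [← sub_eq_zero, ← smul_sub]
    rcases Int.natAbs_eq (s : ℤ) with h | h
    · rw [h, natCast_zsmul] at hs1; exact hs1
    · rw [h, neg_smul, natCast_zsmul, neg_eq_zero] at hs1; exact hs1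
  let I := {x : S × S // x.1 ≠ x.2}
  let f : I → Module.Dual ℚ (Module.Dual ℚ (TensorProduct ℤ ℚ A)) :=
    fun i => Module.Dual.eval ℚ _ (φ ((i.1.1 : A) - i.1.2))
  obtain ⟨x, -, hx⟩ := Module.Dual.exists_forall_mem_ne_zero_of_forall_exists ⊤ f (by
    intro i
    have h1 := hφ _ i.1.1.2 _ i.1.2.2 (fun h => i.2 (Subtype.ext h))
    by_contra hcon
    push Not at hcon
    exact h1 ((Module.forall_dual_apply_eq_zero_iff ℚ _).1 fun l => hcon l trivial))
  refine ⟨x.toAddMonoidHom.comp φ.toAddMonoidHom, fun a ha b hb hab => ?_⟩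
  by_contra hne
  refine hx ⟨(⟨a, ha⟩, ⟨b, hb⟩), fun h => hne (congrArg Subtype.val h)⟩ ?_
  change x (φ (a - b)) = 0
  rw [map_sub, map_sub, sub_eq_zero]
  exact hab

theorem nilp_of_single {K U : Type} [Field K] [IsAlgClosed K] [CharZero K] [AddCommGroup U] [Module K U]
    [FiniteDimensional K U] (f : Module.End K U)
    (h1 : ∀ (a b : K) (u u' : U), u ≠ 0 → u' ≠ 0 → f u = a • u → f u' = b • u' → a = b)
    (htr : LinearMap.trace K U f = 0) : IsNilpotent f := by
  rcases subsingleton_or_nontrivial U with hU | hU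
  · exact ⟨1, Subsingleton.elim _ _⟩
  obtain ⟨c, hc⟩ := Module.End.exists_eigenvalue f
  obtain ⟨u, hu⟩ := hc.exists_hasEigenvector
  have htop := Module.End.iSup_maxGenEigenspace_eq_top f
  have hle : ⨆ μ, f.maxGenEigenspace μ ≤ f.maxGenEigenspace c := by
    refine iSup_le fun μ => ?_
    by_cases hμ : μ = c
    · rw [hμ]
    · have : f.maxGenEigenspace μ = ⊥ := by
        by_contra hb
        have hb' : f.HasUnifEigenvalue μ ⊤ := hb
        have h2 : f.HasEigenvalue μ := hb'.lt zero_lt_one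
        obtain ⟨u', hu'⟩ := h2.exists_hasEigenvector
        exact hμ (h1 _ _ _ _ hu'.2 hu.2 hu'.apply_eq_smul hu.apply_eq_smul)
      rw [this]; exact bot_le
  rw [htop] at hle
  have hn : IsNilpotent (f - algebraMap K (Module.End K U) c) := by
    rw [Module.End.isNilpotent_iff_of_finite]
    intro m
    have := hle (Submodule.mem_top (x := m))
    rw [Module.End.mem_maxGenEigenspace] at this
    simpa [Algebra.algebraMap_eq_smul_one] using this
  have ht := (LinearMap.isNilpotent_trace_of_isNilpotent hn).eq_zero
  rw [map_sub, htr, Algebra.algebraMap_eq_smul_one, map_smul, LinearMap.trace_one, smul_eq_mul, zero_sub, neg_eq_zero,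
    mul_eq_zero] at ht
  have hc0 : c = 0 := ht.resolve_right (by exact_mod_cast Module.finrank_pos.ne')
  rw [hc0, map_zero, sub_zero] at hn
  exact hn

theorem common_eigen {K L U : Type} [Field K] [IsAlgClosed K] [CharZero K] [LieRing L] [LieAlgebra K L]
    [FiniteDimensional K L]
    [AddCommGroup U] [Module K U] [FiniteDimensional K U] [Nontrivial U] [LieRingModule L U] [LieModule K L U]
    (h1 : ∀ (x : L) (a b : K) (u u' : U), u ≠ 0 → u' ≠ 0 → ⁅x, u⁆ = a • u → ⁅x, u'⁆ = b • u' → a = b) :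
    ∃ u : U, u ≠ 0 ∧ ∀ x : L, ∃ a : K, ⁅x, u⁆ = a • u := by
  let χ : L →ₗ[K] K := (LinearMap.trace K U) ∘ₗ (LieModule.toEnd K L U : L →ₗ[K] Module.End K U)
  have hχ : ∀ x, χ x = LinearMap.trace K U (LieModule.toEnd K L U x) := fun _ => rfl
  have hbr : ∀ x y : L, χ ⁅x, y⁆ = 0 := by
    intro x y
    rw [hχ, LieHom.map_lie, LinearMap.trace_lie]
  let k : LieIdeal K L := { LinearMap.ker χ with lie_mem := fun {x m} _ => hbr x m }
  have hk : ∀ x, x ∈ k ↔ χ x = 0 := fun _ => Iff.rfl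
  have : LieModule.IsNilpotent k U := by
    rw [LieModule.isNilpotent_iff_forall' (R := K)]
    intro x
    exact nilp_of_single (LieModule.toEnd K L U x) (h1 x) x.2
  have hnt := LieModule.nontrivial_max_triv_of_isNilpotent K k U
  let U0 := LieModule.maxTrivSubmodule K k U
  have hU0 : ∀ u, u ∈ U0 ↔ ∀ x ∈ k, ⁅x, u⁆ = 0 := by
    intro u
    rw [LieModule.mem_maxTrivSubmodule]
    exact ⟨fun h x hx => h ⟨x, hx⟩, fun h x => h x x.2⟩
  by_cases hall : ∀ x, χ x = 0
  · obtain ⟨⟨u, hu⟩, hu0⟩ := exists_ne (0 : U0)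
    refine ⟨u, fun h => hu0 (Subtype.ext h), fun x => ⟨0, ?_⟩⟩
    rw [zero_smul]
    exact (hU0 u).1 hu x (hall x)
  · push Not at hall
    obtain ⟨x0, hx0⟩ := hall
    have hst : ∀ u ∈ (U0 : Submodule K U), LieModule.toEnd K L U x0 u ∈ (U0 : Submodule K U) := by
      intro u hu
      change ⁅x0, u⁆ ∈ U0
      rw [hU0]
      intro y hy
      rw [leibniz_lie, (hU0 u).1 hu y hy, lie_zero, add_zero]
      exact (hU0 u).1 hu _ (hbr _ _)
    obtain ⟨c, hc⟩ := Module.End.exists_eigenvalue ((LieModule.toEnd K L U x0).restrict hst)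
    obtain ⟨⟨u, hu⟩, hu1⟩ := hc.exists_hasEigenvector
    have h2 : ⁅x0, u⁆ = c • u := congrArg Subtype.val hu1.apply_eq_smul
    refine ⟨u, fun h => hu1.2 (Subtype.ext h), fun x => ⟨(χ x / χ x0) * c, ?_⟩⟩
    have h3 : ⁅x - (χ x / χ x0) • x0, u⁆ = 0 := by
      refine (hU0 u).1 hu _ ?_
      rw [hk, map_sub, map_smul, smul_eq_mul, div_mul_cancel₀ _ hx0, sub_self]
    rw [sub_lie, smul_lie, h2, smul_smul, sub_eq_zero] at h3
    exact h3

end AlgGroup11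

section AlgGroup12
attribute [local instance] LieRing.ofAssociativeRing

variable {F : Type} [Field F] {n : ℕ}

/-- stability of a subspace under a group of matrices -/
def GStab (G : Subgroup (GL (Fin n) F)) (W : Submodule F (Fin n → F)) : Prop :=
  ∀ g ∈ G, ∀ w ∈ W, g.1.mulVec w ∈ W

/-- irreducible extraction -/
theorem exists_irred [IsAlgClosed F] [CharZero F] {G G12 : Subgroup (GL (Fin n) F)} (hred : IsReductive G12)
    (hG : IsIdentityComponent G G12) {t : GL (Fin n) F} (ht : t ∈ G) {lam : F}
    (E : Submodule F (Fin n → F)) (hE : GStab G E) {v : Fin n → F} (hvE : v ∈ E) (hv : v ≠ 0)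
    (htv : t.1.mulVec v = lam • v) :
    ∃ W : Submodule F (Fin n → F), W ≤ E ∧ GStab G W ∧
      (∀ U : Submodule F (Fin n → F), U ≤ W → GStab G U → U = ⊥ ∨ U = W) ∧
      ∃ w ∈ W, w ≠ 0 ∧ t.1.mulVec w = lam • w := by
  let 𝒮 : Set (Submodule F (Fin n → F)) :=
    {W | W ≤ E ∧ GStab G W ∧ ∃ w ∈ W, w ≠ 0 ∧ t.1.mulVec w = lam • w}
  obtain ⟨W, ⟨hWE, hWG, w, hwW, hw0, hwt⟩, hmin⟩ :=
    WellFounded.has_min (wellFounded_lt (α := Submodule F (Fin n → F))) 𝒮 ⟨E, le_rfl, hE, v, hvE, hv, htv⟩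
  refine ⟨W, hWE, hWG, ?_, w, hwW, hw0, hwt⟩
  intro U hUW hU
  by_contra hcon
  push Not at hcon
  obtain ⟨hU0, hU1⟩ := hcon
  obtain ⟨C, hC, hcompl⟩ := exists_group_compl G hred hG U hU
  have htop : w ∈ U ⊔ C := by rw [hcompl.sup_eq_top]; trivial
  obtain ⟨u, hu, c, hc, rfl⟩ := Submodule.mem_sup.1 htop
  have hcW : c ∈ W := by
    have := W.sub_mem hwW (hUW hu)
    rwa [add_sub_cancel_left] at this
  have h1 : t.1.mulVec u - lam • u = -(t.1.mulVec c - lam • c) := by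
    rw [Matrix.mulVec_add, smul_add] at hwt
    rw [neg_sub, sub_eq_sub_iff_add_eq_add, add_comm (lam • c), hwt]
  have h2 : t.1.mulVec u - lam • u ∈ U := U.sub_mem (hU t ht u hu) (U.smul_mem _ hu)
  have h3 : t.1.mulVec u - lam • u ∈ C := by
    rw [h1]; exact C.neg_mem (C.sub_mem (hC t ht c hc) (C.smul_mem _ hc))
  have h4 := Submodule.disjoint_def.1 hcompl.disjoint _ h2 h3
  by_cases hu0 : u = 0
  · refine hmin (C ⊓ W) ⟨inf_le_right.trans hWE, fun g hg x hx => ⟨hC g hg x hx.1, hWG g hg x hx.2⟩,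
      c, ⟨hc, hcW⟩, fun h => hw0 (by rw [hu0, h, add_zero]), ?_⟩ ?_
    · rw [h4, eq_comm, neg_eq_zero, sub_eq_zero] at h1; exact h1
    · refine lt_of_le_of_ne inf_le_right fun h => hU0 ?_
      rw [inf_eq_right] at h
      exact le_bot_iff.1 (hcompl.disjoint le_rfl (hUW.trans h))
  · exact hmin U ⟨hUW.trans hWE, hU, u, hu, hu0, sub_eq_zero.1 h4⟩ (lt_of_le_of_ne hUW hU1)

/-- a common eigenvector of the centralizer of `t` -/
theorem exists_hw [IsAlgClosed F] [CharZero F] {G T : Subgroup (GL (Fin n) F)}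
    (hG : IsZClosed (G : Set (GL (Fin n) F))) (hT : IsMaximalTorus G T) {t : GL (Fin n) F}
    (hss : IsSemisimpleElem t)
    (hd : IsZClosure (Set.range fun k : ℤ => t ^ k) (T : Set (GL (Fin n) F)))
    {lam : F} (W : Submodule F (Fin n → F)) (hW : GStab G W)
    (hev : ∃ w ∈ W, w ≠ 0 ∧ t.1.mulVec w = lam • w) :
    ∃ v ∈ W, v ≠ 0 ∧ t.1.mulVec v = lam • v ∧ ∀ X ∈ zlie (G : Set (GL (Fin n) F)),
      t.1 * X = X * t.1 → ∃ a : F, X.mulVec v = a • v := by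
  let Z : LieSubalgebra F (Module.End F (Fin n → F)) :=
    { carrier := {f | f ∈ zlieEnd G ∧ Matrix.toLin' t.1 * f = f * Matrix.toLin' t.1}
      add_mem' := fun {a b} ha hb => ⟨(zlieEnd G).add_mem ha.1 hb.1, by rw [mul_add, add_mul, ha.2, hb.2]⟩
      zero_mem' := ⟨(zlieEnd G).zero_mem, by rw [mul_zero, zero_mul]⟩
      smul_mem' := fun c a ha => ⟨(zlieEnd G).smul_mem c ha.1, by
        rw [mul_smul_comm, smul_mul_assoc, ha.2]⟩
      lie_mem' := fun {a b} ha hb => ⟨(zlieEnd G).lie_mem ha.1 hb.1, by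
        rw [LieRing.of_associative_ring_bracket, mul_sub, sub_mul, ← mul_assoc, ha.2, ← mul_assoc, hb.2,
          mul_assoc, hb.2, mul_assoc b, ha.2, mul_assoc, mul_assoc]⟩ }
  have hZ : ∀ f, f ∈ Z ↔ f ∈ zlieEnd G ∧ Matrix.toLin' t.1 * f = f * Matrix.toLin' t.1 := fun _ => Iff.rfl
  have hact : ∀ (x : Z) (v : Fin n → F), ⁅x, v⁆ = (LinearMap.toMatrix' x.1).mulVec v := by
    intro x v
    rw [← Matrix.toLin'_apply, Matrix.toLin'_toMatrix']; rfl
  have hcm : ∀ x : Z, t.1 * LinearMap.toMatrix' x.1 = LinearMap.toMatrix' x.1 * t.1 := by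
    intro x
    have := congrArg LinearMap.toMatrix' x.2.2
    rwa [LinearMap.toMatrix'_mul, LinearMap.toMatrix'_mul, LinearMap.toMatrix'_toLin'] at this
  let U : LieSubmodule F Z (Fin n → F) :=
    { W ⊓ Module.End.eigenspace (Matrix.toLin' t.1) lam with
      lie_mem := by
        rintro x m ⟨hm1, hm2⟩
        have hm2' := Module.End.mem_eigenspace_iff.1 hm2
        rw [Matrix.toLin'_apply] at hm2'
        rw [hact]
        refine ⟨zlie_stable_of_stable G W hW _ x.2.1 m hm1, Module.End.mem_eigenspace_iff.2 ?_⟩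
        rw [Matrix.toLin'_apply, Matrix.mulVec_mulVec, hcm, ← Matrix.mulVec_mulVec, hm2', Matrix.mulVec_smul] }
  have hU : ∀ u, u ∈ U ↔ u ∈ W ∧ t.1.mulVec u = lam • u := by
    intro u
    rw [← Matrix.toLin'_apply, ← Module.End.mem_eigenspace_iff]; rfl
  obtain ⟨w, hwW, hw0, hwt⟩ := hev
  have hnt : Nontrivial U := ⟨⟨⟨w, (hU w).2 ⟨hwW, hwt⟩⟩, 0, fun h => hw0 (congrArg Subtype.val h)⟩⟩
  have hfd : FiniteDimensional F U :=
    inferInstanceAs (FiniteDimensional F (W ⊓ Module.End.eigenspace (Matrix.toLin' t.1) lam : Submodule F (Fin n → F)))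
  have hfz : FiniteDimensional F Z := inferInstanceAs (FiniteDimensional F Z.toSubmodule)
  obtain ⟨u, hu0, hu⟩ := common_eigen (K := F) (L := Z) (U := U) (by
    intro x a b u u' hu0 hu0' hua hub
    have h1 : ⁅x, (u : Fin n → F)⁆ = a • (u : Fin n → F) := congrArg Subtype.val hua
    have h2 : ⁅x, (u' : Fin n → F)⁆ = b • (u' : Fin n → F) := congrArg Subtype.val hub
    rw [hact] at h1 h2
    exact single_eigen hG hT hss hd x.2.1 (hcm x) (fun h => hu0 (Subtype.ext h)) (fun h => hu0' (Subtype.ext h))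
      ((hU _).1 u.2).2 ((hU _).1 u'.2).2 h1 h2)
  refine ⟨u, ((hU _).1 u.2).1, fun h => hu0 (Subtype.ext h), ((hU _).1 u.2).2, ?_⟩
  intro X hX hXt
  obtain ⟨a, ha⟩ := hu ⟨Matrix.toLin' X, (hZ _).2 ⟨by rw [mem_zlieEnd, LinearMap.toMatrix'_toLin']; exact hX, by
    rw [Module.End.mul_eq_comp, Module.End.mul_eq_comp, ← Matrix.toLin'_mul, ← Matrix.toLin'_mul, hXt]⟩⟩
  refine ⟨a, ?_⟩
  have h1 : ⁅(⟨Matrix.toLin' X, _⟩ : Z), (u : Fin n → F)⁆ = a • (u : Fin n → F) := congrArg Subtype.val ha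
  rw [hact, LinearMap.toMatrix'_toLin'] at h1
  exact h1

theorem eigen_ne_zero (t : GL (Fin n) F) {lam : F} {v : Fin n → F} (hv : v ≠ 0) (h : t.1.mulVec v = lam • v) :
    lam ≠ 0 := by
  rintro rfl
  apply hv
  have : (t⁻¹ : GL (Fin n) F).1.mulVec (t.1.mulVec v) = 0 := by rw [h, zero_smul, Matrix.mulVec_zero]
  rwa [Matrix.mulVec_mulVec, ← Units.val_mul, inv_mul_cancel, Units.val_one, Matrix.one_mulVec] at this

theorem hasEigenvalue_iff_exists (t : GL (Fin n) F) (lam : F) :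
    (Module.End.HasEigenvalue (Matrix.toLin' t.1) lam) ↔ ∃ v : Fin n → F, v ≠ 0 ∧ t.1.mulVec v = lam • v := by
  constructor
  · intro h
    obtain ⟨v, hv⟩ := h.exists_hasEigenvector
    have := hv.apply_eq_smul
    rw [Matrix.toLin'_apply] at this
    exact ⟨v, hv.2, this⟩
  · rintro ⟨v, hv, h⟩
    exact Module.End.hasEigenvalue_of_hasEigenvector (x := v)
      ⟨Module.End.mem_eigenspace_iff.2 (by rw [Matrix.toLin'_apply, h]), hv⟩

theorem exists_H [CharZero F] {T : Subgroup (GL (Fin n) F)} {t : GL (Fin n) F}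
    (hd : IsZClosure (Set.range fun k : ℤ => t ^ k) (T : Set (GL (Fin n) F)))
    (hconn : IsZConnected (T : Set (GL (Fin n) F))) :
    ∃ H : F → ℚ, (∀ a b, a ≠ 0 → b ≠ 0 → H (a * b) = H a + H b) ∧
      ∀ (a b : F) (v w : Fin n → F), v ≠ 0 → w ≠ 0 → t.1.mulVec v = a • v → t.1.mulVec w = b • w → H a = H b → a = b := by
  classical
  have hfin := Module.End.finite_hasEigenvalue (Matrix.toLin' t.1)
  let S : Finset (Additive Fˣ) := (hfin.preimage (f := fun x : Additive Fˣ => ((x.toMul : Fˣ) : F)) (by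
    intro a _ b _ h; exact congrArg Additive.ofMul (Units.ext h))).toFinset
  have hS : ∀ x : Additive Fˣ, x ∈ S ↔ ∃ v : Fin n → F, v ≠ 0 ∧ t.1.mulVec v = ((x.toMul : Fˣ) : F) • v := by
    intro x
    rw [Set.Finite.mem_toFinset]
    exact hasEigenvalue_iff_exists t _
  obtain ⟨h, hh⟩ := exists_height S (by
    intro a ha b hb m hm hab
    obtain ⟨v, hv, hva⟩ := (hS a).1 ha
    obtain ⟨w, hw, hwb⟩ := (hS b).1 hb
    have := torus_tf hd hconn hv hw hva hwb hm (by
      have := congrArg (fun x : Additive Fˣ => ((x.toMul : Fˣ) : F)) hab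
      simpa using this)
    exact congrArg Additive.ofMul (Units.ext this))
  refine ⟨fun a => if ha : a = 0 then 0 else h (Additive.ofMul (Units.mk0 a ha)), ?_, ?_⟩
  · intro a b ha hb
    simp only [ha, hb, mul_eq_zero, or_self, dite_false]
    rw [Units.mk0_mul _ _ (mul_ne_zero ha hb), ofMul_mul, map_add]
  · intro a b v w hv hw hva hwb hab
    have ha := eigen_ne_zero t hv hva
    have hb := eigen_ne_zero t hw hwb
    simp only [ha, hb, dite_false] at hab
    have := hh (Additive.ofMul (Units.mk0 a ha)) ((hS _).2 ⟨v, hv, hva⟩)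
      (Additive.ofMul (Units.mk0 b hb)) ((hS _).2 ⟨w, hw, hwb⟩) hab
    have := congrArg (fun x : Additive Fˣ => ((x.toMul : Fˣ) : F)) this
    simpa using this

end AlgGroup12

section AlgGroup13

variable {F : Type} [Field F] {n : ℕ}

theorem core_diag [IsAlgClosed F] [CharZero F] {G T : Subgroup (GL (Fin n) F)}
    (hG : IsZClosed (G : Set (GL (Fin n) F))) (hGc : IsZConnected (G : Set (GL (Fin n) F)))
    (hT : IsMaximalTorus G T) {t : GL (Fin n) F} (ht : t ∈ G) (hss : IsSemisimpleElem t)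
    (hd : IsZClosure (Set.range fun k : ℤ => t ^ k) (T : Set (GL (Fin n) F)))
    (W₁ W₂ : Submodule F (Fin n → F)) (h₁ : GStab G W₁) (h₂ : GStab G W₂) (hdis : Disjoint W₁ W₂)
    (hi₁ : ∀ U : Submodule F (Fin n → F), U ≤ W₁ → GStab G U → U = ⊥ ∨ U = W₁)
    (hi₂ : ∀ U : Submodule F (Fin n → F), U ≤ W₂ → GStab G U → U = ⊥ ∨ U = W₂)
    (hev : ∃ lam : F, ∃ w ∈ W₁, w ≠ 0 ∧ t.1.mulVec w = lam • w)
    (hsame : ∀ lam : F, (∃ w ∈ W₁, w ≠ 0 ∧ t.1.mulVec w = lam • w) ↔ ∃ w ∈ W₂, w ≠ 0 ∧ t.1.mulVec w = lam • w) :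
    ∃ N : Submodule F (Fin n → F), GStab G N ∧ N ≤ W₁ ⊔ W₂ ∧ N ⊓ W₁ = ⊥ ∧ N ⊓ W₂ = ⊥ ∧ N ≠ ⊥ := by
  obtain ⟨H, Hmul, Hinj⟩ := exists_H hd hT.2.1.2.1
  have hfin : {lam : F | ∃ w ∈ W₁, w ≠ 0 ∧ t.1.mulVec w = lam • w}.Finite :=
    (Module.End.finite_hasEigenvalue (Matrix.toLin' t.1)).subset (by
      rintro lam ⟨w, -, hw0, hw⟩
      exact (hasEigenvalue_iff_exists t lam).2 ⟨w, hw0, hw⟩)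
  obtain ⟨lam, hlam, hmax⟩ := Set.exists_max_image _ H hfin hev
  obtain ⟨v₁, hv₁W, hv₁0, hv₁t, hv₁X⟩ := exists_hw hG hT hss hd W₁ h₁ hlam
  obtain ⟨v₂, hv₂W, hv₂0, hv₂t, hv₂X⟩ := exists_hw hG hT hss hd W₂ h₂ ((hsame lam).1 hlam)
  have hlam0 : lam ≠ 0 := eigen_ne_zero t hv₁0 hv₁t
  -- homogeneous elements shift eigenspaces
  have shift : ∀ (X : Matrix (Fin n) (Fin n) F) (α μ : F) (u : Fin n → F), t.1 * X = α • (X * t.1) →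
      t.1.mulVec u = μ • u → t.1.mulVec (X.mulVec u) = (α * μ) • X.mulVec u := by
    intro X α μ u hX hu
    rw [Matrix.mulVec_mulVec, hX, Matrix.smul_mulVec, ← Matrix.mulVec_mulVec, hu, Matrix.mulVec_smul, smul_smul]
  -- raising operators kill
  have kill : ∀ (W : Submodule F (Fin n → F)), GStab G W →
      (∀ μ : F, (∃ w ∈ W, w ≠ 0 ∧ t.1.mulVec w = μ • w) → ∃ w ∈ W₁, w ≠ 0 ∧ t.1.mulVec w = μ • w) →
      ∀ X ∈ zlie (G : Set (GL (Fin n) F)), ∀ (α : F) (u : Fin n → F), u ∈ W →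
      t.1.mulVec u = lam • u → t.1 * X = α • (X * t.1) → α ≠ 1 → ¬ (α ≠ 0 ∧ H α < 0) → X.mulVec u = 0 := by
    intro W hW hWs X hX α u huW hut hXα hα1 hα
    by_contra hne
    have h1 := shift X α lam u hXα hut
    have hmem := hWs (α * lam) ⟨_, zlie_stable_of_stable G W hW X hX u huW, hne, h1⟩
    have hαl := eigen_ne_zero t hne h1
    have hα0 : α ≠ 0 := fun h => hαl (by rw [h, zero_mul])
    have h2 := hmax _ hmem
    rw [Hmul α lam hα0 hlam0] at h2
    have h3 : 0 ≤ H α := by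
      by_contra h; exact hα ⟨hα0, not_le.1 h⟩
    have h4 : H (α * lam) = H lam := by rw [Hmul α lam hα0 hlam0]; linarith
    have h5 := Hinj _ _ _ _ hne hv₁0 h1 hv₁t h4
    exact hα1 (mul_right_cancel₀ hlam0 (by rw [h5, one_mul]))
  set v := v₁ + v₂ with hv
  have hvt : t.1.mulVec v = lam • v := by rw [hv, Matrix.mulVec_add, hv₁t, hv₂t, smul_add]
  let PP : Set (Submodule F (Fin n → F)) := {M | v ∈ M ∧ ∀ Y ∈ zlie (G : Set (GL (Fin n) F)), ∀ α : F, α ≠ 0 → H α < 0 →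
    t.1 * Y = α • (Y * t.1) → ∀ u ∈ M, Y.mulVec u ∈ M}
  let N := sInf PP
  have hvN : v ∈ N := Submodule.mem_sInf.2 fun M hM => hM.1
  have hNY : ∀ Y ∈ zlie (G : Set (GL (Fin n) F)), ∀ α : F, α ≠ 0 → H α < 0 →
    t.1 * Y = α • (Y * t.1) → ∀ u ∈ N, Y.mulVec u ∈ N := by
    intro Y hY α hα0 hα hYα u hu
    exact Submodule.mem_sInf.2 fun M hM => hM.2 Y hY α hα0 hα hYα u (Submodule.mem_sInf.1 hu M hM)
  have hNle : ∀ M ∈ PP, N ≤ M := fun M hM => sInf_le hM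
  have hNlie : ∀ X ∈ zlie (G : Set (GL (Fin n) F)), ∀ u ∈ N, X.mulVec u ∈ N := by
    let S : Submodule F (Fin n → F) :=
      { carrier := {u | u ∈ N ∧ ∀ X ∈ zlie (G : Set (GL (Fin n) F)), X.mulVec u ∈ N}
        add_mem' := fun {a b} ha hb => ⟨N.add_mem ha.1 hb.1, fun X hX => by
          rw [Matrix.mulVec_add]; exact N.add_mem (ha.2 X hX) (hb.2 X hX)⟩
        zero_mem' := ⟨N.zero_mem, fun X hX => by rw [Matrix.mulVec_zero]; exact N.zero_mem⟩
        smul_mem' := fun c a ha => ⟨N.smul_mem c ha.1, fun X hX => by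
          rw [Matrix.mulVec_smul]; exact N.smul_mem c (ha.2 X hX)⟩ }
    have hS : S ∈ PP := by
      refine ⟨⟨hvN, ?_⟩, ?_⟩
      · refine zlie_homog G ht hss (P := fun X => X.mulVec v ∈ N) ?_ ?_ ?_
        · rw [Matrix.zero_mulVec]; exact N.zero_mem
        · intro X Y hX hY; rw [Matrix.add_mulVec]; exact N.add_mem hX hY
        · intro X hX α hXα
          by_cases hα1 : α = 1
          · have hXt : t.1 * X = X * t.1 := by rw [hXα, hα1, one_smul]
            obtain ⟨a, ha⟩ := hv₁X X hX hXt
            obtain ⟨b, hb⟩ := hv₂X X hX hXt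
            have hab := single_eigen hG hT hss hd hX hXt hv₁0 hv₂0 hv₁t hv₂t ha hb
            rw [hv, Matrix.mulVec_add, ha, hb, ← hab, ← smul_add]
            exact N.smul_mem a hvN
          · by_cases hα : α ≠ 0 ∧ H α < 0
            · exact hNY X hX α hα.1 hα.2 hXα v hvN
            · rw [hv, Matrix.mulVec_add, kill W₁ h₁ (fun μ h => h) X hX α v₁ hv₁W hv₁t hXα hα1 hα,
                kill W₂ h₂ (fun μ h => (hsame μ).2 h) X hX α v₂ hv₂W hv₂t hXα hα1 hα, add_zero]
              exact N.zero_mem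
      · intro Y hY α hα0 hα hYα u hu
        refine ⟨hNY Y hY α hα0 hα hYα u hu.1, fun X hX => ?_⟩
        have h1 := hNY Y hY α hα0 hα hYα _ (hu.2 X hX)
        have h2 := hu.2 _ (zlie_bracket G hX hY)
        rw [Matrix.sub_mulVec] at h2
        rw [Matrix.mulVec_mulVec] at h1 ⊢
        have := N.add_mem h2 h1
        rwa [sub_add_cancel] at this
    intro X hX u hu
    exact (hNle S hS hu).2 X hX
  have hNG : GStab G N := stable_of_zlie_stable G hGc N hNlie
  have hNsup : N ≤ W₁ ⊔ W₂ := by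
    refine hNle _ ⟨Submodule.add_mem_sup hv₁W hv₂W, ?_⟩
    intro Y hY α _ _ _ u hu
    obtain ⟨a, ha, b, hb, rfl⟩ := Submodule.mem_sup.1 hu
    rw [Matrix.mulVec_add]
    exact Submodule.add_mem_sup (zlie_stable_of_stable G W₁ h₁ Y hY a ha) (zlie_stable_of_stable G W₂ h₂ Y hY b hb)
  let L : Submodule F (Fin n → F) := ⨆ μ : F, ⨆ _ : H μ < H lam, Module.End.eigenspace (Matrix.toLin' t.1) μ
  have hLmem : ∀ (μ : F) (u : Fin n → F), H μ < H lam → t.1.mulVec u = μ • u → u ∈ L := by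
    intro μ u hμ hu
    exact Submodule.mem_iSup_of_mem μ (Submodule.mem_iSup_of_mem hμ
      (Module.End.mem_eigenspace_iff.2 (by rw [Matrix.toLin'_apply, hu])))
  have lower : ∀ Y ∈ zlie (G : Set (GL (Fin n) F)), ∀ α : F, α ≠ 0 → H α < 0 →
      t.1 * Y = α • (Y * t.1) → ∀ (μ : F) (u : Fin n → F), H μ ≤ H lam → t.1.mulVec u = μ • u → Y.mulVec u ∈ L := by
    intro Y hY α hα0 hα hYα μ u hμ hu
    by_cases hu0 : u = 0
    · rw [hu0, Matrix.mulVec_zero]; exact L.zero_mem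
    · refine hLmem (α * μ) _ ?_ (shift Y α μ u hYα hu)
      rw [Hmul α μ hα0 (eigen_ne_zero t hu0 hu)]; linarith
  have hNL : N ≤ Submodule.span F {v} ⊔ L := by
    refine hNle _ ⟨Submodule.mem_sup_left (Submodule.mem_span_singleton_self v), ?_⟩
    intro Y hY α hα0 hα hYα u hu
    obtain ⟨a, ha, b, hb, rfl⟩ := Submodule.mem_sup.1 hu
    obtain ⟨c, rfl⟩ := Submodule.mem_span_singleton.1 ha
    refine Submodule.mem_sup_right ?_
    rw [Matrix.mulVec_add, Matrix.mulVec_smul]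
    refine L.add_mem (L.smul_mem c (lower Y hY α hα0 hα hYα lam v le_rfl hvt)) ?_
    have hle : L ≤ L.comap (Matrix.toLin' Y) := by
      refine iSup_le fun μ => iSup_le fun hμ x hx => ?_
      rw [Submodule.mem_comap, Matrix.toLin'_apply]
      refine lower Y hY α hα0 hα hYα μ x hμ.le ?_
      have := Module.End.mem_eigenspace_iff.1 hx
      rwa [Matrix.toLin'_apply] at this
    have := hle hb
    rwa [Submodule.mem_comap, Matrix.toLin'_apply] at this
  have hNlam : ∀ u ∈ N, t.1.mulVec u = lam • u → ∃ c : F, u = c • v := by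
    intro u hu hut
    obtain ⟨a, ha, b, hb, rfl⟩ := Submodule.mem_sup.1 (hNL hu)
    obtain ⟨c, rfl⟩ := Submodule.mem_span_singleton.1 ha
    refine ⟨c, ?_⟩
    have hbt : t.1.mulVec b = lam • b := by
      rw [Matrix.mulVec_add, Matrix.mulVec_smul, hvt, smul_add lam (c • v) b, smul_comm c lam v] at hut
      exact add_left_cancel hut
    have hind := Module.End.eigenspaces_iSupIndep (Matrix.toLin' t.1) lam
    have hb0 := Submodule.disjoint_def.1 hind b (Module.End.mem_eigenspace_iff.2 (by rw [Matrix.toLin'_apply, hbt]))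
      ((iSup_mono fun μ => iSup_le fun hμ =>
        le_iSup_of_le (f := fun _ : μ ≠ lam => Module.End.eigenspace (Matrix.toLin' t.1) μ) (by rintro rfl; exact lt_irrefl _ hμ) le_rfl : L ≤ _) hb)
    rw [hb0, add_zero]
  have hdj := Submodule.disjoint_def.1 hdis
  refine ⟨N, hNG, hNsup, ?_, ?_, ?_⟩
  · rcases hi₁ (N ⊓ W₁) inf_le_right (fun g hg w hw => ⟨hNG g hg w hw.1, h₁ g hg w hw.2⟩) with h | h
    · exact h
    · exfalso
      rw [inf_eq_right] at h
      obtain ⟨c, hc⟩ := hNlam v₁ (h hv₁W) hv₁t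
      have h3 : c • v₂ = v₁ - c • v₁ := by rw [eq_sub_iff_add_eq, add_comm, ← smul_add]; exact hc.symm
      have h4 := hdj _ (by rw [h3]; exact W₁.sub_mem hv₁W (W₁.smul_mem c hv₁W)) (W₂.smul_mem c hv₂W)
      have hc0 := (smul_eq_zero.1 h4).resolve_right hv₂0
      rw [hc0, zero_smul] at hc
      exact hv₁0 hc
  · rcases hi₂ (N ⊓ W₂) inf_le_right (fun g hg w hw => ⟨hNG g hg w hw.1, h₂ g hg w hw.2⟩) with h | h
    · exact h
    · exfalso
      rw [inf_eq_right] at h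
      obtain ⟨c, hc⟩ := hNlam v₂ (h hv₂W) hv₂t
      have h3 : c • v₁ = v₂ - c • v₂ := by rw [eq_sub_iff_add_eq, ← smul_add]; exact hc.symm
      have h4 := hdj _ (W₁.smul_mem c hv₁W) (by rw [h3]; exact W₂.sub_mem hv₂W (W₂.smul_mem c hv₂W))
      have hc0 := (smul_eq_zero.1 h4).resolve_right hv₁0
      rw [hc0, zero_smul] at hc
      exact hv₂0 hc
  · intro h
    rw [h, Submodule.mem_bot] at hvN
    refine hv₁0 (hdj _ hv₁W ?_)
    rw [eq_neg_of_add_eq_zero_left hvN]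
    exact W₂.neg_mem hv₂W

theorem core_map [IsAlgClosed F] [CharZero F] {G G12 : Subgroup (GL (Fin n) F)} (hred : IsReductive G12)
    (hG : IsIdentityComponent G G12) (W₁ W₂ N : Submodule F (Fin n → F)) (h₂ : GStab G W₂)
    (hN : GStab G N) (hle : N ≤ W₁ ⊔ W₂) (hN1 : N ⊓ W₁ = ⊥) (hN2 : N ⊓ W₂ = ⊥) (hN0 : N ≠ ⊥) :
    ∃ φ : (Fin n → F) →ₗ[F] (Fin n → F), (∀ g ∈ G, ∀ v, φ (g.1.mulVec v) = g.1.mulVec (φ v)) ∧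
      (∀ v, φ v ∈ W₂) ∧ ∃ v ∈ W₁, φ v ≠ 0 := by
  obtain ⟨C, hC, hcompl⟩ := exists_group_compl G hred hG (W₂ ⊔ N) (by
    intro g hg w hw
    obtain ⟨a, ha, b, hb, rfl⟩ := Submodule.mem_sup.1 hw
    rw [Matrix.mulVec_add]
    exact Submodule.add_mem_sup (h₂ g hg a ha) (hN g hg b hb))
  have hcm : IsCompl W₂ (N ⊔ C) := by
    refine ⟨?_, ?_⟩
    · exact (disjoint_iff.2 (by rw [inf_comm]; exact hN2)).disjoint_sup_right_of_disjoint_sup_left hcompl.disjoint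
    · rw [codisjoint_iff, ← sup_assoc]; exact hcompl.sup_eq_top
  have hNC : GStab G (N ⊔ C) := by
    intro g hg w hw
    obtain ⟨a, ha, b, hb, rfl⟩ := Submodule.mem_sup.1 hw
    rw [Matrix.mulVec_add]
    exact Submodule.add_mem_sup (hN g hg a ha) (hC g hg b hb)
  let φ : (Fin n → F) →ₗ[F] (Fin n → F) := W₂.subtype ∘ₗ W₂.projectionOnto (N ⊔ C) hcm
  have hφ1 : ∀ w ∈ W₂, φ w = w := fun w hw =>
    congrArg Subtype.val (Submodule.projectionOnto_apply_left hcm ⟨w, hw⟩)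
  have hφ2 : ∀ w ∈ N ⊔ C, φ w = 0 := fun w hw =>
    congrArg Subtype.val ((Submodule.projectionOnto_apply_eq_zero_iff hcm).2 hw)
  refine ⟨φ, ?_, fun v => (W₂.projectionOnto (N ⊔ C) hcm v).2, ?_⟩
  · intro g hg v
    have hv : v ∈ W₂ ⊔ (N ⊔ C) := by rw [hcm.sup_eq_top]; trivial
    obtain ⟨a, ha, b, hb, rfl⟩ := Submodule.mem_sup.1 hv
    rw [Matrix.mulVec_add, map_add, map_add, hφ1 a ha, hφ2 b hb, hφ1 _ (h₂ g hg a ha), hφ2 _ (hNC g hg b hb),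
      add_zero, add_zero]
  · obtain ⟨x, hx, hx0⟩ := Submodule.exists_mem_ne_zero_of_ne_bot hN0
    obtain ⟨a, ha, b, hb, rfl⟩ := Submodule.mem_sup.1 (hle hx)
    refine ⟨a, ha, fun h => ?_⟩
    have h1 := hφ2 _ (Submodule.mem_sup_left hx)
    rw [map_add, h, hφ1 b hb, zero_add] at h1
    rw [h1, add_zero] at hx hx0
    exact hx0 ((Submodule.mem_bot F).1 (hN1 ▸ (⟨hx, ha⟩ : a ∈ N ⊓ W₁)))

end AlgGroup13

section AlgGroup14

variable {F : Type} [Field F] {n : ℕ}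

theorem core_final [IsAlgClosed F] [CharZero F] {G G12 T : Subgroup (GL (Fin n) F)} (hred : IsReductive G12)
    (hG : IsIdentityComponent G G12) (hT : IsMaximalTorus G T) {t : GL (Fin n) F} (ht : t ∈ G) (hss : IsSemisimpleElem t)
    (hd : IsZClosure (Set.range fun k : ℤ => t ^ k) (T : Set (GL (Fin n) F)))
    (E₁ E₂ : Submodule F (Fin n → F)) (h₁ : GStab G E₁) (h₂ : GStab G E₂) (hdis : Disjoint E₁ E₂)
    (hM₁ : ∀ W : Submodule F (Fin n → F), W ≤ E₁ → GStab G W →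
      (∀ U : Submodule F (Fin n → F), U ≤ W → GStab G U → U = ⊥ ∨ U = W) → ∀ a b : F,
      (∃ w ∈ W, w ≠ 0 ∧ t.1.mulVec w = a • w) → (∃ w ∈ W, w ≠ 0 ∧ t.1.mulVec w = b • w) →
      ∃ w ∈ G, ∀ v : Fin n → F, t.1.mulVec v = a • v → t.1.mulVec (w.1.mulVec v) = b • w.1.mulVec v)
    (hM₂ : ∀ W : Submodule F (Fin n → F), W ≤ E₂ → GStab G W →
      (∀ U : Submodule F (Fin n → F), U ≤ W → GStab G U → U = ⊥ ∨ U = W) → ∀ a b : F,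
      (∃ w ∈ W, w ≠ 0 ∧ t.1.mulVec w = a • w) → (∃ w ∈ W, w ≠ 0 ∧ t.1.mulVec w = b • w) →
      ∃ w ∈ G, ∀ v : Fin n → F, t.1.mulVec v = a • v → t.1.mulVec (w.1.mulVec v) = b • w.1.mulVec v)
    {lam : F} {v₁ v₂ : Fin n → F} (hv₁ : v₁ ∈ E₁) (hv₂ : v₂ ∈ E₂) (hv₁0 : v₁ ≠ 0) (hv₂0 : v₂ ≠ 0)
    (hv₁t : t.1.mulVec v₁ = lam • v₁) (hv₂t : t.1.mulVec v₂ = lam • v₂) :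
    ∃ φ : (Fin n → F) →ₗ[F] (Fin n → F), (∀ g ∈ G, ∀ v, φ (g.1.mulVec v) = g.1.mulVec (φ v)) ∧
      (∀ v, φ v ∈ E₂) ∧ ∃ v ∈ E₁, φ v ≠ 0 := by
  obtain ⟨W₁, hW₁E, hW₁G, hW₁i, hW₁v⟩ := exists_irred hred hG ht E₁ h₁ hv₁ hv₁0 hv₁t
  obtain ⟨W₂, hW₂E, hW₂G, hW₂i, hW₂v⟩ := exists_irred hred hG ht E₂ h₂ hv₂ hv₂0 hv₂t
  have inj : ∀ (w : GL (Fin n) F) (x : Fin n → F), x ≠ 0 → w.1.mulVec x ≠ 0 := by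
    intro w x hx h
    exact eigen_ne_zero w hx (lam := 0) (by rw [h, zero_smul]) rfl
  have hsame : ∀ μ : F, (∃ w ∈ W₁, w ≠ 0 ∧ t.1.mulVec w = μ • w) ↔ ∃ w ∈ W₂, w ≠ 0 ∧ t.1.mulVec w = μ • w := by
    intro μ
    constructor
    · intro h
      obtain ⟨w, hw, hwv⟩ := hM₁ W₁ hW₁E hW₁G hW₁i lam μ hW₁v h
      obtain ⟨x, hx, hx0, hxt⟩ := hW₂v
      exact ⟨_, hW₂G w hw x hx, inj w x hx0, hwv x hxt⟩
    · intro h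
      obtain ⟨w, hw, hwv⟩ := hM₂ W₂ hW₂E hW₂G hW₂i lam μ hW₂v h
      obtain ⟨x, hx, hx0, hxt⟩ := hW₁v
      exact ⟨_, hW₁G w hw x hx, inj w x hx0, hwv x hxt⟩
  obtain ⟨N, hNG, hNle, hN1, hN2, hN0⟩ := core_diag hG.2.1 hG.2.2.1 hT ht hss hd W₁ W₂ hW₁G hW₂G
    (hdis.mono hW₁E hW₂E) hW₁i hW₂i ⟨lam, hW₁v⟩ hsame
  obtain ⟨φ, hφ, hφ2, v, hv, hv0⟩ := core_map hred hG W₁ W₂ N hW₂G hNG hNle hN1 hN2 hN0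
  exact ⟨φ, hφ, fun v => hW₂E (hφ2 v), v, hW₁E hv, hv0⟩

theorem minuscule_transfer {G T : Subgroup (GL (Fin n) F)} (hTG : T ≤ G) {t : GL (Fin n) F}
    (hd : IsZClosure (Set.range fun k : ℤ => t ^ k) (T : Set (GL (Fin n) F))) {m : ℕ}
    (ρ : G →* GL (Fin m) F) (hmin : IsMinuscule G T ρ) (ι : (Fin m → F) →ₗ[F] (Fin n → F))
    (hinj : Function.Injective ι) (hι : ∀ (g : G) (v : Fin m → F), ι ((ρ g).1.mulVec v) = g.1.1.mulVec (ι v))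
    (W : Submodule F (Fin n → F)) (hWE : W ≤ LinearMap.range ι) (hW : GStab G W)
    (hi : ∀ U : Submodule F (Fin n → F), U ≤ W → GStab G U → U = ⊥ ∨ U = W) (a b : F)
    (ha : ∃ w ∈ W, w ≠ 0 ∧ t.1.mulVec w = a • w) (hb : ∃ w ∈ W, w ≠ 0 ∧ t.1.mulVec w = b • w) :
    ∃ w ∈ G, ∀ v : Fin n → F, t.1.mulVec v = a • v → t.1.mulVec (w.1.mulVec v) = b • w.1.mulVec v := by
  obtain ⟨x, hxW, hx0, hxt⟩ := ha
  obtain ⟨y, hyW, hy0, hyt⟩ := hb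
  obtain ⟨x', rfl⟩ := hWE hxW
  obtain ⟨y', rfl⟩ := hWE hyW
  obtain ⟨l, hl⟩ := exists_dual_one hx0
  obtain ⟨k, hk⟩ := exists_dual_one hy0
  have htT : t ∈ T := hd.2.1 ⟨1, by simp⟩
  have hirr : IsIrreducibleOn ρ (W.comap ι) := by
    refine ⟨?_, ?_, ?_⟩
    · intro h
      have : x' ∈ W.comap ι := hxW
      rw [h, Submodule.mem_bot] at this
      exact hx0 (by rw [this, map_zero])
    · intro g v hv
      rw [Submodule.mem_comap, hι]
      exact hW g.1 g.2 _ hv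
    · intro U' hU' hinv
      have h1 : GStab G (U'.map ι) := by
        rintro g hg _ ⟨u, hu, rfl⟩
        exact ⟨_, hinv ⟨g, hg⟩ u hu, hι ⟨g, hg⟩ u⟩
      rcases hi (U'.map ι) (Submodule.map_le_iff_le_comap.2 hU') h1 with h | h
      · left
        rw [Submodule.eq_bot_iff]
        intro u hu
        have : ι u ∈ U'.map ι := ⟨u, hu, rfl⟩
        rw [h, Submodule.mem_bot] at this
        exact hinj (by rw [this, map_zero])
      · right
        rw [← h, Submodule.comap_map_eq_of_injective hinj]
  obtain ⟨w, hwG, hwN, hw⟩ := hmin _ hirr (fun τ => l (τ.1.mulVec (ι x'))) (fun τ => k (τ.1.mulVec (ι y'))) x' y'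
    ⟨hxW, fun h => hx0 (by rw [h, map_zero]), fun τ hτ => hinj (by
      rw [hι, map_smul]; exact torus_scalar hd hx0 hxt l hl hτ hxt)⟩
    ⟨hyW, fun h => hy0 (by rw [h, map_zero]), fun τ hτ => hinj (by
      rw [hι, map_smul]; exact torus_scalar hd hy0 hyt k hk hτ hyt)⟩
  refine ⟨w⁻¹, G.inv_mem hwG, fun v hv => ?_⟩
  have hwt : w * t * w⁻¹ ∈ T := (Subgroup.mem_normalizer_iff.1 hwN t).1 htT
  have h1 := torus_scalar hd hx0 hxt l hl hwt hv
  have h2 := hw t htT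
  rw [← h2, hyt, map_smul, hk, smul_eq_mul, mul_one] at h1
  rw [← Matrix.mulVec_smul, ← h1, Matrix.mulVec_mulVec, Matrix.mulVec_mulVec, ← Units.val_mul, ← Units.val_mul]
  congr 2
  group

variable {m₁ m₂ : ℕ}

/-- block action -/
theorem blk_mulVec (A : Matrix (Fin m₁) (Fin m₁) F) (B : Matrix (Fin m₂) (Fin m₂) F) (x : Fin (m₁ + m₂) → F) :
    (Matrix.reindex finSumFinEquiv finSumFinEquiv (Matrix.fromBlocks A 0 0 B)).mulVec x =
      fun k => Sum.elim (A.mulVec fun i => x (finSumFinEquiv (Sum.inl i))) (B.mulVec fun j => x (finSumFinEquiv (Sum.inr j)))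
        (finSumFinEquiv.symm k) := by
  rw [Matrix.reindex_apply, Matrix.submatrix_mulVec_equiv, Matrix.fromBlocks_mulVec]
  funext k
  simp only [Function.comp_apply, Equiv.symm_symm, Matrix.zero_mulVec, add_zero, zero_add]
  rfl

/-- first inclusion -/
def inc₁ : (Fin m₁ → F) →ₗ[F] (Fin (m₁ + m₂) → F) where
  toFun u := fun k => Sum.elim u (fun _ => 0) (finSumFinEquiv.symm k)
  map_add' u v := by funext k; rcases h : finSumFinEquiv.symm k with i | i <;> simp [h]
  map_smul' c v := by funext k; rcases h : finSumFinEquiv.symm k with i | i <;> simp [h]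

/-- second inclusion -/
def inc₂ : (Fin m₂ → F) →ₗ[F] (Fin (m₁ + m₂) → F) where
  toFun u := fun k => Sum.elim (fun _ => 0) u (finSumFinEquiv.symm k)
  map_add' u v := by funext k; rcases h : finSumFinEquiv.symm k with i | i <;> simp [h]
  map_smul' c v := by funext k; rcases h : finSumFinEquiv.symm k with i | i <;> simp [h]

/-- first projection -/
def prj₁ : (Fin (m₁ + m₂) → F) →ₗ[F] (Fin m₁ → F) where
  toFun x := fun i => x (finSumFinEquiv (Sum.inl i))
  map_add' u v := rfl
  map_smul' c v := rfl

/-- second projection -/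
def prj₂ : (Fin (m₁ + m₂) → F) →ₗ[F] (Fin m₂ → F) where
  toFun x := fun i => x (finSumFinEquiv (Sum.inr i))
  map_add' u v := rfl
  map_smul' c v := rfl

theorem prj₁_inc₁ (u : Fin m₁ → F) : prj₁ (m₂ := m₂) (inc₁ u) = u := by
  funext i; simp only [prj₁, inc₁, LinearMap.coe_mk, AddHom.coe_mk, Equiv.symm_apply_apply, Sum.elim_inl]

theorem prj₂_inc₂ (u : Fin m₂ → F) : prj₂ (m₁ := m₁) (inc₂ u) = u := by
  funext i; simp only [prj₂, inc₂, LinearMap.coe_mk, AddHom.coe_mk, Equiv.symm_apply_apply, Sum.elim_inr]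

theorem prj₁_inc₂ (u : Fin m₂ → F) : prj₁ (m₁ := m₁) (inc₂ u) = 0 := by
  funext i; simp only [prj₁, inc₂, LinearMap.coe_mk, AddHom.coe_mk, Equiv.symm_apply_apply, Sum.elim_inl]; rfl

theorem prj₂_inc₁ (u : Fin m₁ → F) : prj₂ (m₂ := m₂) (inc₁ u) = 0 := by
  funext i; simp only [prj₂, inc₁, LinearMap.coe_mk, AddHom.coe_mk, Equiv.symm_apply_apply, Sum.elim_inr]; rfl

theorem blk_eq (A : Matrix (Fin m₁) (Fin m₁) F) (B : Matrix (Fin m₂) (Fin m₂) F) (x : Fin (m₁ + m₂) → F) :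
    (Matrix.reindex finSumFinEquiv finSumFinEquiv (Matrix.fromBlocks A 0 0 B)).mulVec x =
      inc₁ (A.mulVec (prj₁ x)) + inc₂ (B.mulVec (prj₂ x)) := by
  rw [blk_mulVec]
  funext k
  rcases h : finSumFinEquiv.symm k with i | i <;> simp [h, inc₁, inc₂, prj₁, prj₂]

/-- eigenvectors span the image of an equivariant surjection -/
theorem eigen_top_image {n m : ℕ} (S : Module.End F (Fin n → F)) (S' : Module.End F (Fin m → F))
    (p : (Fin n → F) →ₗ[F] (Fin m → F)) (hp : ∀ x, p (S x) = S' (p x)) (hs : Function.Surjective p)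
    (hS : ⨆ μ, S.eigenspace μ = ⊤) : ⨆ μ, S'.eigenspace μ = ⊤ := by
  rw [eq_top_iff, ← LinearMap.range_eq_top.2 hs, ← Submodule.map_top, ← hS, Submodule.map_iSup]
  refine iSup_mono fun μ => ?_
  rintro _ ⟨x, hx, rfl⟩
  rw [Module.End.mem_eigenspace_iff, ← hp, Module.End.mem_eigenspace_iff.1 hx, map_smul]

theorem common_eigenvalue {n m : ℕ} (S : Module.End F (Fin n → F)) (S' : Module.End F (Fin m → F))
    (hS : ⨆ μ, S.eigenspace μ = ⊤) (hS' : ⨆ μ, S'.eigenspace μ = ⊤) (f : (Fin n → F) →ₗ[F] (Fin m → F)) (hf : f ≠ 0)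
    (k : ℕ) (hc : ∀ v, f ((S ^ k) v) = (S' ^ k) (f v)) :
    ∃ (a b : F) (u : Fin n → F) (x : Fin m → F), u ≠ 0 ∧ x ≠ 0 ∧ S u = a • u ∧ S' x = b • x ∧ a ^ k = b ^ k := by
  have hpow : ∀ {n : ℕ} (S : Module.End F (Fin n → F)) (a : F) (u : Fin n → F), S u = a • u → ∀ k : ℕ,
      (S ^ k) u = a ^ k • u := by
    intro n S a u h k
    induction k with
    | zero => simp
    | succ k ih => rw [pow_succ, Module.End.mul_apply, h, map_smul, ih, smul_smul, pow_succ, mul_comm]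
  have h1 : ∃ (a : F) (u : Fin n → F), S u = a • u ∧ f u ≠ 0 := by
    by_contra hcon
    push Not at hcon
    apply hf
    have : ⨆ μ, S.eigenspace μ ≤ LinearMap.ker f :=
      iSup_le fun μ x hx => hcon μ x (Module.End.mem_eigenspace_iff.1 hx)
    rw [hS] at this
    exact LinearMap.ker_eq_top.1 (top_le_iff.1 this)
  obtain ⟨a, u, hu, hfu⟩ := h1
  let K := (S' ^ k).eigenspace (a ^ k)
  have hK : f u ∈ K := by
    rw [Module.End.mem_eigenspace_iff, ← hc, hpow S a u hu, map_smul]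
  have hKs : ∀ x ∈ K, S' x ∈ K := by
    intro x hx
    have hx' := Module.End.mem_eigenspace_iff.1 hx
    rw [Module.End.mem_eigenspace_iff, ← Module.End.mul_apply, ← pow_succ, pow_succ', Module.End.mul_apply, hx', map_smul]
  have hdec := Submodule.eq_iSup_inf_genEigenspace (p := K) (f := S') 1 hKs hS'
  have h2 : ∃ b, K ⊓ S'.eigenspace b ≠ ⊥ := by
    by_contra hcon
    push Not at hcon
    have : K = ⊥ := by
      rw [hdec, iSup_eq_bot]; exact hcon
    rw [this, Submodule.mem_bot] at hK
    exact hfu hK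
  obtain ⟨b, hb⟩ := h2
  obtain ⟨x, hx, hx0⟩ := Submodule.exists_mem_ne_zero_of_ne_bot hb
  have hxb := Module.End.mem_eigenspace_iff.1 hx.2
  refine ⟨a, b, u, x, fun h => hfu (by rw [h, map_zero]), hx0, hu, hxb, ?_⟩
  have h3 := Module.End.mem_eigenspace_iff.1 hx.1
  rw [hpow S' b x hxb] at h3
  exact (smul_left_injective F hx0 h3).symm

end AlgGroup14

/-- Main theorem, Tate-module version: `V₁, V₂` representations of a
group `Γ` over an algebraically closed field `F` of characteristic 0 such that the
Zariski closure `G₁₂` of the image of `Γ` in `GL(V₁ ⊕ V₂)` is reductive with identity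
component `G`, and `V₁, V₂` restricted to `G` are minuscule.  If some semisimple `t ∈ G`
generates a Zariski-dense subgroup of a maximal torus `T` of `G` and for some `m ≥ 1`
we have `Hom(V₁,V₂)^{t^m} ≠ 0`, then `Hom_G(V₁,V₂) ≠ 0`. -/
theorem stmt_14 {F : Type} [Field F] [IsAlgClosed F] [CharZero F] {m₁ m₂ : ℕ}
    (Γ : Type) [Group Γ]
    (ρ₁ : Γ →* GL (Fin m₁) F) (ρ₂ : Γ →* GL (Fin m₂) F)
    (ρ₁₂ : Γ →* GL (Fin (m₁ + m₂)) F)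
    -- `ρ₁₂` is the block-diagonal joint action of `Γ` on `V₁ ⊕ V₂`:
    (hblk : ∀ γ : Γ, ((ρ₁₂ γ : GL (Fin (m₁ + m₂)) F) : Matrix (Fin (m₁ + m₂)) (Fin (m₁ + m₂)) F)
      = Matrix.reindex finSumFinEquiv finSumFinEquiv
          (Matrix.fromBlocks
            ((ρ₁ γ : GL (Fin m₁) F) : Matrix (Fin m₁) (Fin m₁) F) 0 0
            ((ρ₂ γ : GL (Fin m₂) F) : Matrix (Fin m₂) (Fin m₂) F)))
    (G12 G T : Subgroup (GL (Fin (m₁ + m₂)) F))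
    -- `G₁₂` is the Zariski closure of the image of `Γ`:
    (hcl : IsZClosure (Set.range fun γ : Γ => ρ₁₂ γ) (G12 : Set (GL (Fin (m₁ + m₂)) F)))
    (hred : IsReductive G12)
    -- `G` is its identity component:
    (hG : IsIdentityComponent G G12) (hle : G ≤ G12)
    -- `π₁, π₂` are the actions of `G₁₂` on the two blocks `V₁`, `V₂`:
    (π₁ : G12 →* GL (Fin m₁) F) (π₂ : G12 →* GL (Fin m₂) F)
    (hπ : ∀ g : G12, ((g : GL (Fin (m₁ + m₂)) F) : Matrix (Fin (m₁ + m₂)) (Fin (m₁ + m₂)) F)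
      = Matrix.reindex finSumFinEquiv finSumFinEquiv
          (Matrix.fromBlocks
            ((π₁ g : GL (Fin m₁) F) : Matrix (Fin m₁) (Fin m₁) F) 0 0
            ((π₂ g : GL (Fin m₂) F) : Matrix (Fin m₂) (Fin m₂) F)))
    -- `V₁`, `V₂` restricted to `G` are minuscule, `T` a maximal torus of `G`:
    (hT : IsMaximalTorus G T)
    (hmin₁ : IsMinuscule G T ((π₁.comp (Subgroup.inclusion hle))))
    (hmin₂ : IsMinuscule G T ((π₂.comp (Subgroup.inclusion hle))))
    -- a semisimple `t ∈ G` generating a Zariski-dense subgroup of `T`: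
    (t : G12) (htG : (t : GL (Fin (m₁ + m₂)) F) ∈ G)
    (hss : IsSemisimpleElem (t : GL (Fin (m₁ + m₂)) F))
    (hdense : IsZClosure (Set.range fun k : ℤ => ((t : GL (Fin (m₁ + m₂)) F)) ^ k)
      (T : Set (GL (Fin (m₁ + m₂)) F)))
    -- `Hom(V₁,V₂)^{t^m} ≠ 0` for some `m ≥ 1`:
    (m : ℕ) (hm : 1 ≤ m)
    (f : (Fin m₁ → F) →ₗ[F] (Fin m₂ → F)) (hf : f ≠ 0)
    (hft : ∀ v : Fin m₁ → F,
      f (Matrix.mulVec ((π₁ (t ^ m) : GL (Fin m₁) F) : Matrix (Fin m₁) (Fin m₁) F) v) =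
        Matrix.mulVec ((π₂ (t ^ m) : GL (Fin m₂) F) : Matrix (Fin m₂) (Fin m₂) F) (f v)) :
    -- then `Hom_G(V₁, V₂) ≠ 0`:
    ∃ f' : (Fin m₁ → F) →ₗ[F] (Fin m₂ → F), f' ≠ 0 ∧
      ∀ g : G12, (g : GL (Fin (m₁ + m₂)) F) ∈ G → ∀ v : Fin m₁ → F,
        f' (Matrix.mulVec ((π₁ g : GL (Fin m₁) F) : Matrix (Fin m₁) (Fin m₁) F) v) =
          Matrix.mulVec ((π₂ g : GL (Fin m₂) F) : Matrix (Fin m₂) (Fin m₂) F) (f' v) := by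
  have hg : ∀ (g : G12) (x : Fin (m₁ + m₂) → F), g.1.1.mulVec x =
      inc₁ ((π₁ g).1.mulVec (prj₁ x)) + inc₂ ((π₂ g).1.mulVec (prj₂ x)) := by
    intro g x
    have h := hπ g
    have h' := blk_eq ((π₁ g).1) ((π₂ g).1) x
    rw [← h'] 
    exact congrArg (fun M => Matrix.mulVec M x) h
  have hi₁ : ∀ (g : G12) (v : Fin m₁ → F),
      inc₁ (m₂ := m₂) ((π₁ g).1.mulVec v) = g.1.1.mulVec (inc₁ v) := by
    intro g v
    rw [hg, prj₁_inc₁, prj₂_inc₁, Matrix.mulVec_zero, map_zero, add_zero]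
  have hi₂ : ∀ (g : G12) (v : Fin m₂ → F),
      inc₂ (m₁ := m₁) ((π₂ g).1.mulVec v) = g.1.1.mulVec (inc₂ v) := by
    intro g v
    rw [hg, prj₁_inc₂, prj₂_inc₂, Matrix.mulVec_zero, map_zero, zero_add]
  have hp₁ : ∀ (g : G12) (x : Fin (m₁ + m₂) → F), prj₁ (g.1.1.mulVec x) = (π₁ g).1.mulVec (prj₁ x) := by
    intro g x
    rw [hg, map_add, prj₁_inc₁, prj₁_inc₂, add_zero]
  have hp₂ : ∀ (g : G12) (x : Fin (m₁ + m₂) → F), prj₂ (g.1.1.mulVec x) = (π₂ g).1.mulVec (prj₂ x) := by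
    intro g x
    rw [hg, map_add, prj₂_inc₁, prj₂_inc₂, zero_add]
  have hinj₁ : Function.Injective (inc₁ (F := F) (m₁ := m₁) (m₂ := m₂)) :=
    Function.LeftInverse.injective prj₁_inc₁
  have hinj₂ : Function.Injective (inc₂ (F := F) (m₁ := m₁) (m₂ := m₂)) :=
    Function.LeftInverse.injective prj₂_inc₂
  have hs₁ : Function.Surjective (prj₁ (F := F) (m₁ := m₁) (m₂ := m₂)) := fun u => ⟨_, prj₁_inc₁ u⟩
  have hs₂ : Function.Surjective (prj₂ (F := F) (m₁ := m₁) (m₂ := m₂)) := fun u => ⟨_, prj₂_inc₂ u⟩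
  have htop := eigen_top_of_semisimple hss
  have hS₁ := eigen_top_image _ (Matrix.toLin' (π₁ t).1) prj₁
    (fun x => by rw [Matrix.toLin'_apply, Matrix.toLin'_apply]; exact hp₁ t x) hs₁ htop
  have hS₂ := eigen_top_image _ (Matrix.toLin' (π₂ t).1) prj₂
    (fun x => by rw [Matrix.toLin'_apply, Matrix.toLin'_apply]; exact hp₂ t x) hs₂ htop
  obtain ⟨a, b, u, x, hu0, hx0, hu, hx, hab⟩ := common_eigenvalue _ _ hS₁ hS₂ f hf m (fun v => by
    have h := hft v
    rw [map_pow, map_pow, Units.val_pow_eq_pow_val, Units.val_pow_eq_pow_val] at h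
    rw [← Matrix.toLin'_pow, ← Matrix.toLin'_pow, Matrix.toLin'_apply, Matrix.toLin'_apply]
    exact h)
  rw [Matrix.toLin'_apply] at hu hx
  have hu' : t.1.1.mulVec (inc₁ u) = a • (inc₁ u : Fin (m₁ + m₂) → F) := by rw [← hi₁, hu, map_smul]
  have hx' : t.1.1.mulVec (inc₂ x) = b • (inc₂ x : Fin (m₁ + m₂) → F) := by rw [← hi₂, hx, map_smul]
  have hu0' : (inc₁ u : Fin (m₁ + m₂) → F) ≠ 0 := fun h => hu0 (hinj₁ (by rw [h, map_zero]))
  have hx0' : (inc₂ x : Fin (m₁ + m₂) → F) ≠ 0 := fun h => hx0 (hinj₂ (by rw [h, map_zero]))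
  have hab' : a = b := torus_tf hdense hT.2.1.2.1 hu0' hx0' hu' hx' hm hab
  subst hab'
  have hdis : Disjoint (LinearMap.range (inc₁ (F := F) (m₁ := m₁) (m₂ := m₂)))
      (LinearMap.range (inc₂ (F := F) (m₁ := m₁) (m₂ := m₂))) := by
    rw [Submodule.disjoint_def]
    rintro _ ⟨y, rfl⟩ ⟨z, hz⟩
    have h : y = 0 := by rw [← prj₁_inc₁ (m₂ := m₂) y, ← hz, prj₁_inc₂]
    rw [h, map_zero]
  obtain ⟨φ, hφ, hφr, v, ⟨y, rfl⟩, hv⟩ := core_final hred hG hT htG hss hdense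
    (LinearMap.range (inc₁ (F := F) (m₁ := m₁) (m₂ := m₂)))
    (LinearMap.range (inc₂ (F := F) (m₁ := m₁) (m₂ := m₂)))
    (by rintro g hgG _ ⟨y, rfl⟩; exact ⟨_, hi₁ ⟨g, hle hgG⟩ y⟩)
    (by rintro g hgG _ ⟨y, rfl⟩; exact ⟨_, hi₂ ⟨g, hle hgG⟩ y⟩)
    hdis
    (fun W hWE hW hi c d hc hd => minuscule_transfer hT.1 hdense _ hmin₁ inc₁ hinj₁
      (fun g v => hi₁ (Subgroup.inclusion hle g) v) W hWE hW hi c d hc hd)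
    (fun W hWE hW hi c d hc hd => minuscule_transfer hT.1 hdense _ hmin₂ inc₂ hinj₂
      (fun g v => hi₂ (Subgroup.inclusion hle g) v) W hWE hW hi c d hc hd)
    ⟨u, rfl⟩ ⟨x, rfl⟩ hu0' hx0' hu' hx'
  refine ⟨prj₂ ∘ₗ φ ∘ₗ inc₁, ?_, ?_⟩
  · intro h
    apply hv
    obtain ⟨z, hz⟩ := hφr (inc₁ y)
    have h1 : prj₂ (φ (inc₁ y)) = 0 := LinearMap.congr_fun h y
    rw [← hz, prj₂_inc₂] at h1
    rw [← hz, h1, map_zero]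
  · intro g hgG w
    change prj₂ (φ (inc₁ ((π₁ g).1.mulVec w))) = (π₂ g).1.mulVec (prj₂ (φ (inc₁ w)))
    rw [hi₁, hφ g.1 hgG, hp₂]
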